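/- arXiv:2604.10888 — 11 statements merged into one kernel-verified Lean document; each statement's English description precedes it below -/
import Mathlib

section
/- Let G = SL₂(F_q) with q a prime power, and let χ be a complex irreducible character of G. Then there exists an element g ∈ G such that ℚ(χ) = ℚ(χ(g)), i.e., the field of values of χ is generated over ℚ by a single character value. -/
open CategoryTheory

/-- `z` is a complex root of unity. -/
def IsRootOfUnity (z : ℂ) : Prop := ∃ n : ℕ, 0 < n ∧ z ^ n = 1

/-- The `n`-th cyclotomic field `ℚ(ζ_n)`, realized as the subfield of `ℂ` generated by
all `n`-th roots of unity. -/
noncomputable def cycField (n : ℕ) : Subfield ℂ := Subfield.closure {z : ℂ | z ^ n = 1}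

/-- The conductor of a set `S` of cyclotomic integers: the smallest positive integer `n`
such that `S ⊆ ℚ(ζ_n)`. -/
noncomputable def conductorOf (S : Set ℂ) : ℕ := sInf {n : ℕ | 0 < n ∧ S ⊆ (cycField n : Set ℂ)}

section Fourier

variable {A : Type*} [AddCommGroup A] [Fintype A]

theorem fourier_inversion (f : A → ℂ) (a : AddChar A ℂ → ℂ)
    (h : ∀ ψ : AddChar A ℂ, ∑ x, f x * ψ (-x) = Fintype.card A * a ψ) (x : A) :
    f x = ∑ ψ, a ψ * ψ x := by
  classical
  have hc : (Fintype.card A : ℂ) ≠ 0 := Nat.cast_ne_zero.2 Fintype.card_ne_zero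
  apply mul_left_cancel₀ hc
  calc (Fintype.card A : ℂ) * f x
      = ∑ y, f y * ∑ ψ : AddChar A ℂ, ψ (x - y) := by
        simp [AddChar.sum_apply_eq_ite, sub_eq_zero, mul_comm]
    _ = ∑ ψ : AddChar A ℂ, (∑ y, f y * ψ (-y)) * ψ x := by
        simp_rw [Finset.mul_sum, Finset.sum_mul]
        rw [Finset.sum_comm]
        refine Finset.sum_congr rfl fun ψ _ => Finset.sum_congr rfl fun y _ => ?_
        rw [sub_eq_add_neg, AddChar.map_add_eq_mul]
        ring
    _ = _ := by
        simp_rw [h, Finset.mul_sum, mul_assoc]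

theorem fourier_parseval (f : A → ℂ) (a : AddChar A ℂ → ℂ)
    (h : ∀ ψ : AddChar A ℂ, ∑ x, f x * ψ (-x) = Fintype.card A * a ψ) :
    ∑ x, f x * f (-x) = Fintype.card A * ∑ ψ, a ψ ^ 2 := by
  calc ∑ x, f x * f (-x) = ∑ x, f x * ∑ ψ, a ψ * ψ (-x) :=
        Finset.sum_congr rfl fun x _ => by rw [← fourier_inversion f a h]
    _ = ∑ ψ, a ψ * ∑ x, f x * ψ (-x) := by
        simp_rw [Finset.mul_sum]
        rw [Finset.sum_comm]
        refine Finset.sum_congr rfl fun ψ _ => Finset.sum_congr rfl fun y _ => by ring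
    _ = _ := by
        simp_rw [h, Finset.mul_sum]
        refine Finset.sum_congr rfl fun ψ _ => by ring

theorem fourier_coeff_neg (f : A → ℂ) (hf : ∀ x, f (-x) = f x) (a : AddChar A ℂ → ℂ)
    (h : ∀ ψ : AddChar A ℂ, ∑ x, f x * ψ (-x) = Fintype.card A * a ψ) (ψ : AddChar A ℂ) :
    a (-ψ) = a ψ := by
  have hc : (Fintype.card A : ℂ) ≠ 0 := Nat.cast_ne_zero.2 Fintype.card_ne_zero
  apply mul_left_cancel₀ hc
  rw [← h, ← h, ← Equiv.sum_comp (Equiv.neg A)]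
  simp [hf, AddChar.neg_apply]

/-- An even integral combination of characters with square norm at most `2` is either
integer valued or, up to sign, the sum of a character and its inverse. -/
theorem even_combination_norm_le_two (a : AddChar A ℂ → ℤ) (ha : ∀ ψ, a (-ψ) = a ψ)
    (h2 : ∑ ψ, a ψ ^ 2 ≤ 2) :
    (∀ x, ∃ n : ℤ, ∑ ψ, (a ψ : ℂ) * ψ x = n) ∨
    (2 ≤ ∑ ψ, a ψ ^ 2 ∧ ∃ (ψ : AddChar A ℂ) (c : ℤ), c ^ 2 = 1 ∧
      ∀ x, ∑ φ, (a φ : ℂ) * φ x = c * (ψ x + (ψ x)⁻¹)) := by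
  classical
  by_cases hs : ∀ ψ, a ψ ≠ 0 → -ψ = ψ
  · left
    intro x
    have key : ∀ ψ, ∃ n : ℤ, (a ψ : ℂ) * ψ x = n := by
      intro ψ
      by_cases h0 : a ψ = 0
      · exact ⟨0, by simp [h0]⟩
      · have h1 : (ψ x)⁻¹ = ψ x := by
          rw [← AddChar.neg_apply', hs ψ h0]
        have hne : ψ x ≠ 0 := (ψ.val_isUnit x).ne_zero
        have h3 : ψ x * ψ x = 1 := by nth_rw 1 [← h1]; exact inv_mul_cancel₀ hne
        rcases mul_self_eq_one_iff.1 h3 with h | h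
        · exact ⟨a ψ, by simp [h]⟩
        · exact ⟨-a ψ, by simp [h]⟩
    choose n hn using key
    exact ⟨∑ ψ, n ψ, by push_cast; exact Finset.sum_congr rfl fun ψ _ => hn ψ⟩
  · right
    push Not at hs
    obtain ⟨ψ, h0, hne⟩ := hs
    have hsplit : ∑ φ, a φ ^ 2 =
        a ψ ^ 2 + (a (-ψ) ^ 2 + ∑ φ ∈ (Finset.univ.erase ψ).erase (-ψ), a φ ^ 2) := by
      rw [Finset.add_sum_erase _ (fun φ => a φ ^ 2) (by simp [hne]),
        Finset.add_sum_erase _ (fun φ => a φ ^ 2) (by simp)]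
    have hnn : ∀ φ ∈ (Finset.univ.erase ψ).erase (-ψ), 0 ≤ a φ ^ 2 := fun φ _ => sq_nonneg _
    have hpos : 1 ≤ a ψ ^ 2 := by have : 0 < a ψ ^ 2 := by positivity
                                  omega
    have hr := Finset.sum_nonneg hnn
    rw [ha ψ] at hsplit
    have hz : ∑ φ ∈ (Finset.univ.erase ψ).erase (-ψ), a φ ^ 2 = 0 := by omega
    rw [Finset.sum_eq_zero_iff_of_nonneg hnn] at hz
    refine ⟨by omega, ψ, a ψ, by omega, fun x => ?_⟩
    rw [← Finset.add_sum_erase _ _ (Finset.mem_univ ψ),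
      ← Finset.add_sum_erase _ _ (show -ψ ∈ Finset.univ.erase ψ by simp [hne]), ha,
      AddChar.neg_apply', Finset.sum_eq_zero]
    · ring
    · intro φ hφ
      have := hz φ hφ
      simp at this
      simp [this]

end Fourier

theorem pow_add_inv_pow_mem_adjoin (w : ℂ) (hw : w ≠ 0) (n : ℕ) :
    w ^ n + (w ^ n)⁻¹ ∈ IntermediateField.adjoin ℚ {w + w⁻¹} := by
  induction n using Nat.twoStepInduction with
  | zero => exact add_mem (by simp) (by simp)
  | one => simpa using IntermediateField.mem_adjoin_simple_self ℚ _
  | more n h0 h1 =>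
    have : w ^ (n + 2) + (w ^ (n + 2))⁻¹ =
        (w ^ (n + 1) + (w ^ (n + 1))⁻¹) * (w + w⁻¹) - (w ^ n + (w ^ n)⁻¹) := by
      field_simp
      ring
    rw [this]
    exact sub_mem (mul_mem h1 (IntermediateField.mem_adjoin_simple_self ℚ _)) h0

section Character

variable {G : Type*} [Group G] {V : Type*} [AddCommGroup V] [Module ℂ V] [FiniteDimensional ℂ V]
  (ρ : Representation ℂ G V)

/-- The multiplicity of a linear character of a finite abelian group in the pullback of a
representation is a natural number. -/
theorem exists_multiplicity {A : Type*} [AddCommGroup A] [Fintype A] (φ : Multiplicative A →* G)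
    (ψ : AddChar A ℂ) :
    ∃ n : ℕ, ∑ x : A, ρ.character (φ (.ofAdd x)) * ψ (-x) = Fintype.card A * n := by
  classical
  let σ : Representation ℂ (Multiplicative A) V :=
    { toFun := fun x => (-ψ) x.toAdd • ρ (φ x)
      map_one' := by simp
      map_mul' := fun x y => by
        rw [map_mul φ, map_mul ρ, toAdd_mul, AddChar.map_add_eq_mul, smul_mul_smul_comm] }
  have hc : (Nat.card (Multiplicative A) : ℂ) ≠ 0 := Nat.cast_ne_zero.2 Nat.card_pos.ne'
  let _ : Invertible (Nat.card (Multiplicative A) : ℂ) := invertibleOfNonzero hc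
  have h := σ.card_inv_mul_sum_char_eq_finrank
  rw [inv_mul_eq_iff_eq_mul₀ hc] at h
  refine ⟨_, Eq.trans ?_ (h.trans (by rw [Nat.card_congr Multiplicative.toAdd,
    Nat.card_eq_fintype_card]))⟩
  refine Fintype.sum_equiv Multiplicative.ofAdd _ _ fun x => ?_
  simp [Representation.character, σ, AddChar.neg_apply, mul_comm]

/-- The value of a character is a natural-number combination of roots of unity. -/
theorem exists_character_eq_sum [Finite G] (g : G) :
    ∃ (ι : Type) (_ : Fintype ι) (c : ι → ℕ) (z : ι → ℂ),
      (∀ i, ∃ n : ℕ, 0 < n ∧ z i ^ n = 1) ∧ ρ.character g = ∑ i, c i * z i ∧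
      ρ.character g⁻¹ = ∑ i, c i * (z i)⁻¹ := by
  classical
  have hn : 0 < orderOf g := orderOf_pos g
  have : NeZero (orderOf g) := ⟨hn.ne'⟩
  let φ : Multiplicative (ZMod (orderOf g)) →* G :=
    AddMonoidHom.toMultiplicativeLeft
      (ZMod.lift (orderOf g) ⟨(zmultiplesHom (Additive G)) (Additive.ofMul g), by
        simp [← ofMul_pow, pow_orderOf_eq_one]⟩)
  have hφ : φ (.ofAdd 1) = g := by
    have := ZMod.lift_coe (orderOf g) (A := Additive G)
      ⟨(zmultiplesHom (Additive G)) (Additive.ofMul g), by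
        simp [← ofMul_pow, pow_orderOf_eq_one]⟩ 1
    simp at this
    simp [φ, this]
  choose a ha using exists_multiplicity ρ φ
  have hinv := fourier_inversion (fun x => ρ.character (φ (.ofAdd x))) (fun ψ => (a ψ : ℂ)) ha
  refine ⟨AddChar (ZMod (orderOf g)) ℂ, inferInstance, a, fun ψ => ψ 1, ?_, ?_, ?_⟩
  · intro ψ
    refine ⟨orderOf g, hn, ?_⟩
    rw [← AddChar.map_nsmul_eq_pow]
    simp
  · simpa [hφ] using hinv 1
  · simpa [hφ, AddChar.map_neg_eq_inv] using hinv (-1)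

theorem character_inv_eq_conj [Finite G] (g : G) :
    ρ.character g⁻¹ = (starRingEnd ℂ) (ρ.character g) := by
  obtain ⟨ι, _, c, z, hz, h1, h2⟩ := exists_character_eq_sum ρ g
  rw [h1, h2, map_sum]
  refine Finset.sum_congr rfl fun i _ => ?_
  obtain ⟨n, hn, h⟩ := hz i
  rw [map_mul, map_natCast, Complex.inv_eq_conj (Complex.norm_eq_one_of_pow_eq_one h hn.ne')]

theorem character_isIntegral [Finite G] (g : G) : IsIntegral ℤ (ρ.character g) := by
  obtain ⟨ι, _, c, z, hz, h1, -⟩ := exists_character_eq_sum ρ g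
  rw [h1]
  refine IsIntegral.sum _ fun i _ => ?_
  obtain ⟨n, hn, h⟩ := hz i
  refine IsIntegral.mul (by simpa using isIntegral_algebraMap (R := ℤ) (A := ℂ) (x := (c i : ℤ))) ?_
  exact IsIntegral.of_pow hn (h ▸ isIntegral_one)

/-- A central involution acts on the character of an irreducible representation by a sign. -/
theorem character_central_involution [Fintype G]
    (hρ : ∑ g, ρ.character g * ρ.character g⁻¹ = Fintype.card G)
    (z : G) (hz : ∀ g, z * g = g * z) (hz2 : z * z = 1) :
    ∃ ω : ℂ, (ω = 1 ∨ ω = -1) ∧ ∀ g, ρ.character (z * g) = ω * ρ.character g := by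
  have hc : (Nat.card G : ℂ) ≠ 0 := Nat.cast_ne_zero.2 Nat.card_pos.ne'
  let _ : Invertible (Nat.card G : ℂ) := invertibleOfNonzero hc
  have hfin : Module.finrank ℂ (Representation.IntertwiningMap ρ ρ) = 1 := by
    have h := Representation.card_inv_mul_sum_char_mul_char_eq_finrank ρ ρ
    rw [hρ, ← Nat.card_eq_fintype_card, inv_mul_cancel₀ hc] at h
    exact_mod_cast h.symm
  let idm : Representation.IntertwiningMap ρ ρ := 1
  let T : Representation.IntertwiningMap ρ ρ := ⟨ρ z, fun g => by
    rw [← Module.End.mul_eq_comp, ← Module.End.mul_eq_comp, ← map_mul, ← map_mul, hz]⟩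
  have hid : idm ≠ 0 := by
    intro h
    have : ∀ f : Representation.IntertwiningMap ρ ρ, f = 0 := fun f => by
      rw [← mul_one f]
      change f * idm = 0
      rw [h, mul_zero]
    have : Subsingleton (Representation.IntertwiningMap ρ ρ) := ⟨fun f g => by rw [this f, this g]⟩
    rw [Module.finrank_zero_of_subsingleton] at hfin
    exact zero_ne_one hfin
  obtain ⟨c, hT⟩ := (finrank_eq_one_iff_of_nonzero' idm hid).1 hfin T
  have hcz : ρ z = c • (1 : Module.End ℂ V) := by
    have := congrArg Representation.IntertwiningMap.toLinearMap hT
    exact this.symm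
  have h1 : (1 : Module.End ℂ V) ≠ 0 := fun h => hid (Representation.IntertwiningMap.ext h)
  have hsq : c * c = 1 := by
    have h : ρ z * ρ z = 1 := by rw [← map_mul, hz2, map_one]
    rw [hcz, smul_mul_smul_comm, mul_one] at h
    have h' : (c * c - 1) • (1 : Module.End ℂ V) = 0 := by rw [sub_smul, h, one_smul, sub_self]
    exact sub_eq_zero.1 ((smul_eq_zero.1 h').resolve_right h1)
  refine ⟨c, mul_self_eq_one_iff.1 hsq, fun g => ?_⟩
  simp [Representation.character, hcz]

end Character

section SpecialLinear

open Matrix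

variable {F : Type*} [Field F]

local notation "SL₂" => Matrix.SpecialLinearGroup (Fin 2)

theorem coe_injective_SL2 {g h : SL₂ F}
    (H : (g : Matrix (Fin 2) (Fin 2) F) = (h : Matrix (Fin 2) (Fin 2) F)) : g = h :=
  Subtype.ext H

/-- The companion matrix of `X² - τX + 1`. -/
def companion (τ : F) : SL₂ F := ⟨!![0, -1; 1, τ], by simp [det_fin_two]⟩

/-- The upper unitriangular matrix with off-diagonal entry `b`. -/
def upper (b : F) : SL₂ F := ⟨!![1, b; 0, 1], by simp [det_fin_two]⟩

/-- The upper triangular matrix with diagonal entries `x`, `x⁻¹`. -/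
def borelElt (x : Fˣ) (b : F) : SL₂ F := ⟨!![(x : F), b; 0, (x⁻¹ : Fˣ)], by simp [det_fin_two]⟩

/-- The matrix of determinant one with diagonal entries `a`, `d` and lower left entry `c`. -/
def bigCell (c : Fˣ) (a d : F) : SL₂ F :=
  ⟨!![a, (a * d - 1) * (c⁻¹ : Fˣ); c, d], by simp [det_fin_two]⟩

@[simp]
theorem coe_companion (τ : F) : (companion τ : Matrix (Fin 2) (Fin 2) F) = !![0, -1; 1, τ] := rfl

@[simp]
theorem coe_upper (b : F) : (upper b : Matrix (Fin 2) (Fin 2) F) = !![1, b; 0, 1] := rfl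

@[simp]
theorem coe_borelElt (x : Fˣ) (b : F) :
    (borelElt x b : Matrix (Fin 2) (Fin 2) F) = !![(x : F), b; 0, (x⁻¹ : Fˣ)] := rfl

@[simp]
theorem coe_bigCell (c : Fˣ) (a d : F) : (bigCell c a d : Matrix (Fin 2) (Fin 2) F) =
    !![a, (a * d - 1) * (c⁻¹ : Fˣ); c, d] := rfl

/-- The diagonal torus. -/
def splitTorus : Fˣ →* SL₂ F where
  toFun x := borelElt x 0
  map_one' := by ext i j; fin_cases i <;> fin_cases j <;> simp
  map_mul' x y := by
    ext i j; fin_cases i <;> fin_cases j <;> simp [mul_comm]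

/-- The unipotent radical of the Borel subgroup. -/
def upperHom : Multiplicative F →* SL₂ F where
  toFun x := upper x.toAdd
  map_one' := by ext i j; fin_cases i <;> fin_cases j <;> simp
  map_mul' x y := by
    ext i j; fin_cases i <;> fin_cases j <;> simp [add_comm]

@[simp]
theorem coe_splitTorus (x : Fˣ) :
    (splitTorus x : Matrix (Fin 2) (Fin 2) F) = !![(x : F), 0; 0, (x⁻¹ : Fˣ)] := rfl

theorem exists_quadratic_form_eq_one [Fintype F] (a b c d : F)
    (h : (d - a) ^ 2 + 4 * b * c ≠ 0) :
    ∃ x y : F, c * x ^ 2 + (d - a) * x * y - b * y ^ 2 = 1 := by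
  by_cases hc : c = 0
  · have hda : d - a ≠ 0 := by
      rintro h0
      apply h
      simp [hc, h0]
    refine ⟨(1 + b) / (d - a), 1, ?_⟩
    rw [hc]
    field_simp
    ring
  by_cases h2 : ringChar F = 2
  · obtain ⟨s, hs⟩ := FiniteField.isSquare_of_char_two h2 c⁻¹
    refine ⟨s, 0, ?_⟩
    have : c * s ^ 2 = 1 := by rw [pow_two, ← hs, mul_inv_cancel₀ hc]
    simp [this]
  · have h2' : (2 : F) ≠ 0 := Ring.two_ne_zero h2
    have hodd := FiniteField.odd_card_of_char_ne_two h2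
    obtain ⟨X, Y, hXY⟩ := FiniteField.exists_root_sum_quadratic
      (f := Polynomial.X ^ 2 - Polynomial.C (4 * c))
      (g := Polynomial.C (-((d - a) ^ 2 + 4 * b * c)) * Polynomial.X ^ 2)
      (by compute_degree!) (Polynomial.degree_C_mul_X_pow 2 (neg_ne_zero.2 h)) hodd
    simp at hXY
    refine ⟨(X - (d - a) * Y) / (2 * c), Y, ?_⟩
    field_simp
    linear_combination hXY

/-- Elements of `SL₂` over a finite field with given trace `τ`, `τ² ≠ 4`, are conjugate. -/
theorem exists_conj_companion [Fintype F] (g : SL₂ F) (h : g.1.trace ^ 2 ≠ 4) :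
    ∃ P : SL₂ F, g = P * companion g.1.trace * P⁻¹ := by
  have hdet := g.2
  rw [det_fin_two] at hdet
  rw [trace_fin_two] at h ⊢
  obtain ⟨x, y, hxy⟩ := exists_quadratic_form_eq_one (g.1 0 0) (g.1 0 1) (g.1 1 0) (g.1 1 1)
    (fun h0 => h (by linear_combination h0 + 4 * hdet))
  obtain ⟨P, hP⟩ : ∃ P : SL₂ F,
      P.1 = !![x, g.1 0 0 * x + g.1 0 1 * y; y, g.1 1 0 * x + g.1 1 1 * y] :=
    ⟨⟨_, by rw [det_fin_two_of]; linear_combination hxy⟩, rfl⟩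
  refine ⟨P, eq_mul_inv_iff_mul_eq.2 (coe_injective_SL2 ?_)⟩
  change g.1 * P.1 = P.1 * (companion (g.1 0 0 + g.1 1 1)).1
  rw [hP, coe_companion]
  ext i j
  fin_cases i <;> fin_cases j <;> simp [mul_apply, Fin.sum_univ_two]
  · linear_combination -x * hdet
  · linear_combination -y * hdet

theorem upper_conj (t : Fˣ) (b : F) :
    upper ((t : F) ^ 2 * b) = splitTorus t * upper b * (splitTorus t)⁻¹ := by
  refine eq_mul_inv_iff_mul_eq.2 (coe_injective_SL2 ?_)
  change (upper ((t : F) ^ 2 * b)).1 * (splitTorus t).1 = (splitTorus t).1 * (upper b).1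
  rw [coe_upper, coe_upper, coe_splitTorus]
  ext i j
  fin_cases i <;> fin_cases j <;> simp [mul_apply, Fin.sum_univ_two]
  field_simp

theorem bigCell_conj (c : Fˣ) (a : F) :
    ∃ P : SL₂ F, bigCell c a (2 - a) = P * upper (-(c : F)) * P⁻¹ := by
  obtain ⟨P, hP⟩ : ∃ P : SL₂ F, P.1 = !![(a - 1) * (c⁻¹ : Fˣ), -1; 1, 0] :=
    ⟨⟨_, by simp [det_fin_two_of]⟩, rfl⟩
  refine ⟨P, eq_mul_inv_iff_mul_eq.2 (coe_injective_SL2 ?_)⟩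
  change (bigCell c a (2 - a)).1 * P.1 = P.1 * (upper (-(c : F))).1
  rw [hP, coe_bigCell, coe_upper]
  ext i j
  fin_cases i <;> fin_cases j <;> simp [mul_apply, Fin.sum_univ_two]
  all_goals field_simp
  all_goals ring

/-- Summation over `SL₂` by the Bruhat decomposition. -/
theorem sum_specialLinear [Fintype F] [DecidableEq F] {M : Type*} [AddCommMonoid M]
    (φ : SL₂ F → M) :
    ∑ g, φ g = (∑ x : Fˣ, ∑ b, φ (borelElt x b)) + ∑ c : Fˣ, ∑ a, ∑ d, φ (bigCell c a d) := by
  let e : (Fˣ × F) ⊕ (Fˣ × F × F) → SL₂ F :=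
    Sum.elim (fun p => borelElt p.1 p.2) (fun p => bigCell p.1 p.2.1 p.2.2)
  have he : Function.Bijective e := by
    constructor
    · rintro (⟨x, b⟩ | ⟨c, a, d⟩) (⟨x', b'⟩ | ⟨c', a', d'⟩) h
      all_goals
        simp only [e, Sum.elim_inl, Sum.elim_inr] at h
        have h00 := congrArg (fun g : SL₂ F => g.1 0 0) h
        have h01 := congrArg (fun g : SL₂ F => g.1 0 1) h
        have h10 := congrArg (fun g : SL₂ F => g.1 1 0) h
        have h11 := congrArg (fun g : SL₂ F => g.1 1 1) h
        simp at h00 h01 h10 h11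
      · simp_all [Units.ext_iff]
      · exact absurd h10.symm c'.ne_zero
      · simp_all [Units.ext_iff]
    · intro g
      have hdet := g.2
      rw [det_fin_two] at hdet
      by_cases hc : g.1 1 0 = 0
      · rw [hc, mul_zero, sub_zero] at hdet
        refine ⟨Sum.inl (⟨g.1 0 0, g.1 1 1, hdet, by rw [mul_comm]; exact hdet⟩, g.1 0 1), ?_⟩
        ext i j
        fin_cases i <;> fin_cases j <;> simp [e, hc]
      · refine ⟨Sum.inr (Units.mk0 _ hc, g.1 0 0, g.1 1 1), ?_⟩
        ext i j
        fin_cases i <;> fin_cases j <;> simp [e]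
        rw [← div_eq_mul_inv, div_eq_iff hc]
        linear_combination hdet
  rw [← (Equiv.ofBijective e he).sum_comp, Fintype.sum_sum_type]
  simp [e, Fintype.sum_prod_type]

theorem sum_trace [Fintype F] [DecidableEq F] (Ψ : F → ℂ) :
    ∑ g : SL₂ F, Ψ g.1.trace =
      Fintype.card F * ((Fintype.card F - 1) * ∑ τ, Ψ τ + ∑ x : Fˣ, Ψ (x + (x⁻¹ : Fˣ))) := by
  have hcard : (Fintype.card Fˣ : ℂ) = Fintype.card F - 1 := by
    rw [Fintype.card_units, Nat.cast_sub Fintype.card_pos, Nat.cast_one]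
  have hd : ∀ a : F, ∑ d, Ψ (a + d) = ∑ τ, Ψ τ := fun a => Equiv.sum_comp (Equiv.addLeft a) Ψ
  rw [sum_specialLinear]
  simp [trace_fin_two, hd, hcard, ← Finset.mul_sum]
  ring

theorem sum_eq_zero_add_sum_units [Fintype F] [DecidableEq F] {M : Type*} [AddCommMonoid M]
    (f : F → M) : ∑ b, f b = f 0 + ∑ b : Fˣ, f b := by
  rw [← Finset.add_sum_erase _ _ (Finset.mem_univ (0 : F))]
  congr 1
  symm
  refine Finset.sum_bij (fun b _ => (b : F)) (by simp) (by simp [Units.ext_iff])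
    (fun b hb => ⟨Units.mk0 b (by simpa using hb), by simp⟩) (by simp)

theorem upper_zero : upper (0 : F) = 1 := coe_injective_SL2 (by simp [one_fin_two])

theorem sum_trace_eq_two [Fintype F] [DecidableEq F] (φ : SL₂ F → ℂ)
    (hφ : ∀ g h : SL₂ F, φ (h * g * h⁻¹) = φ g) :
    ∑ g : SL₂ F, (if g.1.trace = 2 then φ g else 0) =
      φ 1 + (Fintype.card F + 1) * ∑ b : Fˣ, φ (upper b) := by
  rw [sum_specialLinear]
  have h1 : ∀ x : Fˣ, ∑ b, (if (borelElt x b).1.trace = 2 then φ (borelElt x b) else 0) =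
      if x = 1 then ∑ b, φ (upper b) else 0 := by
    intro x
    have : ∀ b, (borelElt x b).1.trace = 2 ↔ x = 1 := by
      intro b
      rw [trace_fin_two]
      constructor
      · intro h
        simp at h
        have h3 : ((x : F) - 1) ^ 2 = 0 := by
          field_simp at h
          linear_combination h
        exact Units.ext (by simpa [sub_eq_zero] using h3)
      · rintro rfl
        simp
        norm_num
    simp only [this]
    split_ifs with hx
    · subst hx
      refine Finset.sum_congr rfl fun b _ => congrArg φ ?_
      ext i j
      fin_cases i <;> fin_cases j <;> simp
    · simp
  have h2 : ∀ (c : Fˣ) (a : F),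
      ∑ d, (if (bigCell c a d).1.trace = 2 then φ (bigCell c a d) else 0) = φ (upper (-c)) := by
    intro c a
    have : ∀ d, (bigCell c a d).1.trace = 2 ↔ d = 2 - a := by
      intro d
      rw [trace_fin_two]
      simp [eq_sub_iff_add_eq, add_comm]
    simp only [this, Finset.sum_ite_eq', Finset.mem_univ, if_true]
    obtain ⟨P, hP⟩ := bigCell_conj c a
    rw [hP, hφ]
  have h3 : ∑ b : F, φ (upper b) = φ 1 + ∑ b : Fˣ, φ (upper b) := by
    rw [sum_eq_zero_add_sum_units, upper_zero]
  have h4 : ∑ c : Fˣ, φ (upper (-(c : F))) = ∑ b : Fˣ, φ (upper b) := by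
    rw [← Equiv.sum_comp (Equiv.neg Fˣ)]
    simp
  simp only [h1, h2]
  simp [h3, h4, ← Finset.mul_sum]
  ring

end SpecialLinear

section NonsplitTorus

open Matrix

local notation "SL₂" => Matrix.SpecialLinearGroup (Fin 2)

theorem eq_or_eq_inv_of_add_inv_eq {K : Type*} [Field K] {x y : K} (hx : x ≠ 0) (hy : y ≠ 0)
    (h : x + x⁻¹ = y + y⁻¹) : x = y ∨ x = y⁻¹ := by
  field_simp at h
  have h2 : (x - y) * (x * y - 1) = 0 := by linear_combination h
  rcases mul_eq_zero.1 h2 with h3 | h3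
  · exact .inl (sub_eq_zero.1 h3)
  · exact .inr (eq_inv_of_mul_eq_one_left (sub_eq_zero.1 h3))

theorem sq_eq_one_of_add_inv_sq_eq_four {K : Type*} [Field K] {x : K} (hx : x ≠ 0)
    (h : (x + x⁻¹) ^ 2 = 4) : x ^ 2 = 1 := by
  field_simp at h
  have h2 : (x ^ 2 - 1) ^ 2 = 0 := by linear_combination h
  exact sub_eq_zero.1 (pow_eq_zero_iff two_ne_zero |>.1 h2)

theorem card_fiber_eq_two {Z F K : Type*} [Fintype Z] [Fintype F] [DecidableEq F] [Field K]
    (side : Z → Bool) (r : Z → K) (t : Z → F)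
    (hside : ∀ z z', side z = side z' → r z = r z' → z = z')
    (hr : ∀ z z', r z = r z' → side z ≠ side z' → r z = (r z)⁻¹)
    (ht : ∀ z z', t z = t z' → r z' = r z ∨ r z' = (r z)⁻¹)
    (hcard : Fintype.card Z = 2 * Fintype.card F) (τ : F) :
    (Finset.univ.filter fun z => t z = τ).card = 2 := by
  classical
  have hle : ∀ τ, (Finset.univ.filter fun z => t z = τ).card ≤ 2 := by
    intro τ
    by_contra! h
    obtain ⟨a, ha, b, hb, c, hc, hab, hac, hbc⟩ := Finset.two_lt_card.1 h
    simp only [Finset.mem_filter, Finset.mem_univ, true_and] at ha hb hc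
    have hab' := ht a b (ha.trans hb.symm)
    have hac' := ht a c (ha.trans hc.symm)
    by_cases hra : r a = (r a)⁻¹
    · rw [← hra, or_self] at hab' hac'
      have h1 := fun h => hab (hside a b h hab'.symm)
      have h2 := fun h => hac (hside a c h hac'.symm)
      have h3 := fun h => hbc (hside b c h (hab'.trans hac'.symm))
      revert h1 h2 h3
      cases side a <;> cases side b <;> cases side c <;> simp
    · have key : ∀ x y, (r x = r a ∨ r x = (r a)⁻¹) → r x = r y → x = y := by
        intro x y hx hxy
        by_contra hne
        have h1 := hr x y hxy fun h => hne (hside x y h hxy)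
        rcases hx with hx | hx
        · rw [hx] at h1
          exact hra h1
        · rw [hx, inv_inv] at h1
          exact hra h1.symm
      rcases hab' with hab' | hab'
      · exact hab (key a b (.inl rfl) hab'.symm)
      rcases hac' with hac' | hac'
      · exact hac (key a c (.inl rfl) hac'.symm)
      exact hbc (key b c (.inr hab') (hab'.trans hac'.symm))
  have hsum : ∑ τ, (Finset.univ.filter fun z => t z = τ).card = ∑ _τ : F, 2 := by
    rw [← Finset.card_eq_sum_card_fiberwise (fun _ _ => Finset.mem_coe.2 (Finset.mem_univ _))]
    simp [hcard, mul_comm]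
  exact (Finset.sum_eq_sum_iff_of_le fun τ _ => hle τ).1 hsum τ (Finset.mem_univ τ)

variable {F : Type*} [Field F]

/-- The action of the elements of norm one of a quadratic extension by multiplication. -/
noncomputable def normOneHom {K : Type*} [Field K] [Algebra F K] (b : Module.Basis (Fin 2) F K) :
    (Units.map (Algebra.norm F (S := K))).ker →* SL₂ F where
  toFun y := ⟨Algebra.leftMulMatrix b (y : Kˣ), by
    have h := congrArg Units.val y.2
    rwa [Units.coe_map, Algebra.norm_eq_matrix_det b] at h⟩
  map_one' := coe_injective_SL2 (by simp)
  map_mul' x y := coe_injective_SL2 (map_mul (Algebra.leftMulMatrix b) _ _)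

theorem exists_nonsplit_torus [Fintype F] [DecidableEq F] :
    ∃ (H : Type) (_ : CommGroup H) (_ : Fintype H) (φ : H →* SL₂ F), IsCyclic H ∧
      Function.Injective φ ∧ Fintype.card H = Fintype.card F + 1 ∧ (∃ y, φ y = -1) ∧
      (∀ y, (φ y).1.trace ^ 2 = 4 → φ y = 1 ∨ φ y = -1) ∧
      ∀ Ψ : F → ℂ, ∑ x : Fˣ, Ψ (x + (x⁻¹ : Fˣ)) + ∑ y, Ψ (φ y).1.trace = 2 * ∑ τ, Ψ τ := by
  classical
  obtain ⟨p, hp⟩ := CharP.exists F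
  have : Fact p.Prime := ⟨CharP.char_is_prime F p⟩
  let K := FiniteField.Extension F p 2
  have : Finite K := Module.finite_of_finite F
  let _ : Fintype K := Fintype.ofFinite K
  have hK : Module.finrank F K = 2 := FiniteField.finrank_extension F p 2
  let b : Module.Basis (Fin 2) F K := Module.finBasisOfFinrankEq F K hK
  have hnorm : ∀ y : (Units.map (Algebra.norm F (S := K))).ker,
      ((y : Kˣ) : K) * ((y : Kˣ) : K) ^ Fintype.card F = 1 := by
    intro y
    have h := congrArg (algebraMap F K) (congrArg Units.val y.2)
    rw [Units.coe_map, FiniteField.algebraMap_norm_eq_prod_pow, hK] at h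
    simpa [Finset.prod_range_succ] using h
  have htrace : ∀ y : (Units.map (Algebra.norm F (S := K))).ker,
      algebraMap F K (normOneHom b y).1.trace = ((y : Kˣ) : K) + ((y : Kˣ) : K)⁻¹ := by
    intro y
    have h : (normOneHom b y).1.trace = Algebra.trace F K (y : Kˣ) :=
      (Algebra.trace_eq_matrix_trace b _).symm
    rw [h, FiniteField.algebraMap_trace_eq_sum_pow, hK, ← eq_inv_of_mul_eq_one_right (hnorm y)]
    simp [Finset.sum_range_succ]
  have hcard : Fintype.card (Units.map (Algebra.norm F (S := K))).ker = Fintype.card F + 1 := by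
    have h1 := Subgroup.card_mul_index (Units.map (Algebra.norm F (S := K))).ker
    rw [Subgroup.index_ker, MonoidHom.range_eq_top.2 (FiniteField.unitsMap_norm_surjective F K),
      Subgroup.card_top, Nat.card_units, Nat.card_units, FiniteField.natCard_extension,
      Nat.card_eq_fintype_card, Nat.card_eq_fintype_card] at h1
    have hq : 1 < Fintype.card F := Fintype.one_lt_card
    refine Nat.eq_of_mul_eq_mul_right (Nat.sub_pos_of_lt hq) (h1.trans ?_)
    rw [← Nat.sq_sub_sq, one_pow]
  have hone : ∀ y : (Units.map (Algebra.norm F (S := K))).ker, ((y : Kˣ) : K) ≠ 0 :=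
    fun y => (y : Kˣ).ne_zero
  let r : Fˣ ⊕ (Units.map (Algebra.norm F (S := K))).ker → K :=
    Sum.elim (fun x => algebraMap F K x) (fun y => (y : Kˣ))
  let t : Fˣ ⊕ (Units.map (Algebra.norm F (S := K))).ker → F :=
    Sum.elim (fun x => x + (x⁻¹ : Fˣ)) (fun y => (normOneHom b y).1.trace)
  have hrt : ∀ z, algebraMap F K (t z) = r z + (r z)⁻¹ := by
    rintro (x | y)
    · simp [r, t]
    · exact htrace y
  have hr0 : ∀ z, r z ≠ 0 := by
    rintro (x | y)
    · simp [r]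
    · exact hone y
  have hmixed : ∀ (x : Fˣ) (y : (Units.map (Algebra.norm F (S := K))).ker),
      algebraMap F K x = ((y : Kˣ) : K) → algebraMap F K x = (algebraMap F K x)⁻¹ := by
    intro x y h
    refine eq_inv_of_mul_eq_one_left ?_
    have := hnorm y
    rwa [← h, ← map_pow, FiniteField.pow_card] at this
  have hfib : ∀ τ, (Finset.univ.filter fun z => t z = τ).card = 2 := by
    refine card_fiber_eq_two Sum.isLeft r t ?_ ?_ ?_ ?_
    · rintro (x | y) (x' | y') h h' <;> simp [r] at h h' ⊢
      · exact Units.ext h'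
      · exact Subtype.ext (Units.ext h')
    · rintro (x | y) (x' | y') h h' <;> simp at h'
      · exact hmixed x y' h
      · have := hmixed x' y h.symm
        rw [h]
        exact this
    · intro z z' h
      have h1 := hrt z
      rw [h, hrt z'] at h1
      exact eq_or_eq_inv_of_add_inv_eq (hr0 z') (hr0 z) h1
    · have hq : 0 < Fintype.card F := Fintype.card_pos
      rw [Fintype.card_sum, hcard, Fintype.card_units]
      omega
  have hneg : (-1 : Kˣ) ∈ (Units.map (Algebra.norm F (S := K))).ker := by
    rw [MonoidHom.mem_ker]
    ext
    have := Algebra.norm_algebraMap (S := K) (-1 : F)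
    rw [hK] at this
    simpa using this
  have hφneg : normOneHom b ⟨-1, hneg⟩ = -1 := by
    have : Algebra.leftMulMatrix b (-1 : K) = -1 := by simp
    exact coe_injective_SL2 this
  refine ⟨(Units.map (Algebra.norm F (S := K))).ker, inferInstance, inferInstance, normOneHom b,
    inferInstance, ?_, hcard, ⟨⟨-1, hneg⟩, hφneg⟩, ?_, ?_⟩
  · intro x y h
    have h1 : Algebra.leftMulMatrix b ((x : Kˣ) : K) = Algebra.leftMulMatrix b ((y : Kˣ) : K) :=
      congrArg Subtype.val h
    exact Subtype.ext (Units.ext (Algebra.leftMulMatrix_injective b h1))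
  · intro y hy
    have h1 := congrArg (algebraMap F K) hy
    rw [map_pow, htrace, map_ofNat] at h1
    have h2 : ((y : Kˣ) : K) = 1 ∨ ((y : Kˣ) : K) = -1 := by
      rw [← sq_eq_one_iff]
      exact sq_eq_one_of_add_inv_sq_eq_four (hone y) h1
    rcases h2 with h2 | h2
    · left
      have : y = 1 := Subtype.ext (Units.ext h2)
      rw [this, map_one]
    · right
      have : y = ⟨-1, hneg⟩ := Subtype.ext (Units.ext h2)
      rw [this, hφneg]
  · intro Ψ
    have h1 : ∑ z, Ψ (t z) = 2 * ∑ τ, Ψ τ := by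
      rw [← Finset.sum_fiberwise_of_maps_to (g := t) (t := Finset.univ)
        (fun _ _ => Finset.mem_univ _), Finset.mul_sum]
      refine Finset.sum_congr rfl fun τ _ => ?_
      rw [Finset.sum_congr rfl (g := fun _ => Ψ τ) (by simp +contextual), Finset.sum_const, hfib]
      simp
    rw [← h1, Fintype.sum_sum_type]
    rfl

end NonsplitTorus

section TorusRestriction

variable {G : Type*} [Group G] {V : Type*} [AddCommGroup V] [Module ℂ V] [FiniteDimensional ℂ V]
  (ρ : Representation ℂ G V)

/-- Let `A` be a cyclic subgroup of `G` containing a central involution `m` (or `m = 1`), and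
suppose the character of `ρ` is even on `A`. Subtracting a suitable multiple of the character
induced from `⟨m⟩` gives a virtual character of `A`, and if its square norm `N` is at most `2`
then the values of the character on `A` are rational or generated by a single one. -/
theorem exists_norm_restriction {A : Type*} [AddCommGroup A] [Fintype A] [IsAddCyclic A]
    [DecidableEq G] (φ : Multiplicative A →* G) (hφ : Function.Injective φ) {m : G} {y : A}
    (hy : φ (.ofAdd y) = m) (hmm : m * m = 1) {ω : ℂ} (hω : ω = 1 ∨ ω = -1)
    (hχ : ∀ g, ρ.character (m * g) = ω * ρ.character g)
    (heven : ∀ x : A, ρ.character (φ (.ofAdd (-x))) = ρ.character (φ (.ofAdd x)))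
    (k : ℤ) (κ : ℚ) (hκ : (if m = 1 then 1 else 2) * (κ : ℂ) = k * Fintype.card A) :
    ∃ N : ℤ, 0 ≤ N ∧
      ∑ x : A, (if φ (.ofAdd x) = 1 ∨ φ (.ofAdd x) = m then 0
        else ρ.character (φ (.ofAdd x)) ^ 2) +
        (if m = 1 then 1 else 2) * (ρ.character 1 - κ) ^ 2 = Fintype.card A * N ∧
      (N ≤ 2 → (∀ x : A, ρ.character (φ (.ofAdd x)) ∈ (⊥ : IntermediateField ℚ ℂ)) ∨
        (2 ≤ N ∧ ∃ g : A, ∀ x : A, ρ.character (φ (.ofAdd x)) ∈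
          IntermediateField.adjoin ℚ {ρ.character (φ (.ofAdd g))})) := by
  classical
  have hω2 : ω ^ 2 = 1 := by rcases hω with rfl | rfl <;> norm_num
  have hφ1 : ∀ x : A, φ (.ofAdd x) = 1 ↔ x = 0 := fun x =>
    ⟨fun h => hφ (a₁ := .ofAdd x) (a₂ := 1) (by rw [h, map_one]), fun h => by simp [h]⟩
  have hφm : ∀ x : A, φ (.ofAdd x) = m ↔ x = y := fun x =>
    ⟨fun h => hφ (a₁ := .ofAdd x) (a₂ := .ofAdd y) (by rw [h, hy]), fun h => by rw [h, hy]⟩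
  have hyy : y + y = 0 := by
    rw [← hφ1, ofAdd_add, map_mul, hy, hmm]
  have hm1 : m = 1 ↔ y = 0 := by rw [← hy, hφ1]
  have hχy : ρ.character (φ (.ofAdd y)) = ω * ρ.character 1 := by
    rw [hy, ← hχ, mul_one]
  let c : A → ℂ := fun x => (if x = 0 then (κ : ℂ) else 0) +
    (if y ≠ 0 ∧ x = y then ω * κ else 0)
  let f : A → ℂ := fun x => ρ.character (φ (.ofAdd x)) - c x
  have hneg : -y = y := neg_eq_of_add_eq_zero_left hyy
  have hceven : ∀ x, c (-x) = c x := by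
    intro x
    have : -x = y ↔ x = y := by rw [neg_eq_iff_eq_neg, hneg]
    simp [c, this]
  have hcmem : ∀ x (L : IntermediateField ℚ ℂ), c x ∈ L := by
    intro x L
    have hκL : (κ : ℂ) ∈ L := L.algebraMap_mem κ
    have hωL : ω ∈ L := by
      rcases hω with rfl | rfl
      · exact one_mem L
      · exact neg_mem (one_mem L)
    refine add_mem ?_ ?_
    · split_ifs
      · exact hκL
      · exact zero_mem L
    · split_ifs
      · exact mul_mem hωL hκL
      · exact zero_mem L
  have hfeven : ∀ x, f (-x) = f x := fun x => by simp only [f, heven, hceven]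
  have hcoeff : ∀ ψ : AddChar A ℂ, ∃ a : ℤ, ∑ x, f x * ψ (-x) = Fintype.card A * (a : ℂ) := by
    intro ψ
    obtain ⟨n, hn⟩ := exists_multiplicity ρ φ ψ
    obtain ⟨e, he⟩ : ∃ e : ℤ, ∑ x, c x * ψ (-x) = Fintype.card A * (k * e : ℤ) := by
      by_cases h0 : y = 0
      · refine ⟨1, ?_⟩
        rw [if_pos (hm1.2 h0)] at hκ
        simp [c, h0]
        linear_combination hκ
      · have h1 : ∑ x, c x * ψ (-x) = κ * (1 + ω * ψ y) := by
          simp [c, h0, add_mul, Finset.sum_add_distrib, hneg]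
          ring
        have h2 : ψ y * ψ y = 1 := by
          rw [← AddChar.map_add_eq_mul, hyy, AddChar.map_zero_eq_one]
        rw [if_neg (fun h => h0 (hm1.1 h))] at hκ
        have h3 : (ω * ψ y) * (ω * ψ y) = 1 := by linear_combination ω ^ 2 * h2 + hω2
        rcases mul_self_eq_one_iff.1 h3 with h4 | h4
        · refine ⟨1, ?_⟩
          rw [h1, h4]
          push_cast
          linear_combination hκ
        · refine ⟨0, ?_⟩
          rw [h1, h4]
          simp
    refine ⟨n - k * e, ?_⟩
    simp only [f, sub_mul, Finset.sum_sub_distrib, hn, he]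
    push_cast
    ring
  choose a ha using hcoeff
  have hinv := fourier_inversion f (fun ψ => (a ψ : ℂ)) ha
  have haeven : ∀ ψ, a (-ψ) = a ψ := fun ψ => by
    exact_mod_cast fourier_coeff_neg f hfeven (fun ψ => (a ψ : ℂ)) ha ψ
  have hpars := fourier_parseval f (fun ψ => (a ψ : ℂ)) ha
  refine ⟨∑ ψ, a ψ ^ 2, Finset.sum_nonneg fun ψ _ => sq_nonneg _, ?_, fun hN => ?_⟩
  · push_cast
    rw [← hpars]
    have hpt : ∀ x, f x * f (-x) = (if φ (.ofAdd x) = 1 ∨ φ (.ofAdd x) = m then 0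
        else ρ.character (φ (.ofAdd x)) ^ 2) + ((if x = 0 then (ρ.character 1 - κ) ^ 2 else 0) +
        (if y ≠ 0 ∧ x = y then (ρ.character 1 - κ) ^ 2 else 0)) := by
      intro x
      rw [hfeven]
      simp only [f, c, hφ1, hφm]
      by_cases hx : x = 0
      · subst hx
        by_cases h0 : y = 0
        · simp [h0]
          ring
        · simp [h0, Ne.symm h0]
          ring
      · by_cases hxy : x = y
        · subst hxy
          simp [hx, hχy]
          linear_combination ((Module.finrank ℂ V : ℂ) - κ) ^ 2 * hω2
        · simp [hx, hxy]
          ring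
    simp only [hpt, Finset.sum_add_distrib]
    congr 1
    by_cases h0 : y = 0
    · simp [h0, hm1]
    · simp [h0, hm1]
      ring
  · have hval : ∀ x, ρ.character (φ (.ofAdd x)) = f x + c x := fun x => by simp [f]
    rcases even_combination_norm_le_two a haeven hN with h | ⟨h2, ψ, s, hs, h⟩
    · left
      intro x
      obtain ⟨n, hn⟩ := h x
      rw [hval, hinv, hn]
      exact add_mem (intCast_mem _ n) (hcmem x _)
    · refine .inr ⟨h2, ?_⟩
      obtain ⟨g, hg⟩ := IsAddCyclic.exists_generator (α := A)
      refine ⟨g, fun x => ?_⟩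
      obtain ⟨n, rfl⟩ := mem_multiples_iff_mem_zmultiples.2 (hg x)
      set L := IntermediateField.adjoin ℚ {ρ.character (φ (.ofAdd g))} with hL
      have hfg : f g ∈ L := sub_mem (IntermediateField.mem_adjoin_simple_self ℚ _) (hcmem g L)
      have hs' : (s : ℂ) * s = 1 := by exact_mod_cast (sq s).symm.trans hs
      have hw : ψ g + (ψ g)⁻¹ ∈ L := by
        have : ψ g + (ψ g)⁻¹ = s * f g := by
          rw [hinv, h]
          linear_combination -(ψ g + (ψ g)⁻¹) * hs'
        rw [this]
        exact mul_mem (intCast_mem _ s) hfg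
      have hle : IntermediateField.adjoin ℚ {ψ g + (ψ g)⁻¹} ≤ L :=
        IntermediateField.adjoin_simple_le_iff.2 hw
      change ρ.character (φ (.ofAdd (n • g))) ∈ L
      rw [hval, hinv, h, AddChar.map_nsmul_eq_pow]
      refine add_mem (mul_mem (intCast_mem _ s) (hle ?_)) (hcmem _ L)
      exact pow_add_inv_pow_mem_adjoin _ (ψ.val_isUnit g).ne_zero n

end TorusRestriction

section SpecialLinearCharacter

open Matrix

variable {F : Type*} [Field F]

local notation "SL₂" => Matrix.SpecialLinearGroup (Fin 2)

theorem trace_inv_SL2 (g : SL₂ F) : (g⁻¹).1.trace = g.1.trace := by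
  have h : (g⁻¹).1 = adjugate g.1 := rfl
  rw [h, adjugate_fin_two, trace_fin_two, trace_fin_two]
  simp [add_comm]

theorem trace_neg_SL2 (g : SL₂ F) : (-1 * g).1.trace = -g.1.trace := by
  rw [neg_one_mul, SpecialLinearGroup.coe_neg, trace_neg]

theorem neg_one_eq_one_SL2 : (-1 : SL₂ F) = 1 ↔ (2 : F) = 0 := by
  constructor
  · intro h
    have := congrArg (fun g : SL₂ F => g.1 0 0) h
    simp at this
    linear_combination -this
  · intro h
    have h1 : (-1 : F) = 1 := by linear_combination -h
    refine coe_injective_SL2 ?_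
    change -(1 : Matrix (Fin 2) (Fin 2) F) = 1
    ext i j
    fin_cases i <;> fin_cases j <;> simp [h1]

theorem character_upper_sq_mul {V : Type*} [AddCommGroup V] [Module ℂ V]
    (ρ : Representation ℂ (SL₂ F) V) (t : Fˣ) (b : F) :
    ρ.character (upper ((t : F) ^ 2 * b)) = ρ.character (upper b) := by
  rw [upper_conj, Representation.char_conj]

variable [Fintype F]

/-- Elements of trace two are conjugate to upper unitriangular matrices. -/
theorem exists_conj_upper [DecidableEq F] (g : SL₂ F) (h : g.1.trace = 2) :
    ∃ (b : F) (P : SL₂ F), g = P * upper b * P⁻¹ := by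
  classical
  by_contra hg
  let φ : SL₂ F → ℕ := fun g => if ∃ (b : F) (P : SL₂ F), g = P * upper b * P⁻¹ then 0 else 1
  have hup : ∀ b, φ (upper b) = 0 := fun b => if_pos ⟨b, 1, by simp⟩
  have hone : φ 1 = 0 := if_pos ⟨0, 1, by simp [upper_zero]⟩
  have hconj : ∀ g h : SL₂ F, φ (h * g * h⁻¹) = φ g := by
    intro g h
    have : (∃ (b : F) (P : SL₂ F), h * g * h⁻¹ = P * upper b * P⁻¹) ↔
        ∃ (b : F) (P : SL₂ F), g = P * upper b * P⁻¹ := by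
      constructor
      · rintro ⟨b, P, hP⟩
        refine ⟨b, h⁻¹ * P, ?_⟩
        have : g = h⁻¹ * (h * g * h⁻¹) * h := by group
        rw [this, hP]
        group
      · rintro ⟨b, P, rfl⟩
        exact ⟨b, h * P, by group⟩
    simp only [φ, this]
  have hsum := sum_trace_eq_two (fun g => (φ g : ℂ)) (fun g h => by rw [hconj])
  simp only [hup, hone] at hsum
  have hsum' : ∑ g : SL₂ F, (if g.1.trace = 2 then φ g else 0) = 0 := by
    have : ((∑ g : SL₂ F, (if g.1.trace = 2 then φ g else 0) : ℕ) : ℂ) = 0 := by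
      push_cast
      simpa using hsum
    exact_mod_cast this
  have := Finset.sum_eq_zero_iff.1 hsum' g (Finset.mem_univ g)
  rw [if_pos h] at this
  simp [φ, hg] at this

theorem exists_square_class [DecidableEq F] :
    ∃ ε : Fˣ, ((-1 : F) = 1 → ε = 1) ∧
      ∀ b : Fˣ, (∃ t : Fˣ, b = t ^ 2) ∨ ∃ t : Fˣ, b = t ^ 2 * ε := by
  by_cases h : ∀ b : Fˣ, ∃ t : Fˣ, b = t ^ 2
  · exact ⟨1, fun _ => rfl, fun b => .inl (h b)⟩
  push Not at h
  obtain ⟨ε, hε⟩ := h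
  have hsq : ∀ b : Fˣ, IsSquare (b : F) → ∃ t : Fˣ, b = t ^ 2 := by
    rintro b ⟨t, ht⟩
    have ht0 : t ≠ 0 := by
      rintro rfl
      exact b.ne_zero (by simp at ht)
    exact ⟨Units.mk0 t ht0, Units.ext (by simp [ht, sq])⟩
  have hε' : ¬IsSquare (ε : F) := fun h => (hsq ε h).elim hε
  have hchar : ringChar F ≠ 2 := fun h => hε' (FiniteField.isSquare_of_char_two h _)
  refine ⟨ε, fun h => absurd h (Ring.neg_one_ne_one_of_char_ne_two hchar), fun b => ?_⟩
  by_cases hb : IsSquare (b : F)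
  · exact .inl (hsq b hb)
  · right
    have hbε : IsSquare ((b * ε : Fˣ) : F) := by
      rw [← quadraticChar_one_iff_isSquare (b * ε).ne_zero, Units.val_mul, map_mul,
        quadraticChar_neg_one_iff_not_isSquare.2 hb, quadraticChar_neg_one_iff_not_isSquare.2 hε']
      norm_num
    obtain ⟨t, ht⟩ := hsq _ hbε
    refine ⟨t * ε⁻¹, ?_⟩
    rw [mul_pow, ← ht]
    group

variable {V : Type*} [AddCommGroup V] [Module ℂ V]
  (ρ : Representation ℂ (SL₂ F) V)

theorem character_eq_companion (g : SL₂ F) (h : g.1.trace ^ 2 ≠ 4) :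
    ρ.character g = ρ.character (companion g.1.trace) := by
  obtain ⟨P, hP⟩ := exists_conj_companion g h
  conv_lhs => rw [hP, Representation.char_conj]

/-- The character values on nontrivial unipotent elements: there are at most two of them,
equally often. -/
theorem exists_unipotent_values [DecidableEq F] : ∃ ε : Fˣ, ((-1 : F) = 1 → ε = 1) ∧
    (∀ b : Fˣ, ρ.character (upper b) = ρ.character (upper 1) ∨
      ρ.character (upper b) = ρ.character (upper ε)) ∧
    2 * ∑ b : Fˣ, ρ.character (upper b) =
      (Fintype.card F - 1) * (ρ.character (upper 1) + ρ.character (upper ε)) := by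
  obtain ⟨ε, hε, hb⟩ := exists_square_class (F := F)
  have h1 : ∀ t : Fˣ, ρ.character (upper ((t ^ 2 : Fˣ) : F)) = ρ.character (upper 1) := by
    intro t
    have := character_upper_sq_mul ρ t 1
    rwa [mul_one] at this
  have h2 : ∀ t : Fˣ, ρ.character (upper ((t ^ 2 * ε : Fˣ) : F)) = ρ.character (upper ε) :=
    fun t => character_upper_sq_mul ρ t ε
  have hcard : (Fintype.card Fˣ : ℂ) = Fintype.card F - 1 := by
    rw [Fintype.card_units, Nat.cast_sub Fintype.card_pos, Nat.cast_one]
  refine ⟨ε, hε, fun b => ?_, ?_⟩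
  · rcases hb b with ⟨t, rfl⟩ | ⟨t, rfl⟩
    · exact .inl (h1 t)
    · exact .inr (h2 t)
  · have hshift : ∑ b : Fˣ, ρ.character (upper b) =
        ∑ b : Fˣ, ρ.character (upper ((b * ε : Fˣ) : F)) :=
      (Equiv.sum_comp (Equiv.mulRight ε) fun b : Fˣ => ρ.character (upper b)).symm
    rw [two_mul]
    nth_rewrite 2 [hshift]
    rw [← Finset.sum_add_distrib, Finset.sum_congr rfl
      (g := fun _ => ρ.character (upper 1) + ρ.character (upper (ε : F)))]
    · simp [hcard, mul_add]
    · intro b _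
      rcases hb b with ⟨t, rfl⟩ | ⟨t, rfl⟩
      · rw [h1, h2]
      · rw [h2, add_comm, show t ^ 2 * ε * ε = (t * ε) ^ 2 by rw [mul_pow, sq ε, mul_assoc], h1]

/-- The contribution of the elements of trace `±2`. -/
theorem sum_trace_sq_eq_four [DecidableEq F] (φ : SL₂ F → ℂ)
    (hφ : ∀ g h : SL₂ F, φ (h * g * h⁻¹) = φ g)
    (hneg : ∀ g, φ (-1 * g) = φ g) :
    ∑ g : SL₂ F, (if g.1.trace ^ 2 = 4 then φ g else 0) =
      (if (-1 : SL₂ F) = 1 then 1 else 2) *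
        (φ 1 + (Fintype.card F + 1) * ∑ b : Fˣ, φ (upper b)) := by
  rw [← sum_trace_eq_two φ hφ]
  have hsq : ∀ τ : F, τ ^ 2 = 4 ↔ τ = 2 ∨ τ = -2 := by
    intro τ
    rw [← sq_eq_sq_iff_eq_or_eq_neg]
    norm_num
  by_cases h2 : (2 : F) = 0
  · rw [if_pos (neg_one_eq_one_SL2.2 h2), one_mul]
    refine Finset.sum_congr rfl fun g _ => ?_
    simp only [hsq, h2, neg_zero, or_self]
  · rw [if_neg (fun h => h2 (neg_one_eq_one_SL2.1 h)), two_mul]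
    have hshift : ∑ g : SL₂ F, (if g.1.trace = 2 then φ g else 0) =
        ∑ g : SL₂ F, (if g.1.trace = -2 then φ g else 0) := by
      rw [← Equiv.sum_comp (Equiv.mulLeft (-1 : SL₂ F))]
      refine Finset.sum_congr rfl fun g _ => ?_
      rw [Equiv.coe_mulLeft, hneg, trace_neg_SL2]
      simp only [neg_eq_iff_eq_neg]
    nth_rewrite 2 [hshift]
    rw [← Finset.sum_add_distrib]
    refine Finset.sum_congr rfl fun g _ => ?_
    have hne : (2 : F) ≠ -2 := by
      intro h
      have h4 : (2 : F) * 2 = 0 := by linear_combination h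
      rcases mul_eq_zero.1 h4 with h | h <;> exact h2 h
    simp only [hsq]
    by_cases ha : g.1.trace = 2
    · simp [ha, hne]
    · simp [ha]

end SpecialLinearCharacter

section FieldOfValues

open Matrix

variable {F : Type*} [Field F] [Fintype F] [DecidableEq F]

local notation "SL₂" => Matrix.SpecialLinearGroup (Fin 2)

variable {V : Type*} [AddCommGroup V] [Module ℂ V] (ρ : Representation ℂ (SL₂ F) V)

/-- The square of the character value on regular semisimple elements of trace `τ`, and zero
if there are no such elements. -/
noncomputable def regularSquare (τ : F) : ℂ :=
  if τ ^ 2 = 4 then 0 else ρ.character (companion τ) ^ 2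

theorem sum_character_mul_inv (hneg : ∀ g, ρ.character (-1 * g) * ρ.character (-1 * g)⁻¹ =
    ρ.character g * ρ.character g⁻¹) :
    ∑ g, ρ.character g * ρ.character g⁻¹ =
      (if (-1 : SL₂ F) = 1 then 1 else 2) * (ρ.character 1 ^ 2 + (Fintype.card F + 1) *
        ∑ b : Fˣ, ρ.character (upper b) * ρ.character (upper (b : F))⁻¹) +
      ∑ g : SL₂ F, regularSquare ρ g.1.trace := by
  have hconj : ∀ g h : SL₂ F, ρ.character (h * g * h⁻¹) * ρ.character (h * g * h⁻¹)⁻¹ =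
      ρ.character g * ρ.character g⁻¹ := by
    intro g h
    have : (h * g * h⁻¹)⁻¹ = h * g⁻¹ * h⁻¹ := by group
    rw [this, Representation.char_conj, Representation.char_conj]
  have h := sum_trace_sq_eq_four (fun g => ρ.character g * ρ.character g⁻¹) hconj hneg
  rw [inv_one, ← sq] at h
  rw [← h, ← Finset.sum_add_distrib]
  refine Finset.sum_congr rfl fun g _ => ?_
  rw [regularSquare]
  by_cases hg : g.1.trace ^ 2 = 4
  · rw [if_pos hg, if_pos hg, add_zero]
  · rw [if_neg hg, if_neg hg, zero_add, character_eq_companion ρ g hg,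
      character_eq_companion ρ g⁻¹ (by rwa [trace_inv_SL2]), trace_inv_SL2, sq]

theorem character_mem_of_unipotent_of_tori {H : Type*} [Group H] [Fintype H] (φ : H →* SL₂ F)
    (hsum : ∀ Ψ : F → ℂ,
      ∑ x : Fˣ, Ψ (x + (x⁻¹ : Fˣ)) + ∑ y, Ψ (φ y).1.trace = 2 * ∑ τ, Ψ τ)
    {ω : ℂ} (hω : ω = 1 ∨ ω = -1) (hχ : ∀ g, ρ.character (-1 * g) = ω * ρ.character g)
    (L : IntermediateField ℚ ℂ) (hu : ∀ b : Fˣ, ρ.character (upper b) ∈ L)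
    (h1 : ∀ x, ρ.character (splitTorus x) ∈ L) (h2 : ∀ y, ρ.character (φ y) ∈ L) (g : SL₂ F) :
    ρ.character g ∈ L := by
  have hone : ρ.character 1 ∈ L := by have := h1 1; rwa [map_one] at this
  have htwo : ∀ g : SL₂ F, g.1.trace = 2 → ρ.character g ∈ L := by
    intro g hg
    obtain ⟨b, P, rfl⟩ := exists_conj_upper g hg
    rw [Representation.char_conj]
    by_cases hb : b = 0
    · rwa [hb, upper_zero]
    · exact hu (Units.mk0 b hb)
  by_cases hg : g.1.trace ^ 2 = 4
  · have : g.1.trace = 2 ∨ g.1.trace = -2 := by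
      rw [← sq_eq_sq_iff_eq_or_eq_neg, hg]
      norm_num
    rcases this with h | h
    · exact htwo g h
    · have h3 := htwo (-1 * g) (by rw [trace_neg_SL2, h, neg_neg])
      rw [hχ] at h3
      rcases hω with rfl | rfl
      · simpa using h3
      · simpa using neg_mem h3
  · have hex : (∃ x : Fˣ, (splitTorus x).1.trace = g.1.trace) ∨
        ∃ y, (φ y).1.trace = g.1.trace := by
      by_contra! h
      have := hsum fun τ => if τ = g.1.trace then 1 else 0
      have hs : ∀ x : Fˣ, (x : F) + (x⁻¹ : Fˣ) ≠ g.1.trace := fun x => by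
        have := h.1 x
        rwa [coe_splitTorus, trace_fin_two_of] at this
      simp only [hs, h.2, if_false] at this
      simp at this
    rcases hex with ⟨x, hx⟩ | ⟨y, hy⟩
    · have := h1 x
      rwa [character_eq_companion ρ _ (by rwa [hx]), hx, ← character_eq_companion ρ _ hg] at this
    · have := h2 y
      rwa [character_eq_companion ρ _ (by rwa [hy]), hy, ← character_eq_companion ρ _ hg] at this

variable [FiniteDimensional ℂ V]

theorem exists_norm_restriction_SL2 {H : Type*} [CommGroup H] [Fintype H] [IsCyclic H]
    (φ : H →* SL₂ F) (hφ : Function.Injective φ) (hneg : ∃ y, φ y = -1)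
    (htr : ∀ y, (φ y).1.trace ^ 2 = 4 → φ y = 1 ∨ φ y = -1) {ω : ℂ} (hω : ω = 1 ∨ ω = -1)
    (hχ : ∀ g, ρ.character (-1 * g) = ω * ρ.character g)
    (k : ℤ) (κ : ℚ) (hκ : (if (-1 : SL₂ F) = 1 then 1 else 2) * (κ : ℂ) = k * Fintype.card H) :
    ∃ N : ℤ, 0 ≤ N ∧ ∑ y, regularSquare ρ (φ y).1.trace +
        (if (-1 : SL₂ F) = 1 then 1 else 2) * (ρ.character 1 - κ) ^ 2 = Fintype.card H * N ∧
      (N ≤ 2 → (∀ y, ρ.character (φ y) ∈ (⊥ : IntermediateField ℚ ℂ)) ∨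
        (2 ≤ N ∧ ∃ x, ∀ y, ρ.character (φ y) ∈
          IntermediateField.adjoin ℚ {ρ.character (φ x)})) := by
  obtain ⟨y₀, hy₀⟩ := hneg
  have htr' : ∀ y, φ y = 1 ∨ φ y = -1 → (φ y).1.trace ^ 2 = 4 := by
    rintro y (h | h)
    · rw [h]
      change ((1 : Matrix (Fin 2) (Fin 2) F).trace) ^ 2 = 4
      rw [trace_one]
      norm_num
    · rw [h]
      change ((-1 : Matrix (Fin 2) (Fin 2) F).trace) ^ 2 = 4
      rw [trace_neg, trace_one]
      norm_num
  have heven : ∀ y, ρ.character (φ y⁻¹) = ρ.character (φ y) := by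
    intro y
    rw [map_inv]
    by_cases h : (φ y).1.trace ^ 2 = 4
    · rcases htr y h with h | h <;> rw [h] <;> simp
    · rw [character_eq_companion ρ _ h, character_eq_companion ρ _ (by rwa [trace_inv_SL2]),
        trace_inv_SL2]
  obtain ⟨N, h0, h1, h2⟩ := exists_norm_restriction ρ (A := Additive H)
    (φ.comp (MulEquiv.multiplicativeAdditive H).toMonoidHom)
    (hφ.comp (MulEquiv.multiplicativeAdditive H).injective) (m := -1) (y := Additive.ofMul y₀)
    hy₀ (by simp) hω hχ heven k κ (by rwa [Fintype.card_additive])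
  refine ⟨N, h0, ?_, h2⟩
  rw [← Fintype.card_additive H, ← h1]
  congr 1
  refine Fintype.sum_equiv Additive.ofMul _ _ fun y => ?_
  change _ = if φ y = 1 ∨ φ y = -1 then 0 else ρ.character (φ y) ^ 2
  rw [regularSquare]
  by_cases h : (φ y).1.trace ^ 2 = 4
  · rw [if_pos h, if_pos (htr y h)]
  · rw [if_neg h, if_neg (fun h' => h (htr' y h')), character_eq_companion ρ (φ y) h]

theorem exists_int_of_isIntegral_rat (r : ℚ) (hr : IsIntegral ℤ (r : ℂ)) :
    ∃ k : ℤ, (k : ℚ) = r := by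
  have h : IsIntegral ℤ r :=
    (isIntegral_algebraMap_iff (A := ℚ) (B := ℂ) (algebraMap ℚ ℂ).injective).1 hr
  obtain ⟨k, hk⟩ := IsIntegrallyClosed.isIntegral_iff.1 h
  exact ⟨k, by simpa using hk⟩

/-- The multiplicity `n` of the trivial character of the unipotent subgroup, and the integer
measuring its deviation from the average value of the character on unipotent elements. -/
theorem exists_unipotent_multiplicity : ∃ (n : ℕ) (k : ℤ),
    ρ.character 1 + ∑ b : Fˣ, ρ.character (upper b) = Fintype.card F * n ∧
    (k : ℂ) * (Fintype.card F - 1) = (if (-1 : SL₂ F) = 1 then 1 else 2) *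
      (n * (Fintype.card F - 1) - ∑ b : Fˣ, ρ.character (upper b)) := by
  obtain ⟨n, hn⟩ := exists_multiplicity ρ (upperHom (F := F)) 0
  have hn' : ρ.character 1 + ∑ b : Fˣ, ρ.character (upper b) = Fintype.card F * n := by
    rw [← hn, ← upper_zero, ← sum_eq_zero_add_sum_units fun b : F => ρ.character (upper b)]
    refine Finset.sum_congr rfl fun b _ => ?_
    rw [AddChar.zero_apply, mul_one]
    rfl
  obtain ⟨ε, hε, -, hsum⟩ := exists_unipotent_values ρ
  have hq : (Fintype.card F : ℚ) - 1 ≠ 0 := by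
    have : (1 : ℚ) < Fintype.card F := by exact_mod_cast Fintype.one_lt_card
    linarith
  have hq' : (Fintype.card F : ℂ) - 1 ≠ 0 := by exact_mod_cast hq
  set M := ∑ b : Fˣ, ρ.character (upper b) with hM
  have hMrat : M = ((Fintype.card F * n - Module.finrank ℂ V : ℚ) : ℂ) := by
    rw [Representation.char_one] at hn'
    push_cast
    linear_combination hn'
  have hintegral : IsIntegral ℤ ((if (-1 : SL₂ F) = 1 then 1 else 2) * (M / (Fintype.card F - 1))) := by
    split_ifs with h
    · have h1 : ε = 1 := hε (by linear_combination -(neg_one_eq_one_SL2.1 h))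
      rw [h1, Units.val_one] at hsum
      have : M / (Fintype.card F - 1) = ρ.character (upper 1) := by
        field_simp
        linear_combination hsum / 2
      rw [one_mul, this]
      exact character_isIntegral ρ _
    · have : 2 * (M / (Fintype.card F - 1)) =
          ρ.character (upper 1) + ρ.character (upper (ε : F)) := by
        field_simp
        linear_combination hsum
      rw [this]
      exact (character_isIntegral ρ _).add (character_isIntegral ρ _)
  obtain ⟨j, hj⟩ := exists_int_of_isIntegral_rat ((if (-1 : SL₂ F) = 1 then 1 else 2) *
    ((Fintype.card F * n - Module.finrank ℂ V) / (Fintype.card F - 1))) (by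
      convert hintegral using 1
      rw [hMrat]
      split_ifs <;> push_cast <;> ring)
  have hj' : (j : ℂ) * (Fintype.card F - 1) = (if (-1 : SL₂ F) = 1 then 1 else 2) * M := by
    have h1 : (j : ℚ) * (Fintype.card F - 1) = (if (-1 : SL₂ F) = 1 then 1 else 2) *
        (Fintype.card F * n - Module.finrank ℂ V) := by
      rw [hj]
      field_simp
    have h2 := congrArg (Rat.cast (K := ℂ)) h1
    rw [hMrat]
    split_ifs at h2 ⊢ <;> push_cast at h2 ⊢ <;> exact h2
  refine ⟨n, (if (-1 : SL₂ F) = 1 then 1 else 2) * n - j, hn', ?_⟩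
  split_ifs at hj' ⊢ <;> push_cast <;> linear_combination -hj'

/-- The deviation of the character values on unipotent elements from their average. -/
theorem sum_normSq_sub_average {r : ℝ}
    (hr : (r : ℂ) * (Fintype.card F - 1) = ∑ b : Fˣ, ρ.character (upper b)) :
    ∑ b : Fˣ, ρ.character (upper b) * ρ.character (upper (b : F))⁻¹ =
      ((∑ b : Fˣ, Complex.normSq (ρ.character (upper b) - r) : ℝ) : ℂ) +
        r ^ 2 * (Fintype.card F - 1) := by
  have hcard : (Fintype.card Fˣ : ℂ) = Fintype.card F - 1 := by
    rw [Fintype.card_units, Nat.cast_sub Fintype.card_pos, Nat.cast_one]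
  have hconj : ∑ b : Fˣ, ρ.character (upper (b : F))⁻¹ = r * (Fintype.card F - 1) := by
    have := congrArg (starRingEnd ℂ) hr
    simp only [map_mul, map_sub, map_sum, map_natCast, map_one, Complex.conj_ofReal] at this
    rw [this]
    exact Finset.sum_congr rfl fun b _ => character_inv_eq_conj ρ _
  have hpt : ∀ b : Fˣ, ((Complex.normSq (ρ.character (upper b) - r) : ℝ) : ℂ) =
      ρ.character (upper b) * ρ.character (upper (b : F))⁻¹ - r * ρ.character (upper b) -
        r * ρ.character (upper (b : F))⁻¹ + r ^ 2 := by
    intro b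
    rw [Complex.normSq_eq_conj_mul_self, map_sub, Complex.conj_ofReal, ← character_inv_eq_conj]
    ring
  push_cast
  simp only [hpt, Finset.sum_add_distrib, Finset.sum_sub_distrib, ← Finset.mul_sum, hconj, ← hr,
    Finset.sum_const, Finset.card_univ, nsmul_eq_mul, hcard]
  ring

/-- The field of values of an irreducible character of `SL₂` over a finite field is generated
by a single value. -/
theorem exists_forall_character_mem_adjoin
    (hρ : ∑ g, ρ.character g * ρ.character g⁻¹ = Fintype.card (SL₂ F)) :
    ∃ g, ∀ x, ρ.character x ∈ IntermediateField.adjoin ℚ {ρ.character g} := by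
  obtain ⟨ω, hω, hχ⟩ := character_central_involution ρ hρ (-1) (by simp) (by simp)
  have hω2 : ω ^ 2 = 1 := by rcases hω with rfl | rfl <;> norm_num
  obtain ⟨n, k, hn, hk⟩ := exists_unipotent_multiplicity ρ
  obtain ⟨H, _, _, φ, _, hφ, hHcard, hφneg, hφtr, hφsum⟩ := exists_nonsplit_torus (F := F)
  obtain ⟨ε, hε, hval, hMval⟩ := exists_unipotent_values ρ
  set M := ∑ b : Fˣ, ρ.character (upper b) with hM
  have hq : (1 : ℝ) < Fintype.card F := by exact_mod_cast Fintype.one_lt_card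
  have hq1 : (Fintype.card F : ℂ) - 1 ≠ 0 := by
    have : (Fintype.card F : ℝ) - 1 ≠ 0 := by linarith
    exact_mod_cast this
  have hunits : (Fintype.card Fˣ : ℂ) = Fintype.card F - 1 := by
    rw [Fintype.card_units, Nat.cast_sub Fintype.card_pos, Nat.cast_one]
  obtain ⟨z, hz0, hz⟩ : ∃ z : ℕ, 0 < z ∧ (if (-1 : SL₂ F) = 1 then (1 : ℂ) else 2) = z := by
    split_ifs
    · exact ⟨1, by simp⟩
    · exact ⟨2, by simp⟩
  have hz' : (z : ℂ) ≠ 0 := Nat.cast_ne_zero.2 hz0.ne'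
  have hsneg : splitTorus (-1 : Fˣ) = -1 := coe_injective_SL2 (by
    ext i j
    fin_cases i <;> fin_cases j <;> simp)
  obtain ⟨N₁, hN₁, hsum₁, hor₁⟩ := exists_norm_restriction_SL2 ρ (splitTorus (F := F))
    (fun x y h => Units.ext (by simpa using congrArg (fun g : SL₂ F => g.1 0 0) h))
    ⟨-1, hsneg⟩
    (fun x hx => by
      rw [coe_splitTorus, trace_fin_two_of, Units.val_inv_eq_inv_val] at hx
      have h := sq_eq_one_of_add_inv_sq_eq_four x.ne_zero hx
      rcases sq_eq_one_iff.1 h with h | h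
      · exact .inl (by rw [show x = 1 from Units.ext h, map_one])
      · exact .inr (by rw [show x = -1 from Units.ext h, hsneg]))
    hω hχ k (k * Fintype.card Fˣ / z) (by
      rw [hz]
      push_cast
      field_simp)
  obtain ⟨N₂, hN₂, hsum₂, hor₂⟩ := exists_norm_restriction_SL2 ρ φ hφ hφneg hφtr hω hχ k
    (k * Fintype.card H / z) (by
      rw [hz]
      push_cast
      field_simp)
  have hd : ρ.character 1 = Module.finrank ℂ V := ρ.char_one
  obtain ⟨r, hr⟩ : ∃ r : ℚ, (r : ℂ) * (Fintype.card F - 1) = M := by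
    refine ⟨(Fintype.card F * n - Module.finrank ℂ V) / (Fintype.card F - 1), ?_⟩
    push_cast
    rw [div_mul_cancel₀ _ hq1, ← hn, hd]
    ring
  have hP := sum_normSq_sub_average ρ (r := r) (by exact_mod_cast hr)
  set P : ℝ := ∑ b : Fˣ, Complex.normSq (ρ.character (upper b) - (r : ℝ)) with hPdef
  have hgroup := sum_character_mul_inv ρ (fun g => by
    have h : (-1 * g)⁻¹ = -1 * g⁻¹ := by
      rw [_root_.mul_inv_rev, inv_neg, inv_one, mul_neg_one, neg_one_mul]
    rw [h, hχ, hχ]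
    linear_combination ρ.character g * ρ.character g⁻¹ * hω2)
  rw [hρ, hP, hz] at hgroup
  have htrace := sum_trace (regularSquare ρ)
  have htori := hφsum (regularSquare ρ)
  have hcardG : (Fintype.card (SL₂ F) : ℂ) =
      Fintype.card F * ((Fintype.card F - 1) * Fintype.card F + (Fintype.card F - 1)) := by
    simpa [hunits] using sum_trace (fun _ : F => (1 : ℂ))
  have hsplit : ∀ x : Fˣ, (splitTorus x).1.trace = x + (x⁻¹ : Fˣ) := fun x => by
    rw [coe_splitTorus, trace_fin_two_of]
  have hHcard' : (Fintype.card H : ℂ) = Fintype.card F + 1 := by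
    rw [hHcard]
    push_cast
    rfl
  rw [hz] at hsum₁ hsum₂ hk
  simp only [hsplit] at hsum₁
  simp only [Rat.cast_div, Rat.cast_mul, Rat.cast_intCast, Rat.cast_natCast] at hsum₁ hsum₂
  rw [hunits] at hsum₁
  rw [hHcard'] at hsum₂
  have hk' : (k : ℂ) = z * (n - r) := by
    apply mul_right_cancel₀ hq1
    rw [hk, ← hr]
    ring
  have hd' : ρ.character 1 = Fintype.card F * n - r * (Fintype.card F - 1) := by
    linear_combination hn + hr
  have hκ : ∀ x : ℂ, (k : ℂ) * x / z = (n - r) * x := fun x => by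
    rw [hk']
    field_simp
  rw [hκ, hd'] at hsum₁ hsum₂
  rw [hd', htrace, hcardG] at hgroup
  have hmain : (2 - N₁ - N₂ : ℝ) * (Fintype.card F * (Fintype.card F - 1)) *
      (Fintype.card F + 1) = 2 * z * P * (Fintype.card F + 1) := by
    have h : (2 - N₁ - N₂ : ℂ) * (Fintype.card F * (Fintype.card F - 1)) *
        (Fintype.card F + 1) = 2 * z * P * (Fintype.card F + 1) := by
      rw [Complex.ofReal_ratCast] at hgroup
      linear_combination 2 * hgroup -
        (Fintype.card F : ℂ) * (Fintype.card F - 1) * htori +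
        (Fintype.card F : ℂ) * (Fintype.card F + 1) * hsum₁ +
        (Fintype.card F : ℂ) * (Fintype.card F - 1) * hsum₂
    exact_mod_cast h
  replace hmain := mul_right_cancel₀ (by linarith) hmain
  have hP0 : 0 ≤ P := Finset.sum_nonneg fun b _ => Complex.normSq_nonneg _
  have hzR : (0 : ℝ) < z := Nat.cast_pos.2 hz0
  have hqq : (0 : ℝ) < Fintype.card F * (Fintype.card F - 1) :=
    mul_pos (by linarith) (by linarith)
  have hN : N₁ + N₂ ≤ 2 := by
    have h : (0 : ℝ) ≤ 2 - N₁ - N₂ := by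
      by_contra! h
      have h1 := mul_neg_of_neg_of_pos h hqq
      have h2 : 0 ≤ 2 * z * P := by positivity
      linarith
    have h' : (N₁ + N₂ : ℝ) ≤ 2 := by linarith
    exact_mod_cast h'
  have hrational : 2 ≤ N₁ + N₂ → ∀ (L : IntermediateField ℚ ℂ) (b : Fˣ),
      ρ.character (upper b) ∈ L := by
    intro h L b
    have h2 : (N₁ + N₂ : ℝ) = 2 := by exact_mod_cast le_antisymm hN h
    have h3 : P = 0 := by
      have : 2 * z * P = 0 := by
        rw [← hmain, sub_sub, h2]
        ring
      simpa [hzR.ne'] using this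
    rw [hPdef, Finset.sum_eq_zero_iff_of_nonneg fun b _ => Complex.normSq_nonneg _] at h3
    have h4 := Complex.normSq_eq_zero.1 (h3 b (Finset.mem_univ b))
    rw [sub_eq_zero.1 h4, Complex.ofReal_ratCast]
    exact L.algebraMap_mem r
  have hmem := character_mem_of_unipotent_of_tori ρ φ hφsum hω hχ
  have hbot : ∀ (L : IntermediateField ℚ ℂ) {c : ℂ}, c ∈ (⊥ : IntermediateField ℚ ℂ) → c ∈ L :=
    fun L c h => (bot_le : ⊥ ≤ L) h
  rcases hor₁ (by omega) with h₁ | ⟨hN₁', x, hx⟩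
  · rcases hor₂ (by omega) with h₂ | ⟨hN₂', y, hy⟩
    · refine ⟨upper 1, hmem _ (fun b => ?_) (fun x => hbot _ (h₁ x)) (fun y => hbot _ (h₂ y))⟩
      have hA := IntermediateField.mem_adjoin_simple_self ℚ (ρ.character (upper (1 : F)))
      rcases hval b with h | h
      · rw [h]
        exact hA
      · have hB : ρ.character (upper (ε : F)) = (2 * r : ℚ) - ρ.character (upper 1) := by
          apply mul_left_cancel₀ hq1
          push_cast
          linear_combination -hMval - 2 * hr
        rw [h, hB]
        exact sub_mem (IntermediateField.algebraMap_mem _ (2 * r)) hA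
    · exact ⟨φ y, hmem _ (hrational (by omega) _) (fun x => hbot _ (h₁ x)) hy⟩
  · rcases hor₂ (by omega) with h₂ | ⟨hN₂', -⟩
    · exact ⟨splitTorus x, hmem _ (hrational (by omega) _) hx (fun y => hbot _ (h₂ y))⟩
    · omega

end FieldOfValues

/-- For `G = SL₂(F_q)` with `q` a prime power and `χ` an irreducible complex character of `G`,
there exists `g ∈ G` such that the field of values `ℚ(χ)` equals `ℚ(χ(g))`. -/
theorem field_of_values_one_value_SL2 (q : ℕ) (hq : IsPrimePow q)
    (F : Type) [Field F] [Fintype F] (hF : Fintype.card F = q)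
    (V : FDRep ℂ (Matrix.SpecialLinearGroup (Fin 2) F)) (hV : Simple V) :
    ∃ g : Matrix.SpecialLinearGroup (Fin 2) F,
      IntermediateField.adjoin ℚ (Set.range V.character) =
        IntermediateField.adjoin ℚ {V.character g} := by
  classical
  have hρ : ∑ g, V.character g * V.character g⁻¹ =
      Fintype.card (Matrix.SpecialLinearGroup (Fin 2) F) := by
    have hne : (Nat.card (Matrix.SpecialLinearGroup (Fin 2) F) : ℂ) ≠ 0 :=
      Nat.cast_ne_zero.2 Nat.card_pos.ne'
    let _ : Invertible (Nat.card (Matrix.SpecialLinearGroup (Fin 2) F) : ℂ) :=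
      invertibleOfNonzero hne
    have h := FDRep.char_orthonormal V V
    rw [if_pos ⟨Iso.refl V⟩] at h
    rw [← Nat.card_eq_fintype_card]
    have h' := congrArg ((Nat.card (Matrix.SpecialLinearGroup (Fin 2) F) : ℂ) * ·) h
    simpa [hne] using h'
  obtain ⟨g, hg⟩ := exists_forall_character_mem_adjoin V.ρ hρ
  refine ⟨g, le_antisymm (IntermediateField.adjoin_le_iff.2 (Set.range_subset_iff.2 hg)) ?_⟩
  exact IntermediateField.adjoin_simple_le_iff.2
    (IntermediateField.subset_adjoin ℚ _ (Set.mem_range_self g))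
end

section
/- Let α be a cyclotomic integer written as α = ξ₁ + ⋯ + ξ_k, where each ξ_i is a root of unity, and assume α cannot be expressed as a sum of fewer than k roots of unity. Then each ξ_i lies in the cyclotomic field ℚ(ζ_{c(α)}), and consequently ℚ(ζ_{c(α)}) = ℚ(ξ₁, …, ξ_k). -/
open CategoryTheory

open IntermediateField

/-- If `θ ^ M` is a primitive `p`-th root of unity, every `M * p`-th root of unity is an `M`-th
root of unity times a power `θ ^ r` with `r < p`. -/
theorem exists_eq_mul_pow_of_isPrimitiveRoot_pow {M p : ℕ} (hM : 0 < M) (hp : 0 < p) {θ x : ℂ}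
    (hθ : IsPrimitiveRoot (θ ^ M) p) (hx : x ^ (M * p) = 1) :
    ∃ r < p, ∃ η : ℂ, η ^ M = 1 ∧ x = η * θ ^ r := by
  have : NeZero p := ⟨hp.ne'⟩
  rw [pow_mul] at hx
  obtain ⟨r, hr, h⟩ := hθ.eq_pow_of_pow_eq_one hx
  have hθ0 : θ ≠ 0 := (pow_ne_zero_iff hM.ne').1 (hθ.ne_zero hp.ne')
  refine ⟨r, hr, x / θ ^ r, ?_, by field_simp⟩
  rw [div_pow, ← h, ← pow_mul, ← pow_mul, mul_comm r M, div_self (pow_ne_zero _ hθ0)]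

theorem finrank_adjoin_isPrimitiveRoot {n : ℕ} (hn : 0 < n) {ω : ℂ} (hω : IsPrimitiveRoot ω n) :
    Module.finrank ℚ ℚ⟮ω⟯ = n.totient := by
  rw [adjoin.finrank (hω.isIntegral hn |>.tower_top), ← Polynomial.cyclotomic_eq_minpoly_rat hω hn,
    Polynomial.natDegree_cyclotomic]

theorem mem_adjoin_of_pow_eq_one {n : ℕ} (hn : 0 < n) {ω x : ℂ} (hω : IsPrimitiveRoot ω n)
    (hx : x ^ n = 1) : x ∈ ℚ⟮ω⟯ := by
  have : NeZero n := ⟨hn.ne'⟩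
  obtain ⟨i, -, rfl⟩ := hω.eq_pow_of_pow_eq_one hx
  exact pow_mem (mem_adjoin_simple_self ℚ ω) i

theorem totient_mul_le_natDegree_minpoly {M p : ℕ} (hM : 0 < M) (hp : 0 < p) {ω θ : ℂ}
    (hω : IsPrimitiveRoot ω M) (hθ : IsPrimitiveRoot (θ ^ M) p) :
    (M * p).totient ≤ M.totient * (minpoly ℚ⟮ω⟯ θ).natDegree := by
  have hθint : IsIntegral ℚ⟮ω⟯ θ :=
    (IsIntegral.of_pow hM (hθ.isIntegral hp)).tower_top
  have hωint : IsIntegral ℚ ω := (hω.isIntegral hM).tower_top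
  have := adjoin.finiteDimensional hωint
  have := adjoin.finiteDimensional hθint
  have hMp : 0 < M * p := Nat.mul_pos hM hp
  have hζ := Complex.isPrimitiveRoot_exp (M * p) hMp.ne'
  set ζ := Complex.exp (2 * Real.pi * Complex.I / (M * p : ℕ))
  have hfin : FiniteDimensional ℚ ℚ⟮ω⟯⟮θ⟯ := FiniteDimensional.trans ℚ ℚ⟮ω⟯ ℚ⟮ω⟯⟮θ⟯
  have hmem : ζ ∈ ℚ⟮ω⟯⟮θ⟯.restrictScalars ℚ := by
    obtain ⟨r, -, η, hη, h⟩ := exists_eq_mul_pow_of_isPrimitiveRoot_pow hM hp hθ hζ.pow_eq_one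
    rw [h, mem_restrictScalars]
    refine mul_mem ?_ (pow_mem (mem_adjoin_simple_self _ θ) r)
    exact ℚ⟮ω⟯⟮θ⟯.algebraMap_mem ⟨η, mem_adjoin_of_pow_eq_one hM hω hη⟩
  have hle : ℚ⟮ζ⟯ ≤ ℚ⟮ω⟯⟮θ⟯.restrictScalars ℚ := by
    rwa [adjoin_simple_le_iff]
  have hfin' : FiniteDimensional ℚ (ℚ⟮ω⟯⟮θ⟯.restrictScalars ℚ) := hfin
  calc (M * p).totient = Module.finrank ℚ ℚ⟮ζ⟯ := (finrank_adjoin_isPrimitiveRoot hMp hζ).symm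
    _ ≤ Module.finrank ℚ (ℚ⟮ω⟯⟮θ⟯.restrictScalars ℚ) :=
      LinearMap.finrank_le_finrank_of_injective (f := (inclusion hle).toLinearMap)
        (inclusion hle).injective
    _ = Module.finrank ℚ ℚ⟮ω⟯ * Module.finrank ℚ⟮ω⟯ ℚ⟮ω⟯⟮θ⟯ :=
      (Module.finrank_mul_finrank ℚ ℚ⟮ω⟯ ℚ⟮ω⟯⟮θ⟯).symm
    _ = _ := by rw [finrank_adjoin_isPrimitiveRoot hM hω, adjoin.finrank hθint]

theorem eq_zero_of_sum_mul_pow_eq_zero {F : IntermediateField ℚ ℂ} {θ : ℂ} {d : ℕ}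
    (hd : d ≤ (minpoly F θ).natDegree) {c : ℕ → ℂ} (hc : ∀ r, c r ∈ F)
    (h : ∑ r ∈ Finset.range d, c r * θ ^ r = 0) {r : ℕ} (hr : r < d) : c r = 0 := by
  have hli := (linearIndependent_pow (K := F) θ).comp (Fin.castLE hd) (Fin.castLE_injective hd)
  rw [Fintype.linearIndependent_iff] at hli
  have := hli (fun i => ⟨c i, hc i⟩) (by
    rw [← h, ← Fin.sum_univ_eq_sum_range (fun r => c r * θ ^ r)]
    rfl) ⟨r, hr⟩
  simpa using congrArg Subtype.val this

theorem cycField_eq_toSubfield_adjoin {n : ℕ} (hn : 0 < n) {ω : ℂ} (hω : IsPrimitiveRoot ω n) :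
    cycField n = ℚ⟮ω⟯.toSubfield := by
  apply le_antisymm
  · exact Subfield.closure_le.2 fun x hx => mem_adjoin_of_pow_eq_one hn hω hx
  · have : ℚ⟮ω⟯ ≤ Subfield.toIntermediateField (K := ℚ) (cycField n)
        (fun q => SubfieldClass.ratCast_mem (cycField n) q) := by
      rw [adjoin_simple_le_iff]
      exact Subfield.subset_closure hω.pow_eq_one
    exact this

theorem cycField_mono {m n : ℕ} (h : m ∣ n) : cycField m ≤ cycField n :=
  Subfield.closure_mono fun x (hx : x ^ m = 1) => by
    obtain ⟨k, rfl⟩ := h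
    simp [pow_mul, hx]

theorem cycField_two_mul {n : ℕ} (hn : Odd n) : cycField (2 * n) = cycField n := by
  refine le_antisymm (Subfield.closure_le.2 fun x hx => ?_) (cycField_mono (dvd_mul_left _ _))
  have hx' : (x ^ n) ^ 2 = 1 := by rwa [← pow_mul, mul_comm]
  rcases eq_or_eq_neg_of_sq_eq_sq (x ^ n) 1 (by rw [hx', one_pow]) with h | h
  · exact Subfield.subset_closure h
  · rw [← neg_neg x]
    exact neg_mem (Subfield.subset_closure (by simp [hn.neg_pow, h]))

theorem IsRootOfUnity.neg {z : ℂ} (hz : IsRootOfUnity z) : IsRootOfUnity (-z) := by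
  obtain ⟨n, hn, h⟩ := hz
  exact ⟨2 * n, by omega, by rw [(even_two_mul n).neg_pow, mul_comm, pow_mul, h, one_pow]⟩

/-- `α` is not a sum of fewer than `k` roots of unity. -/
def NotSumOfFewer (k : ℕ) (α : ℂ) : Prop :=
  ∀ (j : ℕ) (η : Fin j → ℂ), (∀ i, IsRootOfUnity (η i)) → α = ∑ i, η i → k ≤ j

theorem NotSumOfFewer.le_card {k : ℕ} {α : ℂ} (h : NotSumOfFewer k α) {ι : Type*} (S : Finset ι)
    (f : ι → ℂ) (hf : ∀ i, IsRootOfUnity (f i)) (hα : α = ∑ i ∈ S, f i) : k ≤ S.card := by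
  refine h S.card (fun i => f (S.equivFin.symm i)) (fun i => hf _) ?_
  rw [hα, ← Finset.sum_coe_sort]
  exact (S.equivFin.symm.sum_comp (fun i : S => f i)).symm

theorem pow_eq_one_of_pow_mul_prime_eq_one {M p k : ℕ} (hM : 0 < M) (hM2 : Even M) (hp : p.Prime)
    {ξ : Fin k → ℂ} (hmin : NotSumOfFewer k (∑ i, ξ i)) (hα : ∑ i, ξ i ∈ cycField M)
    (hξ : ∀ i, ξ i ^ (M * p) = 1) (i : Fin k) : ξ i ^ M = 1 := by
  classical
  have hω := Complex.isPrimitiveRoot_exp M hM.ne'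
  set ω := Complex.exp (2 * Real.pi * Complex.I / M)
  rw [cycField_eq_toSubfield_adjoin hM hω] at hα
  change _ ∈ ℚ⟮ω⟯ at hα
  have key : ∃ θ : ℂ, IsPrimitiveRoot (θ ^ M) p ∧ (p ∣ M ∨ θ ^ p = 1 ∧ ¬ p ∣ M) := by
    by_cases hpM : p ∣ M
    · have hζ := Complex.isPrimitiveRoot_exp (M * p) (Nat.mul_pos hM hp.pos).ne'
      exact ⟨_, hζ.pow (Nat.mul_pos hM hp.pos) rfl, Or.inl hpM⟩
    · have hζ := Complex.isPrimitiveRoot_exp p hp.ne_zero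
      exact ⟨_, hζ.pow_of_coprime M ((Nat.Prime.coprime_iff_not_dvd hp).2 hpM).symm,
        Or.inr ⟨hζ.pow_eq_one, hpM⟩⟩
  obtain ⟨θ, hθ, hcase⟩ := key
  choose r hr η hη hξη using
    fun i => exists_eq_mul_pow_of_isPrimitiveRoot_pow hM hp.pos hθ (hξ i)
  have hroot : ∀ i, IsRootOfUnity (η i) := fun i => ⟨M, hM, hη i⟩
  let S : ℕ → Finset (Fin k) := fun s => Finset.univ.filter fun i => r i = s
  let a : ℕ → ℂ := fun s => ∑ i ∈ S s, η i
  have ha : ∀ s, a s ∈ ℚ⟮ω⟯ := fun s =>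
    sum_mem fun i _ => mem_adjoin_of_pow_eq_one hM hω (hη i)
  have hsum : ∑ i, ξ i = ∑ s ∈ Finset.range p, a s * θ ^ s := by
    rw [← Finset.sum_fiberwise_of_maps_to (s := Finset.univ) (t := Finset.range p) (g := r)
      (fun i _ => Finset.mem_range.2 (hr i))]
    refine Finset.sum_congr rfl fun s _ => ?_
    rw [Finset.sum_mul]
    refine Finset.sum_congr rfl fun i hi => ?_
    rw [hξη i, (Finset.mem_filter.1 hi).2]
  have hdeg := totient_mul_le_natDegree_minpoly hM hp.pos hω hθ
  have hφ : 0 < M.totient := Nat.totient_pos.2 hM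
  suffices hk : k ≤ (S 0).card by
    have : S 0 = Finset.univ := by
      rw [← Finset.card_eq_iff_eq_univ, Fintype.card_fin]
      exact le_antisymm (by simpa using Finset.card_le_univ (S 0)) hk
    have h0 : r i = 0 := by
      have : i ∈ S 0 := this ▸ Finset.mem_univ i
      exact (Finset.mem_filter.1 this).2
    rw [hξη i, h0, pow_zero, mul_one, hη]
  rcases hcase with hpM | ⟨hθp, hpM⟩
  · rw [mul_comm M p, Nat.totient_mul_of_prime_of_dvd hp hpM, mul_comm p] at hdeg
    have hdeg := le_of_mul_le_mul_left hdeg hφ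
    refine hmin.le_card (S 0) η hroot ?_
    have hc := eq_zero_of_sum_mul_pow_eq_zero hdeg (c := fun s => if s = 0 then
      a 0 - ∑ i, ξ i else a s) (fun s => by
        split_ifs
        exacts [sub_mem (ha 0) hα, ha s]) (r := 0) ?_ hp.pos
    · exact (sub_eq_zero.1 hc).symm
    · obtain ⟨q, rfl⟩ : ∃ q, p = q + 1 := ⟨p - 1, by have := hp.pos; omega⟩
      rw [Finset.sum_range_succ'] at hsum ⊢
      simp only [Nat.add_eq_zero_iff, one_ne_zero, and_false, if_false, if_true, pow_zero, mul_one]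
        at hsum ⊢
      linear_combination -hsum
  · rw [mul_comm M p, Nat.totient_mul_of_prime_of_not_dvd hp hpM, mul_comm (p - 1)] at hdeg
    have hdeg := le_of_mul_le_mul_left hdeg hφ
    have hp3 : 3 ≤ p := by
      have := hp.two_le
      have : p ≠ 2 := by
        rintro rfl
        exact hpM hM2.two_dvd
      omega
    have hgeom : ∑ s ∈ Finset.range p, θ ^ s = 0 := by
      have hθ1 : θ ≠ 1 := by
        rintro rfl
        have := hθ.eq_orderOf
        simp at this
        omega
      have := mul_geom_sum θ p
      rw [hθp, sub_self] at this
      exact (mul_eq_zero.1 this).resolve_left (sub_ne_zero.2 hθ1)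
    obtain ⟨q, rfl⟩ : ∃ q, p = q + 2 := ⟨p - 2, by omega⟩
    have hc := fun s hs => eq_zero_of_sum_mul_pow_eq_zero hdeg (c := fun s => if s = 0 then
      a 0 - a (q + 1) - ∑ i, ξ i else a s - a (q + 1)) (fun s => by
        split_ifs
        exacts [sub_mem (sub_mem (ha 0) (ha _)) hα, sub_mem (ha s) (ha _)]) (r := s) (by
      change ∑ r ∈ Finset.range (q + 1), _ = _
      rw [Finset.sum_range_succ, Finset.sum_range_succ'] at hsum hgeom
      rw [Finset.sum_range_succ']
      simp only [Nat.add_eq_zero_iff, one_ne_zero, and_false, if_false, if_true, pow_zero, mul_one,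
        sub_mul, Finset.sum_sub_distrib, ← Finset.mul_sum] at hsum hgeom ⊢
      linear_combination -hsum - a (q + 1) * hgeom) hs
    have hlast : a 1 = a (q + 1) := by
      simpa [sub_eq_zero] using hc 1 (by omega)
    have hzero : ∑ i, ξ i = a 0 - a (q + 1) := by
      exact (sub_eq_zero.1 (hc 0 (by omega))).symm
    have hdisj : ∀ {s t : ℕ}, s ≠ t → Disjoint (S s) (S t) := fun hst =>
      Finset.disjoint_filter.2 fun i _ h h' => hst (h.symm.trans h')
    have hbound : ∀ s, s ≠ 0 → ∑ i, ξ i = a 0 - a s → k ≤ (S 0).card + (S s).card := by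
      intro s hs h
      rw [← Finset.card_union_of_disjoint (hdisj hs.symm)]
      refine hmin.le_card (S 0 ∪ S s) (fun i => if r i = 0 then η i else - η i) (fun i => ?_) ?_
      · split_ifs
        exacts [hroot i, (hroot i).neg]
      · rw [h, Finset.sum_union (hdisj hs.symm), sub_eq_add_neg, ← Finset.sum_neg_distrib]
        congr 1
        · refine Finset.sum_congr rfl fun i hi => ?_
          rw [if_pos (Finset.mem_filter.1 hi).2]
        · refine Finset.sum_congr rfl fun i hi => ?_
          rw [if_neg ((Finset.mem_filter.1 hi).2 ▸ hs)]
    have h1 := hbound 1 one_ne_zero (hlast ▸ hzero)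
    have h2 := hbound (q + 1) (by omega) hzero
    have h3 : (S 0).card + (S 1).card + (S (q + 1)).card ≤ k := by
      rw [← Finset.card_union_of_disjoint (hdisj zero_ne_one),
        ← Finset.card_union_of_disjoint]
      · simpa using Finset.card_le_univ (S 0 ∪ S 1 ∪ S (q + 1))
      · exact Finset.disjoint_union_left.2 ⟨hdisj (by omega), hdisj (by omega)⟩
    omega

theorem pow_eq_one_of_pow_mul_eq_one {M k : ℕ} (hM : 0 < M) (hM2 : Even M)
    {ξ : Fin k → ℂ} (hmin : NotSumOfFewer k (∑ i, ξ i)) (hα : ∑ i, ξ i ∈ cycField M)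
    {q : ℕ} (hq : 0 < q) (hξ : ∀ i, ξ i ^ (M * q) = 1) (i : Fin k) : ξ i ^ M = 1 := by
  induction q using induction_on_primes with
  | zero => omega
  | one => simpa using hξ i
  | prime_mul p q hp ih =>
    have hq : 0 < q := Nat.pos_of_mul_pos_left hq
    refine ih hq fun j => ?_
    refine pow_eq_one_of_pow_mul_prime_eq_one (Nat.mul_pos hM hq) (hM2.mul_right q) hp hmin
      (cycField_mono (dvd_mul_right M q) hα) (fun l => ?_) j
    rw [← hξ l]
    congr 1
    ring

/-- A finite family of `n`-th roots of unity generates the cyclotomic field `cycField d` for some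
`d ∣ n`. -/
theorem exists_closure_range_eq_cycField {n k : ℕ} (hn : 0 < n) {ξ : Fin k → ℂ}
    (hξ : ∀ i, ξ i ^ n = 1) : ∃ d, d ∣ n ∧ Subfield.closure (Set.range ξ) = cycField d := by
  have : NeZero n := ⟨hn.ne'⟩
  choose u hu using fun i => IsUnit.of_pow_eq_one (hξ i) hn.ne'
  let G := Subgroup.closure (Set.range u)
  have hcard : ∀ m : ℕ, m ≠ 0 → Nat.card (rootsOfUnity m ℂ) = m := fun m hm => by
    have : NeZero m := ⟨hm⟩
    exact Complex.card_rootsOfUnity m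
  have hGn : G ≤ rootsOfUnity n ℂ := by
    rw [Subgroup.closure_le]
    rintro _ ⟨i, rfl⟩
    exact (mem_rootsOfUnity' n _).2 (by rw [hu, hξ])
  have hfin : Finite G := Finite.of_injective _ (Subgroup.inclusion_injective hGn)
  have hd0 : Nat.card G ≠ 0 := Nat.card_pos.ne'
  have : NeZero (Nat.card G) := ⟨hd0⟩
  have hGd : G = rootsOfUnity (Nat.card G) ℂ := by
    refine Subgroup.eq_of_le_of_card_ge (fun g hg => ?_) (hcard _ hd0).le
    rw [mem_rootsOfUnity]
    exact congrArg Subtype.val (pow_card_eq_one' (x := (⟨g, hg⟩ : G)))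
  refine ⟨Nat.card G, ?_, le_antisymm (Subfield.closure_mono ?_) (Subfield.closure_le.2 ?_)⟩
  · exact hcard n hn.ne' ▸ Subgroup.card_dvd_of_le hGn
  · rintro _ ⟨i, rfl⟩
    have hi : u i ∈ rootsOfUnity (Nat.card G) ℂ :=
      hGd ▸ Subgroup.subset_closure (Set.mem_range_self i)
    rwa [mem_rootsOfUnity', hu] at hi
  · intro z hz
    obtain ⟨v, rfl⟩ := IsUnit.of_pow_eq_one hz hd0
    have hv : v ∈ G := by
      rw [hGd]
      exact (mem_rootsOfUnity' _ _).2 hz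
    clear hz
    induction hv using Subgroup.closure_induction with
    | mem x hx =>
      obtain ⟨i, rfl⟩ := hx
      exact Subfield.subset_closure ⟨i, (hu i).symm⟩
    | one => exact one_mem _
    | mul x y _ _ hx hy => exact mul_mem hx hy
    | inv x _ hx => simpa using inv_mem hx

/-- Loxton's theorem: if `α = ξ₁ + ⋯ + ξ_k` is a sum of `k` roots of unity which cannot be
written as a sum of fewer than `k` roots of unity, then each `ξ_i` lies in `ℚ(ζ_{c(α)})`,
and `ℚ(ζ_{c(α)}) = ℚ(ξ₁, …, ξ_k)`. -/
theorem roots_in_conductor_field (k : ℕ) (ξ : Fin k → ℂ)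
    (hξ : ∀ i, IsRootOfUnity (ξ i)) (α : ℂ) (hα : α = ∑ i, ξ i)
    (hmin : ∀ (j : ℕ) (η : Fin j → ℂ), (∀ i, IsRootOfUnity (η i)) →
      α = ∑ i, η i → k ≤ j) :
    (∀ i, ξ i ∈ cycField (conductorOf {α})) ∧
      cycField (conductorOf {α}) = Subfield.closure (Set.range ξ) := by
  subst hα
  choose n hn hξn using hξ
  let N := ∏ i, n i
  have hN : 0 < N := Finset.prod_pos fun i _ => hn i
  have hξN : ∀ m i, ξ i ^ (m * N) = 1 := fun m i => by
    obtain ⟨t, ht⟩ := (Finset.dvd_prod_of_mem n (Finset.mem_univ i)).mul_left m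
    rw [ht, pow_mul, hξn, one_pow]
  have hmem : conductorOf {∑ i, ξ i} ∈ {n : ℕ | 0 < n ∧ {∑ i, ξ i} ⊆ (cycField n : Set ℂ)} := by
    refine Nat.sInf_mem ⟨N, hN, Set.singleton_subset_iff.2 (sum_mem fun i _ => ?_)⟩
    exact Subfield.subset_closure (by simpa using hξN 1 i)
  have hle : ∀ d, 0 < d → ∑ i, ξ i ∈ cycField d → conductorOf {∑ i, ξ i} ≤ d := fun d hd h =>
    Nat.sInf_le ⟨hd, Set.singleton_subset_iff.2 h⟩
  set c := conductorOf {∑ i, ξ i}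
  obtain ⟨hc, hαc⟩ := hmem
  rw [Set.singleton_subset_iff, SetLike.mem_coe] at hαc
  have hmemK : ∑ i, ξ i ∈ Subfield.closure (Set.range ξ) :=
    sum_mem fun i _ => Subfield.subset_closure (Set.mem_range_self i)
  suffices h : cycField c = Subfield.closure (Set.range ξ) from
    ⟨fun i => h ▸ Subfield.subset_closure (Set.mem_range_self i), h⟩
  rcases Nat.even_or_odd c with hev | hodd
  · obtain ⟨d, hd, hK⟩ := exists_closure_range_eq_cycField hc
      (pow_eq_one_of_pow_mul_eq_one hc hev hmin hαc hN (hξN c))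
    rw [hK] at hmemK ⊢
    rw [le_antisymm (hle d (Nat.pos_of_dvd_of_pos hd hc) hmemK) (Nat.le_of_dvd hc hd)]
  · have hc2 : 0 < 2 * c := by omega
    obtain ⟨d, ⟨e, he⟩, hK⟩ := exists_closure_range_eq_cycField hc2
      (pow_eq_one_of_pow_mul_eq_one hc2 (even_two_mul c) hmin
        (cycField_mono (dvd_mul_left c 2) hαc) hN (hξN (2 * c)))
    rw [hK] at hmemK ⊢
    have hcd := hle d (Nat.pos_of_dvd_of_pos ⟨e, he⟩ hc2) hmemK
    have he2 : e ≤ 2 := by nlinarith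
    interval_cases e
    · omega
    · rw [← cycField_two_mul hodd, he, mul_one]
    · rw [show d = c by omega]
end

section
/- Let n, m, and k be fixed integers with k even. Assume that for all integers c and d satisfying nc + md = gcd(n,m), the congruence nc + md ≡ nd + mc + k/2 (mod k) holds. Then (n² − m²)/gcd(n,m) is divisible by k. -/
/-- Let `n, m, k` be integers with `k` even. If for all integers `c, d` with
`nc + md = gcd(n,m)` one has `nc + md ≡ nd + mc + k/2 (mod k)`, then `k` divides
`(n² − m²)/gcd(n,m)`. -/
theorem dvd_of_congruence_half (n m k : ℤ) (hk : 2 ∣ k)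
    (h : ∀ c d : ℤ, n * c + m * d = (Int.gcd n m : ℤ) →
      Int.ModEq k (n * c + m * d) (n * d + m * c + k / 2)) :
    k ∣ (n ^ 2 - m ^ 2) / (Int.gcd n m : ℤ) := by
  have bezout : n * n.gcdA m + m * n.gcdB m = (Int.gcd n m : ℤ) := (Int.gcd_eq_gcd_ab n m).symm
  obtain ⟨a, ha⟩ := Int.gcd_dvd_left n m
  obtain ⟨b, hb⟩ := Int.gcd_dvd_right n m
  generalize n.gcdA m = c at bezout
  generalize n.gcdB m = d at bezout
  generalize (Int.gcd n m : ℤ) = g at *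
  rcases eq_or_ne g 0 with rfl | hg
  · simp
  have shift : n * b - m * a = 0 := by rw [ha, hb]; ring
  have bezout_shift : n * (c + b) + m * (d - a) = g := by linear_combination bezout + shift
  have quotient : (n ^ 2 - m ^ 2) / g = n * a - m * b :=
    Int.ediv_eq_of_eq_mul_right hg (by linear_combination n * ha - m * hb)
  have key := dvd_sub (h c d bezout).dvd (h (c + b) (d - a) bezout_shift).dvd
  rw [quotient]
  refine (congrArg (k ∣ ·) ?_).mp key
  linear_combination shift
end

section
/- Let n, m, and k be fixed integers with 3 dividing k. Assume that for every pair of integers c, d with nc + md = gcd(n,m), there exists a sign σ_{c,d} ∈ {−1, 1} such that nc + md ≡ nd + mc + σ_{c,d}·(k/3) (mod k). Then in fact there is a single fixed sign σ ∈ {−1, 1} such that nc + md ≡ nd + mc + σ·(k/3) (mod k) for all integers c, d with nc + md = gcd(n,m); in particular, (n² − m²)/gcd(n,m) is divisible by k. -/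
/-- If three consecutive terms `x`, `x + D`, `x + 2 * D` of an arithmetic progression are each
congruent to `j` or `-j` modulo `3 * j`, then `3 * j` divides the common difference `D`. -/
lemma three_mul_dvd_of_forall_sign {j D x : ℤ}
    (h : ∀ t ∈ Finset.range 3, ∃ σ : ℤ, (σ = 1 ∨ σ = -1) ∧ 3 * j ∣ x + t * D - σ * j) :
    3 * j ∣ D := by
  obtain ⟨s₀, hs₀, u₀, h₀⟩ := h 0 (by simp)
  obtain ⟨s₁, hs₁, u₁, h₁⟩ := h 1 (by simp)
  obtain ⟨s₂, hs₂, u₂, h₂⟩ := h 2 (by simp)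
  push_cast at h₀ h₁ h₂
  have hD : D = j * (s₁ - s₀ + 3 * (u₁ - u₀)) := by linear_combination h₁ - h₀
  rcases eq_or_ne j 0 with rfl | hj
  · simp [hD]
  have hcancel : s₁ - s₀ + 3 * (u₁ - u₀) = s₂ - s₁ + 3 * (u₂ - u₁) :=
    mul_left_cancel₀ hj (by linear_combination h₀ + h₂ - 2 * h₁)
  have hs : s₁ = s₀ := by omega
  exact ⟨u₁ - u₀, by rw [hD, hs]; ring⟩

/-- Let `n, m, k` be integers with `3 ∣ k`. If for every pair of integers `c, d` with
`nc + md = gcd(n,m)` there is a sign `σ_{c,d} ∈ {−1,1}` with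
`nc + md ≡ nd + mc + σ_{c,d}·(k/3) (mod k)`, then there is a single fixed sign
`σ ∈ {−1,1}` working for all such `c, d`; in particular `k` divides
`(n² − m²)/gcd(n,m)`. -/
theorem fixed_sign_of_congruence_third (n m k : ℤ) (hk : 3 ∣ k)
    (h : ∀ c d : ℤ, n * c + m * d = (Int.gcd n m : ℤ) →
      ∃ σ : ℤ, (σ = 1 ∨ σ = -1) ∧
        Int.ModEq k (n * c + m * d) (n * d + m * c + σ * (k / 3))) :
    (∃ σ : ℤ, (σ = 1 ∨ σ = -1) ∧
      ∀ c d : ℤ, n * c + m * d = (Int.gcd n m : ℤ) →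
        Int.ModEq k (n * c + m * d) (n * d + m * c + σ * (k / 3))) ∧
    k ∣ (n ^ 2 - m ^ 2) / (Int.gcd n m : ℤ) := by
  obtain ⟨j, rfl⟩ := hk
  rw [Int.mul_ediv_cancel_left j three_ne_zero] at *
  rcases eq_or_ne (Int.gcd n m : ℤ) 0 with hg | hg
  · obtain ⟨rfl, rfl⟩ := Int.gcd_eq_zero_iff.mp (by exact_mod_cast hg)
    obtain ⟨σ, hσ, h₀⟩ := h 0 0 (by simp)
    exact ⟨⟨σ, hσ, fun c d _ => by simpa using h₀⟩, by simp⟩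
  obtain ⟨a, ha⟩ := Int.gcd_dvd_left n m
  obtain ⟨b, hb⟩ := Int.gcd_dvd_right n m
  have bezout := Int.gcd_eq_gcd_ab n m
  generalize Int.gcdA n m = c₀, Int.gcdB n m = d₀ at bezout
  generalize (Int.gcd n m : ℤ) = g at *
  subst ha hb
  have hone : a * c₀ + b * d₀ = 1 :=
    mul_left_cancel₀ hg (by linear_combination -bezout)
  have hquot : ((g * a) ^ 2 - (g * b) ^ 2) / g = g * (a ^ 2 - b ^ 2) :=
    Int.ediv_eq_of_eq_mul_right hg (by ring)
  have hdvd : 3 * j ∣ g * (a ^ 2 - b ^ 2) := by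
    refine three_mul_dvd_of_forall_sign
      (x := g * a * c₀ + g * b * d₀ - g * a * d₀ - g * b * c₀) fun t _ => ?_
    obtain ⟨σ, hσ, hmod⟩ := h (c₀ + t * b) (d₀ - t * a) (by linear_combination -bezout)
    refine ⟨σ, hσ, ?_⟩
    convert hmod.symm.dvd using 1
    ring
  refine ⟨?_, hquot ▸ hdvd⟩
  obtain ⟨σ, hσ, h₀⟩ := h c₀ d₀ bezout.symm
  refine ⟨σ, hσ, fun c d hcd => ?_⟩
  have hone' : a * c + b * d = 1 := mul_left_cancel₀ hg (by linear_combination hcd)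
  have hc : c = c₀ + (d₀ * c - c₀ * d) * b := by
    linear_combination (-c) * hone + c₀ * hone'
  have hd : d = d₀ - (d₀ * c - c₀ * d) * a := by
    linear_combination (-d) * hone + d₀ * hone'
  generalize d₀ * c - c₀ * d = t at hc hd
  subst hc hd
  obtain ⟨u, hu⟩ := h₀.symm.dvd
  obtain ⟨v, hv⟩ := hdvd
  exact (Int.modEq_iff_dvd.mpr ⟨u + t * v, by linear_combination hu + t * hv⟩).symm
end

section
/- Let q be a prime power, let ε be a primitive (q−1)-th root of unity in ℂ, and let m, n be integers with 0 ≤ m < n ≤ q−2. Let S be the set of cyclotomic integers S = {ε^{(m+n)a} : 0 ≤ a ≤ q−2} ∪ {ε^{nc+md} + ε^{nd+mc} : 0 ≤ c < d ≤ q−2}. Then there exists z ∈ S such that c(S) = c(z). -/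
open CategoryTheory

/-- Endomorphisms preserve every subfield generated by an element of a cyclotomic extension. -/
theorem algHom_apply_mem_adjoin_of_mem_cyclotomic {F L : Type*} [Field F] [Field L] [Algebra F L]
    {N : ℕ} [NeZero N] {ε z : L} (hε : IsPrimitiveRoot ε N)
    (hz : z ∈ IntermediateField.adjoin F {ε}) (σ : L →ₐ[F] L) :
    σ z ∈ IntermediateField.adjoin F {z} := by
  have hint : IsIntegral F ε := (hε.isIntegral (NeZero.pos N)).tower_top
  have : IsCyclotomicExtension {N} F (IntermediateField.adjoin F {ε}) := by
    change IsCyclotomicExtension {N} F (IntermediateField.adjoin F {ε}).toSubalgebra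
    rw [IntermediateField.adjoin_simple_toSubalgebra_of_isAlgebraic hint.isAlgebraic]
    exact hε.adjoin_isCyclotomicExtension F
  have : IsAbelianGalois F (IntermediateField.adjoin F {ε}) :=
    IsCyclotomicExtension.isAbelianGalois {N} F _
  have hle : IntermediateField.adjoin F {z} ≤ IntermediateField.adjoin F {ε} := by
    simpa [IntermediateField.adjoin_le_iff] using hz
  have : IsAbelianGalois F (IntermediateField.adjoin F {z}) :=
    IsAbelianGalois.of_algHom (IntermediateField.inclusion hle)
  rw [← AlgHom.fieldRange_of_normal (σ.comp (IntermediateField.adjoin F {z}).val)]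
  exact ⟨⟨z, IntermediateField.mem_adjoin_simple_self F z⟩, rfl⟩

/-- If `S` lies in the field generated by one of its elements, its conductor is attained there. -/
theorem conductorOf_eq_singleton {S : Set ℂ} {z : ℂ} (hz : z ∈ S)
    (hS : S ⊆ (IntermediateField.adjoin ℚ {z} : Set ℂ)) : conductorOf S = conductorOf {z} := by
  have hmem (k : ℕ) : S ⊆ (cycField k : Set ℂ) ↔ {z} ⊆ (cycField k : Set ℂ) := by
    refine ⟨fun h => Set.singleton_subset_iff.mpr (h hz), fun h x hx => ?_⟩
    have hxz := hS hx
    clear hx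
    induction hxz using IntermediateField.adjoin_induction with
    | mem x hx => exact h hx
    | algebraMap r => exact SubfieldClass.ratCast_mem (cycField k) r
    | add x y _ _ hx hy => exact add_mem hx hy
    | inv x _ hx => exact inv_mem hx
    | mul x y _ _ hx hy => exact mul_mem hx hy
  simp only [conductorOf, hmem]

/-- A subring containing `x + y` and `x * y` contains every power sum `x ^ k + y ^ k`. -/
theorem pow_add_pow_mem {R A : Type*} [CommRing R] [SetLike A R] [SubringClass A R] (K : A)
    {x y : R} (hadd : x + y ∈ K) (hmul : x * y ∈ K) (k : ℕ) : x ^ k + y ^ k ∈ K := by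
  induction k using Nat.twoStepInduction with
  | zero => simpa using add_mem (one_mem K) (one_mem K)
  | one => simpa using hadd
  | more k h₀ h₁ =>
    have : x ^ (k + 2) + y ^ (k + 2) =
        (x + y) * (x ^ (k + 1) + y ^ (k + 1)) - x * y * (x ^ k + y ^ k) := by ring
    rw [this]
    exact sub_mem (mul_mem hadd h₁) (mul_mem hmul h₀)

/-- For `q` a prime power, `ε` a primitive `(q−1)`-th root of unity and `0 ≤ m < n ≤ q−2`,
the conductor of the reduced value set of the character `X_{(m,n)}` of `GL₂(F_q)` is
attained at a single value. -/
theorem conductor_one_value_Xmn (q : ℕ) (hq : IsPrimePow q)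
    (ε : ℂ) (hε : IsPrimitiveRoot ε (q - 1))
    (m n : ℕ) (hmn : m < n) (hn : n ≤ q - 2)
    (S : Set ℂ)
    (hS : S = {x : ℂ | (∃ a : ℕ, a ≤ q - 2 ∧ x = ε ^ ((m + n) * a)) ∨
        (∃ c d : ℕ, c < d ∧ d ≤ q - 2 ∧ x = ε ^ (n * c + m * d) + ε ^ (n * d + m * c))}) :
    ∃ z ∈ S, conductorOf S = conductorOf {z} := by
  have : NeZero (q - 1) := ⟨by omega⟩
  have hε0 : ε ≠ 0 := hε.ne_zero (by omega)
  set x := ε ^ m with hx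
  set y := ε ^ n with hy
  have hprod (a : ℕ) : ε ^ ((m + n) * a) = (x * y) ^ a := by
    rw [pow_mul, pow_add]
  have hsum (c d : ℕ) : ε ^ (n * c + m * d) + ε ^ (n * d + m * c) =
      x ^ d * y ^ c + x ^ c * y ^ d := by
    simp only [hx, hy]; ring
  simp only [hprod, hsum] at hS
  -- It suffices that some element of `S` generates a field containing `x * y` and `x ^ k + y ^ k`.
  have key (z : ℂ) (hz : z ∈ S) (hmul : x * y ∈ IntermediateField.adjoin ℚ {z})
      (hpow : ∀ k, x ^ k + y ^ k ∈ IntermediateField.adjoin ℚ {z}) :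
      conductorOf S = conductorOf {z} := by
    refine conductorOf_eq_singleton hz ?_
    rw [hS]
    rintro _ (⟨a, -, rfl⟩ | ⟨c, d, hcd, -, rfl⟩)
    · exact pow_mem hmul a
    · obtain ⟨k, rfl⟩ := Nat.exists_eq_add_of_lt hcd
      have : x ^ (c + k + 1) * y ^ c + x ^ c * y ^ (c + k + 1) =
          (x * y) ^ c * (x ^ (k + 1) + y ^ (k + 1)) := by ring
      rw [this]
      exact mul_mem (pow_mem hmul c) (hpow _)
  by_cases h0 : x + y = 0
  · have hself := IntermediateField.mem_adjoin_simple_self ℚ (x * y)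
    have hz : x * y ∈ S := hS ▸ Or.inl ⟨1, by omega, by simp⟩
    exact ⟨x * y, hz, key _ hz hself (pow_add_pow_mem _ (h0 ▸ zero_mem _) hself)⟩
  · have hz : x + y ∈ S := hS ▸ Or.inr ⟨0, 1, one_pos, by omega, by simp⟩
    have hself := IntermediateField.mem_adjoin_simple_self ℚ (x + y)
    have hεmem := IntermediateField.mem_adjoin_simple_self ℚ ε
    have hconj : (starRingEnd ℂ) (x + y) ∈ IntermediateField.adjoin ℚ {x + y} :=
      algHom_apply_mem_adjoin_of_mem_cyclotomic hε
        (add_mem (pow_mem hεmem m) (pow_mem hεmem n)) (Complex.conjAe.toAlgHom.restrictScalars ℚ)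
    have hnorm : ‖ε‖ = 1 := hε.norm'_eq_one (by omega)
    have hinv : (starRingEnd ℂ) ε = ε⁻¹ := (Complex.inv_eq_conj hnorm).symm
    have hx0 : x ≠ 0 := pow_ne_zero m hε0
    have hy0 : y ≠ 0 := pow_ne_zero n hε0
    have hdiv : x * y = (x + y) / (starRingEnd ℂ) (x + y) := by
      have hstar : (starRingEnd ℂ) (x + y) = (x + y) / (x * y) := by
        simp only [hx, hy, map_add, map_pow, hinv, inv_pow]
        field_simp
        ring
      rw [hstar]
      field_simp
    have hmul : x * y ∈ IntermediateField.adjoin ℚ {x + y} := hdiv ▸ div_mem hself hconj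
    exact ⟨x + y, hz, key _ hz hmul (pow_add_pow_mem _ hself hmul)⟩
end

section
/- Let q be a prime power, let η be a primitive (q²−1)-th root of unity in ℂ, and let n be an integer not divisible by q+1. Let S be the set of cyclotomic integers S = {η^{na(q+1)} : 0 ≤ a ≤ q−2} ∪ {−(η^{ne} + η^{neq}) : e ∈ ℤ, (q+1) ∤ e}. Then there exists z ∈ S such that c(S) = c(z). -/
open CategoryTheory

open scoped ComplexConjugate

/-- Subextensions of cyclotomic extensions are normal: they are stable under endomorphisms of
an ambient field. -/
theorem IsPrimitiveRoot.algHom_apply_mem_adjoin_simple {K L : Type*} [Field K] [Field L]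
    [Algebra K L] {N : ℕ} [NeZero N] {η s : L} (hη : IsPrimitiveRoot η N)
    (hs : s ∈ IntermediateField.adjoin K {η}) (f : L →ₐ[K] L) :
    f s ∈ IntermediateField.adjoin K {s} := by
  have : IsCyclotomicExtension {N} K (IntermediateField.adjoin K {η}) := by
    change IsCyclotomicExtension {N} K (IntermediateField.adjoin K {η}).toSubalgebra
    rw [IntermediateField.adjoin_simple_toSubalgebra_of_isAlgebraic
      (hη.isIntegral (NeZero.pos N)).tower_top.isAlgebraic]
    exact hη.adjoin_isCyclotomicExtension K
  have : IsAbelianGalois K (IntermediateField.adjoin K {η}) :=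
    IsCyclotomicExtension.isAbelianGalois {N} K _
  have hle : IntermediateField.adjoin K {s} ≤ IntermediateField.adjoin K {η} :=
    IntermediateField.adjoin_simple_le_iff.mpr hs
  have : IsAbelianGalois K (IntermediateField.adjoin K {s}) :=
    .of_algHom (IntermediateField.inclusion hle)
  have hrange := AlgHom.fieldRange_of_normal (f.comp (IntermediateField.adjoin K {s}).val)
  exact hrange.le ⟨⟨s, IntermediateField.mem_adjoin_simple_self K s⟩, rfl⟩

/-- A subfield of `ℂ` contains the complex conjugate of each of its elements lying in
a cyclotomic field. -/
theorem Subfield.conj_mem_of_mem_adjoin_primitiveRoot {N : ℕ} [NeZero N] {η s : ℂ}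
    (hη : IsPrimitiveRoot η N) (hs : s ∈ IntermediateField.adjoin ℚ {η})
    (F : Subfield ℂ) (hF : s ∈ F) : conj s ∈ F := by
  have hsF : IntermediateField.adjoin ℚ {s} ≤ F.toIntermediateField (fun x => by simp) :=
    IntermediateField.adjoin_simple_le_iff.mpr hF
  exact hsF (hη.algHom_apply_mem_adjoin_simple hs (Complex.conjAe.toAlgHom.restrictScalars ℚ))

/-- A subfield containing the sum and the product of two elements contains the sums of their
`k`-th powers. -/
theorem Subfield.pow_add_pow_mem {K : Type*} [Field K] (F : Subfield K) {x y : K}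
    (hs : x + y ∈ F) (hp : x * y ∈ F) (k : ℕ) : x ^ k + y ^ k ∈ F := by
  induction k using Nat.twoStepInduction with
  | zero => simpa using F.add_mem F.one_mem F.one_mem
  | one => simpa using hs
  | more k ih ih' =>
    have h : x ^ (k + 2) + y ^ (k + 2) =
        (x + y) * (x ^ (k + 1) + y ^ (k + 1)) - x * y * (x ^ k + y ^ k) := by ring
    rw [h]
    exact F.sub_mem (F.mul_mem hs ih') (F.mul_mem hp ih)

/-- A subfield containing the sum and the product of two nonzero elements contains the sums of
their integer powers. -/
theorem Subfield.zpow_add_zpow_mem {K : Type*} [Field K] (F : Subfield K) {x y : K}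
    (hx : x ≠ 0) (hy : y ≠ 0) (hs : x + y ∈ F) (hp : x * y ∈ F) (k : ℤ) :
    x ^ k + y ^ k ∈ F := by
  obtain ⟨m, rfl | rfl⟩ := k.eq_nat_or_neg
  · simpa using F.pow_add_pow_mem hs hp m
  · have h : x ^ (-(m : ℤ)) + y ^ (-(m : ℤ)) = (x ^ m + y ^ m) / (x * y) ^ m := by
      simp only [zpow_neg, zpow_natCast]
      field_simp
      ring
    rw [h]
    exact F.div_mem (F.pow_add_pow_mem hs hp m) (F.pow_mem hp m)

/-- For `q` a prime power, `η` a primitive `(q²−1)`-th root of unity and `n` an integer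
not divisible by `q+1`, the conductor of the reduced value set of the character `Y_{(n)}`
of `GL₂(F_q)` is attained at a single value. -/
theorem conductor_one_value_Yn (q : ℕ) (hq : IsPrimePow q)
    (η : ℂ) (hη : IsPrimitiveRoot η (q ^ 2 - 1))
    (n : ℤ) (hn : ¬ ((q : ℤ) + 1) ∣ n)
    (S : Set ℂ)
    (hS : S = {x : ℂ | (∃ a : ℕ, a ≤ q - 2 ∧ x = η ^ (n * a * ((q : ℤ) + 1))) ∨
        (∃ e : ℤ, ¬ ((q : ℤ) + 1) ∣ e ∧ x = -(η ^ (n * e) + η ^ (n * e * (q : ℤ))))}) :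
    ∃ z ∈ S, conductorOf S = conductorOf {z} := by
  have hq2 : 2 ≤ q := hq.two_le
  have hN : q ^ 2 - 1 ≠ 0 := by
    have : 2 ^ 2 ≤ q ^ 2 := Nat.pow_le_pow_left hq2 2
    omega
  have : NeZero (q ^ 2 - 1) := ⟨hN⟩
  have hη0 : η ≠ 0 := hη.ne_zero hN
  have hx0 : η ^ n ≠ 0 := zpow_ne_zero _ hη0
  have hy0 : η ^ (n * q) ≠ 0 := zpow_ne_zero _ hη0
  -- The sum and the product of `η ^ n` and `η ^ (n * q)` generate the field of `S`.
  have hSF (F : Subfield ℂ) (hs : η ^ n + η ^ (n * q) ∈ F) (hp : η ^ n * η ^ (n * q) ∈ F) :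
      S ⊆ F := by
    rw [hS]
    rintro x (⟨a, -, rfl⟩ | ⟨e, -, rfl⟩)
    · have h : η ^ (n * a * ((q : ℤ) + 1)) = (η ^ n * η ^ (n * q)) ^ a := by
        rw [← zpow_add₀ hη0, ← zpow_natCast, ← zpow_mul]
        ring_nf
      rw [h]
      exact F.pow_mem hp a
    · have h := F.zpow_add_zpow_mem hx0 hy0 hs hp e
      rw [← zpow_mul, ← zpow_mul, mul_right_comm] at h
      exact F.neg_mem h
  suffices ∃ z ∈ S, ∀ F : Subfield ℂ, z ∈ F → S ⊆ F by
    obtain ⟨z, hzS, hz⟩ := this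
    refine ⟨z, hzS, ?_⟩
    have h (N : ℕ) : S ⊆ (cycField N : Set ℂ) ↔ {z} ⊆ (cycField N : Set ℂ) :=
      ⟨fun h => Set.singleton_subset_iff.mpr (h hzS),
        fun h => hz _ (Set.singleton_subset_iff.mp h)⟩
    simp only [conductorOf, h]
  by_cases h0 : η ^ n + η ^ (n * q) = 0
  · have hy : η ^ (n * q) = -η ^ n := by linear_combination h0
    refine ⟨-(η ^ (n * 2) + η ^ (n * 2 * q)), ?_, fun F hF => hSF F (h0 ▸ F.zero_mem) ?_⟩
    · rw [hS]
      refine Or.inr ⟨2, fun h => ?_, rfl⟩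
      have := Int.le_of_dvd two_pos h
      omega
    · have h2 : η ^ n * η ^ (n * q) = -(η ^ (n * 2) + η ^ (n * 2 * q)) / 2 := by
        rw [mul_right_comm, zpow_mul _ _ 2, zpow_mul _ _ 2, hy]
        simp only [zpow_ofNat]
        ring
      rw [h2]
      exact F.div_mem hF (ofNat_mem F 2)
  · refine ⟨-(η ^ n + η ^ (n * q)), ?_, fun F hF => ?_⟩
    · rw [hS]
      refine Or.inr ⟨1, fun h => ?_, by rw [mul_one]⟩
      have := Int.le_of_dvd one_pos h
      omega
    · have hs : η ^ n + η ^ (n * q) ∈ F := by simpa using F.neg_mem hF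
      have hmem := IntermediateField.mem_adjoin_simple_self ℚ η
      have hc := F.conj_mem_of_mem_adjoin_primitiveRoot hη
        (add_mem (zpow_mem hmem n) (zpow_mem hmem (n * q))) hs
      have hηc : conj η = η⁻¹ := (Complex.inv_eq_conj (hη.norm'_eq_one hN)).symm
      have h : conj (η ^ n + η ^ (n * q)) =
          (η ^ n + η ^ (n * q)) / (η ^ n * η ^ (n * q)) := by
        rw [map_add, map_zpow₀, map_zpow₀, hηc, inv_zpow, inv_zpow]
        field_simp
        ring
      refine hSF F hs ?_
      have h' : η ^ n * η ^ (n * q) = (η ^ n + η ^ (n * q)) / conj (η ^ n + η ^ (n * q)) := by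
        rw [h]
        field_simp
      rw [h']
      exact F.div_mem hs hc
end

section
/- Let α be a cyclotomic integer expressible as a sum of two roots of unity, α = ε₁ + ε₂, and assume α is neither zero nor equal to a single root of unity. Then the degree of the field extension [ℚ(ζ_{c(α)}) : ℚ(α)] is at most 2. -/
open CategoryTheory

open IntermediateField

/-- `φ(lcm(a, b)) φ(gcd(a, b)) = φ(a) φ(b)`. -/
lemma totient_lcm_mul_totient_gcd {a : ℕ} (b : ℕ) (ha : 0 < a) :
    (a.lcm b).totient * (a.gcd b).totient = a.totient * b.totient := by
  have h := Nat.totient_gcd_mul_totient_mul a b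
  have h' := Nat.totient_gcd_mul_totient_mul (a.gcd b) (a.lcm b)
  rw [Nat.gcd_eq_left ((Nat.gcd_dvd_left a b).trans (Nat.dvd_lcm_left a b)),
    Nat.gcd_mul_lcm, h] at h'
  have := Nat.eq_of_mul_eq_mul_right (Nat.gcd_pos_of_pos_left b ha) h'
  rw [this, mul_comm]

lemma IsPrimitiveRoot.finrank_adjoin_rat {n : ℕ} (hn : 0 < n) {ζ : ℂ} (hζ : IsPrimitiveRoot ζ n) :
    Module.finrank ℚ ℚ⟮ζ⟯ = n.totient := by
  rw [adjoin.finrank ((hζ.isIntegral hn).tower_top), ← Polynomial.cyclotomic_eq_minpoly_rat hζ hn,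
    Polynomial.natDegree_cyclotomic]

lemma mem_adjoin_of_pow_eq_one_s9 {n : ℕ} (hn : 0 < n) {ζ z : ℂ} (hζ : IsPrimitiveRoot ζ n)
    (hz : z ^ n = 1) : z ∈ ℚ⟮ζ⟯ := by
  have : NeZero n := ⟨hn.ne'⟩
  obtain ⟨i, -, rfl⟩ := hζ.eq_pow_of_pow_eq_one hz
  exact pow_mem (mem_adjoin_simple_self ℚ ζ) i

lemma mem_cycField_iff {n : ℕ} (hn : 0 < n) {ζ : ℂ} (hζ : IsPrimitiveRoot ζ n) (z : ℂ) :
    z ∈ cycField n ↔ z ∈ ℚ⟮ζ⟯ := by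
  constructor
  · intro hz
    have h : cycField n ≤ ℚ⟮ζ⟯.toSubfield :=
      Subfield.closure_le.2 fun w hw => mem_adjoin_of_pow_eq_one_s9 hn hζ hw
    exact h hz
  · intro hz
    have h : ℚ⟮ζ⟯ ≤ (cycField n).toIntermediateField fun q => by
        simp :=
      adjoin_simple_le_iff.2 (Subfield.subset_closure hζ.pow_eq_one)
    exact h hz

/-- `ℚ(ζ_a) ∩ ℚ(ζ_b) = ℚ(ζ_{gcd(a, b)})`. -/
lemma adjoin_inf_adjoin_eq_adjoin_gcd {a b : ℕ} (ha : 0 < a) (hb : 0 < b) {x y z : ℂ}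
    (hx : IsPrimitiveRoot x a) (hy : IsPrimitiveRoot y b) (hz : IsPrimitiveRoot z (a.gcd b)) :
    ℚ⟮x⟯ ⊓ ℚ⟮y⟯ = ℚ⟮z⟯ := by
  have hg : 0 < a.gcd b := Nat.gcd_pos_of_pos_left b ha
  have hl : 0 < a.lcm b := Nat.lcm_pos ha hb
  obtain ⟨w, hw⟩ : ∃ w : ℂ, IsPrimitiveRoot w (a.lcm b) :=
    ⟨_, Complex.isPrimitiveRoot_exp _ hl.ne'⟩
  have : FiniteDimensional ℚ ℚ⟮x⟯ := adjoin.finiteDimensional ((hx.isIntegral ha).tower_top)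
  have : FiniteDimensional ℚ ℚ⟮y⟯ := adjoin.finiteDimensional ((hy.isIntegral hb).tower_top)
  have hzF : ℚ⟮z⟯ ≤ ℚ⟮x⟯ ⊓ ℚ⟮y⟯ := by
    refine adjoin_simple_le_iff.2 ⟨mem_adjoin_of_pow_eq_one_s9 ha hx ?_,
      mem_adjoin_of_pow_eq_one_s9 hb hy ?_⟩
    · exact (hz.pow_eq_one_iff_dvd _).2 (Nat.gcd_dvd_left a b)
    · exact (hz.pow_eq_one_iff_dvd _).2 (Nat.gcd_dvd_right a b)
  set F := ℚ⟮x⟯ ⊓ ℚ⟮y⟯ with hF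
  have hFx : F ≤ ℚ⟮x⟯ := inf_le_left
  have hFy : F ≤ ℚ⟮y⟯ := inf_le_right
  have : FiniteDimensional ℚ F := Module.Finite.of_injective (inclusion hFx).toLinearMap
    (inclusion_injective hFx)
  have hwxy : ℚ⟮w⟯ ≤ ℚ⟮x⟯ ⊔ ℚ⟮y⟯ := by
    have hxy := IsPrimitiveRoot.pow_mul_pow_lcm hx hy ha.ne' hb.ne'
    have : NeZero (a.lcm b) := ⟨hl.ne'⟩
    obtain ⟨i, -, rfl⟩ := hxy.eq_pow_of_pow_eq_one hw.pow_eq_one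
    refine adjoin_simple_le_iff.2 (pow_mem (mul_mem (pow_mem ?_ _) (pow_mem ?_ _)) _)
    · exact (le_sup_left : ℚ⟮x⟯ ≤ ℚ⟮x⟯ ⊔ ℚ⟮y⟯) (mem_adjoin_simple_self ℚ x)
    · exact (le_sup_right : ℚ⟮y⟯ ≤ ℚ⟮x⟯ ⊔ ℚ⟮y⟯) (mem_adjoin_simple_self ℚ y)
  have hdw : (a.lcm b).totient ≤ Module.finrank ℚ ↥(ℚ⟮x⟯ ⊔ ℚ⟮y⟯) := by
    rw [← hw.finrank_adjoin_rat hl]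
    exact finrank_le_of_le_right hwxy
  have hsup := finrank_sup_le (extendScalars hFx) (extendScalars hFy)
  have hdx : Module.finrank ℚ F * Module.finrank F (extendScalars hFx) = a.totient :=
    (Module.finrank_mul_finrank ℚ F (extendScalars hFx)).trans (hx.finrank_adjoin_rat ha)
  have hdy : Module.finrank ℚ F * Module.finrank F (extendScalars hFy) = b.totient :=
    (Module.finrank_mul_finrank ℚ F (extendScalars hFy)).trans (hy.finrank_adjoin_rat hb)
  have hds : Module.finrank ℚ F * Module.finrank F ↥(extendScalars hFx ⊔ extendScalars hFy) =
      Module.finrank ℚ ↥(ℚ⟮x⟯ ⊔ ℚ⟮y⟯) := by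
    rw [extendScalars_sup]
    exact Module.finrank_mul_finrank ℚ F (extendScalars (le_sup_of_le_left hFx))
  refine (eq_of_le_of_finrank_le hzF ?_).symm
  rw [hz.finrank_adjoin_rat hg]
  refine Nat.le_of_mul_le_mul_left ?_ (Nat.totient_pos.2 hl)
  rw [totient_lcm_mul_totient_gcd b ha, ← hdx, ← hdy]
  calc _ ≤ _ := Nat.mul_le_mul_right _ (hdw.trans_eq hds.symm)
    _ ≤ _ := Nat.mul_le_mul_right _ (Nat.mul_le_mul_left _ hsup)
    _ = _ := by ring

/-- A number lying in the `n`-th cyclotomic field has conductor dividing `n`. -/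
lemma conductorOf_singleton_dvd {n : ℕ} (hn : 0 < n) {α : ℂ} (hα : α ∈ cycField n) :
    conductorOf {α} ∣ n := by
  have hmem : conductorOf {α} ∈ {m : ℕ | 0 < m ∧ ({α} : Set ℂ) ⊆ (cycField m : Set ℂ)} :=
    Nat.sInf_mem ⟨n, hn, by simpa using hα⟩
  obtain ⟨hc, hαc⟩ := hmem
  have hg : 0 < (conductorOf {α}).gcd n := Nat.gcd_pos_of_pos_right _ hn
  have hx := Complex.isPrimitiveRoot_exp _ hc.ne'
  have hy := Complex.isPrimitiveRoot_exp _ hn.ne'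
  have hz := Complex.isPrimitiveRoot_exp _ hg.ne'
  have hle : conductorOf {α} ≤ (conductorOf {α}).gcd n := by
    refine Nat.sInf_le ⟨hg, Set.singleton_subset_iff.2 ?_⟩
    refine (mem_cycField_iff hg hz α).2 ?_
    rw [← adjoin_inf_adjoin_eq_adjoin_gcd hc hn hx hy hz]
    exact ⟨(mem_cycField_iff hc hx α).1 (hαc rfl), (mem_cycField_iff hn hy α).1 hα⟩
  have := Nat.gcd_dvd_right (conductorOf {α}) n
  rwa [le_antisymm (Nat.gcd_le_left n hc) hle] at this

/-- For `α` in a cyclotomic field, `ℚ(α)` is stable under complex conjugation. -/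
lemma conj_mem_adjoin_simple {n : ℕ} (hn : 0 < n) {ξ α : ℂ} (hξ : IsPrimitiveRoot ξ n)
    (hα : α ∈ ℚ⟮ξ⟯) : (starRingEnd ℂ) α ∈ ℚ⟮α⟯ := by
  have : NeZero n := ⟨hn.ne'⟩
  have : IsCyclotomicExtension {n} ℚ ℚ⟮ξ⟯ := by
    change IsCyclotomicExtension {n} ℚ ℚ⟮ξ⟯.toSubalgebra
    rw [adjoin_simple_toSubalgebra_of_isAlgebraic ((hξ.isIntegral hn).tower_top).isAlgebraic]
    exact hξ.adjoin_isCyclotomicExtension ℚ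
  have : IsAbelianGalois ℚ ℚ⟮ξ⟯ := IsCyclotomicExtension.isAbelianGalois {n} ℚ _
  let ι : ℚ⟮α⟯ →ₐ[ℚ] ℚ⟮ξ⟯ := inclusion (adjoin_simple_le_iff.2 hα)
  have : IsAbelianGalois ℚ ℚ⟮α⟯ := IsAbelianGalois.of_algHom ι
  let σ : ℂ →ₐ[ℚ] ℂ := (Complex.conjAe.restrictScalars ℚ : ℂ ≃ₐ[ℚ] ℂ)
  have h := σ.restrictNormal_commutes ℚ⟮α⟯ (AdjoinSimple.gen ℚ α)
  have h' : σ (algebraMap ℚ⟮α⟯ ℂ (AdjoinSimple.gen ℚ α)) = (starRingEnd ℂ) α := rfl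
  rw [← h', ← h]
  exact SetLike.coe_mem _

lemma IsRootOfUnity.conj_mul_self {z : ℂ} (hz : IsRootOfUnity z) : (starRingEnd ℂ) z * z = 1 := by
  obtain ⟨n, hn, h⟩ := hz
  rw [mul_comm, Complex.mul_conj, Complex.normSq_eq_norm_sq,
    Complex.norm_eq_one_of_pow_eq_one h hn.ne']
  simp

lemma IsRootOfUnity.orderOf_pos {z : ℂ} (hz : IsRootOfUnity z) : 0 < orderOf z :=
  _root_.orderOf_pos_iff.2 (isOfFinOrder_iff_pow_eq_one.2 hz)

/-- If `α = ε₁ + ε₂` is a sum of two roots of unity which is neither zero nor a single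
root of unity, then `[ℚ(ζ_{c(α)}) : ℚ(α)] ≤ 2`.  Here `ℚ(ζ_{c(α)})` is realized as
`ℚ(α)(ζ)` for `ζ` a primitive `c(α)`-th root of unity (these fields agree, since
`α ∈ ℚ(ζ_{c(α)})`). -/
theorem degree_le_two_of_sum_two_roots (ε₁ ε₂ : ℂ)
    (h₁ : IsRootOfUnity ε₁) (h₂ : IsRootOfUnity ε₂)
    (α : ℂ) (hα : α = ε₁ + ε₂) (h0 : α ≠ 0) (hru : ¬ IsRootOfUnity α)
    (ζ : ℂ) (hζ : IsPrimitiveRoot ζ (conductorOf {α})) :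
    Module.finrank (IntermediateField.adjoin ℚ {α})
      (IntermediateField.adjoin (IntermediateField.adjoin ℚ {α}) {ζ}) ≤ 2 := by
  have hn : 0 < (orderOf ε₁).lcm (orderOf ε₂) := Nat.lcm_pos h₁.orderOf_pos h₂.orderOf_pos
  have hξ := IsPrimitiveRoot.pow_mul_pow_lcm (IsPrimitiveRoot.orderOf ε₁)
    (IsPrimitiveRoot.orderOf ε₂) h₁.orderOf_pos.ne' h₂.orderOf_pos.ne'
  have hαξ : α ∈ ℚ⟮_⟯ := hα ▸ add_mem
    (mem_adjoin_of_pow_eq_one_s9 hn hξ (orderOf_dvd_iff_pow_eq_one.1 (Nat.dvd_lcm_left _ _)))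
    (mem_adjoin_of_pow_eq_one_s9 hn hξ (orderOf_dvd_iff_pow_eq_one.1 (Nat.dvd_lcm_right _ _)))
  have hζn := (hζ.pow_eq_one_iff_dvd _).2
    (conductorOf_singleton_dvd hn ((mem_cycField_iff hn hξ α).2 hαξ))
  have hε₁ : ε₁ ∈ ℚ⟮α⟯⟮ε₁⟯ := mem_adjoin_simple_self _ ε₁
  have hε₂ : ε₂ ∈ ℚ⟮α⟯⟮ε₁⟯ := by
    have : α ∈ ℚ⟮α⟯⟮ε₁⟯ := IntermediateField.algebraMap_mem ℚ⟮α⟯⟮ε₁⟯ (AdjoinSimple.gen ℚ α)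
    simpa [hα] using sub_mem this hε₁
  have hle : ℚ⟮α⟯⟮ζ⟯ ≤ ℚ⟮α⟯⟮ε₁⟯ := by
    have : NeZero ((orderOf ε₁).lcm (orderOf ε₂)) := ⟨hn.ne'⟩
    obtain ⟨i, -, rfl⟩ := hξ.eq_pow_of_pow_eq_one hζn
    exact adjoin_simple_le_iff.2 (pow_mem (mul_mem (pow_mem hε₁ _) (pow_mem hε₂ _)) _)
  have hmul : ε₁ * ε₂ ∈ ℚ⟮α⟯ := by
    have hconj : (starRingEnd ℂ) α * (ε₁ * ε₂) = α := by
      rw [hα, map_add]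
      linear_combination ε₂ * h₁.conj_mul_self + ε₁ * h₂.conj_mul_self
    have hne : (starRingEnd ℂ) α ≠ 0 := by simpa using h0
    rw [eq_div_of_mul_eq hne ((mul_comm _ _).trans hconj)]
    exact div_mem (mem_adjoin_simple_self ℚ α) (conj_mem_adjoin_simple hn hξ hαξ)
  let p : Polynomial ℚ⟮α⟯ := Polynomial.X ^ 2 -
    (Polynomial.C (AdjoinSimple.gen ℚ α) * Polynomial.X - Polynomial.C ⟨ε₁ * ε₂, hmul⟩)
  have hpdeg : p.natDegree = 2 := by
    unfold p
    compute_degree!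
  have hpmonic : p.Monic := by
    unfold p
    monicity!
  have hproot : Polynomial.aeval ε₁ p = 0 := by
    have h : algebraMap ℚ⟮α⟯ ℂ (AdjoinSimple.gen ℚ α) = ε₁ + ε₂ := hα
    have h' : algebraMap ℚ⟮α⟯ ℂ ⟨ε₁ * ε₂, hmul⟩ = ε₁ * ε₂ := rfl
    simp only [p, map_sub, map_mul, map_pow, Polynomial.aeval_X, Polynomial.aeval_C, h, h']
    ring
  have hint : IsIntegral ℚ⟮α⟯ ε₁ := ⟨p, hpmonic, hproot⟩
  have := adjoin.finiteDimensional hint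
  calc Module.finrank ℚ⟮α⟯ ℚ⟮α⟯⟮ζ⟯ ≤ Module.finrank ℚ⟮α⟯ ℚ⟮α⟯⟮ε₁⟯ := finrank_le_of_le_right hle
    _ = (minpoly ℚ⟮α⟯ ε₁).natDegree := adjoin.finrank hint
    _ ≤ p.natDegree := Polynomial.natDegree_le_natDegree (minpoly.min _ _ hpmonic hproot)
    _ = 2 := hpdeg
end

section
/- If ξ₀, ξ₁, ξ₂ are complex roots of unity with ξ₀ + ξ₁ + ξ₂ = 0, then there exists a root of unity ξ such that {ξ₀, ξ₁, ξ₂} = {ξ, ξζ₃, ξζ₃²}, where ζ₃ is a primitive third root of unity. In particular, the sum of any two of them equals the negative of a root of unity. -/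
open CategoryTheory

namespace IsRootOfUnity

lemma norm_eq_one {z : ℂ} (hz : IsRootOfUnity z) : ‖z‖ = 1 := by
  obtain ⟨n, hn, h⟩ := hz
  exact Complex.norm_eq_one_of_pow_eq_one h hn.ne'

end IsRootOfUnity

/-- Two numbers of norm one whose sum also has norm one have a primitive third root of unity as
their ratio. -/
lemma sq_add_mul_add_sq_eq_zero {x y z : ℂ} (hx : ‖x‖ = 1) (hy : ‖y‖ = 1) (hz : ‖z‖ = 1)
    (hsum : x + y + z = 0) : x ^ 2 + x * y + y ^ 2 = 0 := by
  have mul_conj_eq_one {w : ℂ} (hw : ‖w‖ = 1) : w * starRingEnd ℂ w = 1 := by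
    simp [Complex.mul_conj', hw]
  have hconj : starRingEnd ℂ x + starRingEnd ℂ y + starRingEnd ℂ z = 0 := by
    simpa using congrArg (starRingEnd ℂ) hsum
  linear_combination (x + y) * hsum - x * y * z * hconj + y * z * mul_conj_eq_one hx +
    x * z * mul_conj_eq_one hy + x * y * mul_conj_eq_one hz

lemma exp_two_pi_div_three_sq_add :
    Complex.exp (2 * Real.pi * Complex.I / 3) ^ 2 +
      Complex.exp (2 * Real.pi * Complex.I / 3) + 1 = 0 := by
  have h := (Complex.isPrimitiveRoot_exp 3 (by norm_num)).geom_sum_eq_zero (by norm_num)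
  simp only [Finset.sum_range_succ, Finset.sum_range_zero, Nat.cast_ofNat] at h
  linear_combination h

/-- If `ξ₀ + ξ₁ + ξ₂ = 0` is a vanishing sum of three roots of unity, then there is a root
of unity `ξ` with `{ξ₀, ξ₁, ξ₂} = {ξ, ξζ₃, ξζ₃²}` where `ζ₃ = e^{2πi/3}`; in particular
the sum of any two of them is the negative of a root of unity. -/
theorem vanishing_sum_three_roots (ξ₀ ξ₁ ξ₂ : ℂ)
    (h₀ : IsRootOfUnity ξ₀) (h₁ : IsRootOfUnity ξ₁) (h₂ : IsRootOfUnity ξ₂)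
    (hsum : ξ₀ + ξ₁ + ξ₂ = 0) :
    (∃ ξ : ℂ, IsRootOfUnity ξ ∧
      ({ξ₀, ξ₁, ξ₂} : Set ℂ) =
        {ξ, ξ * Complex.exp (2 * Real.pi * Complex.I / 3),
          ξ * Complex.exp (2 * Real.pi * Complex.I / 3) ^ 2}) ∧
    IsRootOfUnity (-(ξ₀ + ξ₁)) ∧ IsRootOfUnity (-(ξ₀ + ξ₂)) ∧
      IsRootOfUnity (-(ξ₁ + ξ₂)) := by
  refine ⟨⟨ξ₀, h₀, ?_⟩, ?_, ?_, ?_⟩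
  · have hω := exp_two_pi_div_three_sq_add
    set ω := Complex.exp (2 * Real.pi * Complex.I / 3)
    have hquad := sq_add_mul_add_sq_eq_zero h₀.norm_eq_one h₁.norm_eq_one h₂.norm_eq_one hsum
    have hfactor : (ξ₁ - ξ₀ * ω) * (ξ₁ - ξ₀ * ω ^ 2) = 0 := by
      linear_combination hquad + (ξ₀ ^ 2 * (ω - 1) - ξ₀ * ξ₁) * hω
    rcases mul_eq_zero.mp hfactor with h | h
    · have e₁ : ξ₁ = ξ₀ * ω := sub_eq_zero.mp h
      have e₂ : ξ₂ = ξ₀ * ω ^ 2 := by linear_combination hsum - h - ξ₀ * hω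
      rw [e₁, e₂]
    · have e₁ : ξ₁ = ξ₀ * ω ^ 2 := sub_eq_zero.mp h
      have e₂ : ξ₂ = ξ₀ * ω := by linear_combination hsum - h - ξ₀ * hω
      rw [e₁, e₂, Set.pair_comm]
  · rwa [show -(ξ₀ + ξ₁) = ξ₂ by linear_combination -hsum]
  · rwa [show -(ξ₀ + ξ₂) = ξ₁ by linear_combination -hsum]
  · rwa [show -(ξ₁ + ξ₂) = ξ₀ by linear_combination -hsum]
end

section
/- If ξ₁, ξ₂, ξ₃, ξ₄ are complex roots of unity with ξ₁ + ξ₂ + ξ₃ + ξ₄ = 0, then the four terms can be partitioned into two pairs each summing to zero; that is, after reindexing, ξ₂ = −ξ₁ and ξ₄ = −ξ₃. -/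
open CategoryTheory

theorem IsRootOfUnity.norm_eq_one_s12 {z : ℂ} (hz : IsRootOfUnity z) : ‖z‖ = 1 := by
  obtain ⟨n, hn, h⟩ := hz
  exact Complex.norm_eq_one_of_pow_eq_one h (Nat.ne_of_gt hn)

/-- If four complex numbers of norm one sum to zero, two of the first three are opposite. -/
theorem pair_sums_mul_eq_zero_of_norm_eq_one {a b c d : ℂ} (ha : ‖a‖ = 1) (hb : ‖b‖ = 1)
    (hc : ‖c‖ = 1) (hd : ‖d‖ = 1) (hsum : a + b + c + d = 0) :
    (a + b) * (b + c) * (a + c) = 0 := by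
  have conj_sum : a⁻¹ + b⁻¹ + c⁻¹ + d⁻¹ = 0 := by
    rw [Complex.inv_eq_conj ha, Complex.inv_eq_conj hb, Complex.inv_eq_conj hc,
      Complex.inv_eq_conj hd, ← map_add, ← map_add, ← map_add, hsum, map_zero]
  have ne_zero : ∀ {z : ℂ}, ‖z‖ = 1 → z ≠ 0 := fun hz => norm_ne_zero_iff.mp (by simp [hz])
  have ha0 := ne_zero ha
  have hb0 := ne_zero hb
  have hc0 := ne_zero hc
  have hd0 := ne_zero hd
  field_simp at conj_sum
  linear_combination (a * b + b * c + a * c) * hsum - conj_sum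

/-- A vanishing sum of four roots of unity splits into two vanishing pairs: after
reindexing by a permutation, the second term is the negative of the first and the fourth
is the negative of the third. -/
theorem vanishing_sum_four_roots (ξ : Fin 4 → ℂ) (h : ∀ i, IsRootOfUnity (ξ i))
    (hsum : ξ 0 + ξ 1 + ξ 2 + ξ 3 = 0) :
    ∃ e : Equiv.Perm (Fin 4), ξ (e 1) = -ξ (e 0) ∧ ξ (e 3) = -ξ (e 2) := by
  have hn i := (h i).norm_eq_one_s12
  have key := pair_sums_mul_eq_zero_of_norm_eq_one (hn 0) (hn 1) (hn 2) (hn 3) hsum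
  rcases mul_eq_zero.mp key with hprod | h02
  · rcases mul_eq_zero.mp hprod with h01 | h12
    · refine ⟨1, ?_, ?_⟩ <;> simp only [Equiv.Perm.one_apply]
      · linear_combination h01
      · linear_combination hsum - h01
    · refine ⟨Equiv.swap 1 3, ?_, ?_⟩
      · change ξ 3 = -ξ 0
        linear_combination hsum - h12
      · change ξ 1 = -ξ 2
        linear_combination h12
  · refine ⟨Equiv.swap 1 2, ?_, ?_⟩
    · change ξ 2 = -ξ 0
      linear_combination h02
    · change ξ 3 = -ξ 1
      linear_combination hsum - h02
end

section
/- If ξ₁, ξ₂, ξ₃, ξ₄ are complex roots of unity each of odd order, then ξ₁ + ξ₂ + ξ₃ + ξ₄ ≠ 0. -/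
open CategoryTheory

/-- Two complex roots of unity of odd order are never opposite. -/
theorem add_ne_zero_of_odd_pow_eq_one {a b : ℂ} (ha : ∃ n : ℕ, Odd n ∧ a ^ n = 1)
    (hb : ∃ n : ℕ, Odd n ∧ b ^ n = 1) : a + b ≠ 0 := by
  obtain ⟨m, hm, ham⟩ := ha
  obtain ⟨n, hn, hbn⟩ := hb
  intro h
  have h₁ : a ^ (m * n) = 1 := by rw [pow_mul, ham, one_pow]
  have h₂ : b ^ (m * n) = 1 := by rw [mul_comm, pow_mul, hbn, one_pow]
  rw [eq_neg_of_add_eq_zero_left h, (hm.mul hn).neg_pow, h₂] at h₁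
  norm_num at h₁

theorem mul_conj_eq_one_of_odd_pow_eq_one {a : ℂ} (ha : ∃ n : ℕ, Odd n ∧ a ^ n = 1) :
    a * starRingEnd ℂ a = 1 := by
  obtain ⟨n, hn, han⟩ := ha
  rw [Complex.mul_conj', Complex.norm_eq_one_of_pow_eq_one han hn.pos.ne']
  norm_num

/-- Among four complex numbers of modulus one with sum zero, the first is opposite to another. -/
theorem mul_add_eq_zero_of_sum_eq_zero {a b c d : ℂ} (ha : a * starRingEnd ℂ a = 1)
    (hb : b * starRingEnd ℂ b = 1) (hc : c * starRingEnd ℂ c = 1)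
    (hd : d * starRingEnd ℂ d = 1) (h : a + b + c + d = 0) :
    (a + b) * (a + c) * (a + d) = 0 := by
  have h' := congrArg (starRingEnd ℂ) h
  simp only [map_add, map_zero] at h'
  linear_combination a ^ 2 * h + a * b * c * d * h' - b * c * d * ha - a * c * d * hb
    - a * b * d * hc - a * b * c * hd


/-- A sum of four roots of unity, each of odd order, is never zero. -/
theorem sum_four_odd_roots_ne_zero (ξ₁ ξ₂ ξ₃ ξ₄ : ℂ)
    (h₁ : ∃ n : ℕ, Odd n ∧ ξ₁ ^ n = 1) (h₂ : ∃ n : ℕ, Odd n ∧ ξ₂ ^ n = 1)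
    (h₃ : ∃ n : ℕ, Odd n ∧ ξ₃ ^ n = 1) (h₄ : ∃ n : ℕ, Odd n ∧ ξ₄ ^ n = 1) :
    ξ₁ + ξ₂ + ξ₃ + ξ₄ ≠ 0 := by
  intro h
  have key := mul_add_eq_zero_of_sum_eq_zero (mul_conj_eq_one_of_odd_pow_eq_one h₁)
    (mul_conj_eq_one_of_odd_pow_eq_one h₂) (mul_conj_eq_one_of_odd_pow_eq_one h₃)
    (mul_conj_eq_one_of_odd_pow_eq_one h₄) h
  exact mul_ne_zero (mul_ne_zero (add_ne_zero_of_odd_pow_eq_one h₁ h₂)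
    (add_ne_zero_of_odd_pow_eq_one h₁ h₃)) (add_ne_zero_of_odd_pow_eq_one h₁ h₄) key
end

section
/- Let q = 2^{2n+1} for some integer n ≥ 1, let ζ be a primitive N-th root of unity where N = q + √(2q) + 1 or N = q − √(2q) + 1 (note √(2q) = 2^{n+1} is an integer and N divides q² + 1), and let m be an integer. Set α_m = ζ^m + ζ^{mq} + ζ^{−m} + ζ^{−mq}, and assume α_m cannot be expressed as a sum of fewer than four roots of unity. Let σ be the Galois automorphism of ℚ(ζ_{c(α_m)}) sending ζ^m to ζ^{mq}. Then ℚ(α_m) is precisely the subfield of ℚ(ζ_{c(α_m)}) fixed by σ. -/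
open CategoryTheory

open IntermediateField

/-- If `ω` is a primitive root of unity of order `p * k`, then `ω` has degree at least `φ(p)`
over `ℚ(ω ^ p)`. -/
lemma IsPrimitiveRoot.totient_le_natDegree_minpoly_adjoin_pow {K : Type*} [Field K] [CharZero K]
    {ω : K} {p k : ℕ} (hω : IsPrimitiveRoot ω (p * k)) (hpos : 0 < p * k) :
    p.totient ≤ (minpoly ℚ⟮ω ^ p⟯ ω).natDegree := by
  have hk : 0 < k := Nat.pos_of_mul_pos_left hpos
  have hωp : IsPrimitiveRoot (ω ^ p) k := hω.pow hpos rfl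
  have hint : IsIntegral ℚ ω := (hω.isIntegral hpos).tower_top
  have hintp : IsIntegral ℚ (ω ^ p) := hint.pow p
  have hintF : IsIntegral ℚ⟮ω ^ p⟯ ω := hint.tower_top
  have h₁ : Module.finrank ℚ ℚ⟮ω⟯ = (p * k).totient := by
    rw [adjoin.finrank hint, ← Polynomial.cyclotomic_eq_minpoly_rat hω hpos,
      Polynomial.natDegree_cyclotomic]
  have h₂ : Module.finrank ℚ ℚ⟮ω ^ p⟯ = k.totient := by
    rw [adjoin.finrank hintp, ← Polynomial.cyclotomic_eq_minpoly_rat hωp hk,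
      Polynomial.natDegree_cyclotomic]
  have : FiniteDimensional ℚ ℚ⟮ω ^ p⟯ := adjoin.finiteDimensional hintp
  have : FiniteDimensional ℚ⟮ω ^ p⟯ ℚ⟮ω ^ p⟯⟮ω⟯ := adjoin.finiteDimensional hintF
  have : FiniteDimensional ℚ (ℚ⟮ω ^ p⟯⟮ω⟯.restrictScalars ℚ) :=
    FiniteDimensional.trans ℚ ℚ⟮ω ^ p⟯ ℚ⟮ω ^ p⟯⟮ω⟯
  have h₃ : Module.finrank ℚ ℚ⟮ω⟯ ≤ Module.finrank ℚ (ℚ⟮ω ^ p⟯⟮ω⟯.restrictScalars ℚ) :=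
    finrank_le_of_le_right <| adjoin_simple_le_iff.mpr (mem_adjoin_simple_self ℚ⟮ω ^ p⟯ ω)
  have h₄ : Module.finrank ℚ (ℚ⟮ω ^ p⟯⟮ω⟯.restrictScalars ℚ) =
      k.totient * (minpoly ℚ⟮ω ^ p⟯ ω).natDegree := by
    rw [← h₂, ← adjoin.finrank hintF]
    exact (Module.finrank_mul_finrank ℚ ℚ⟮ω ^ p⟯ ℚ⟮ω ^ p⟯⟮ω⟯).symm
  have h₅ := Nat.totient_super_multiplicative p k
  rw [h₁, h₄] at h₃
  have := Nat.totient_pos.mpr hk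
  nlinarith

/-- Let `p` be a prime dividing the order of a root of unity `ω`. There is an additive map which,
on the powers of `ω` with exponent prime to `p`, projects to those with exponent `r` modulo `p`. -/
lemma IsPrimitiveRoot.exists_residue_projection {K : Type*} [Field K] [CharZero K]
    {ω : K} {p k : ℕ} (hp : p.Prime) (hω : IsPrimitiveRoot ω (p * k)) (hpos : 0 < p * k) (r : ℤ) :
    ∃ f : K →+ K, ∀ j : ℤ, ¬ (p : ℤ) ∣ j →
      f (ω ^ j) = if (p : ℤ) ∣ j - r then ω ^ j else 0 := by
  have hω₀ : ω ≠ 0 := hω.ne_zero hpos.ne'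
  have hdeg := hω.totient_le_natDegree_minpoly_adjoin_pow hpos
  rw [Nat.totient_prime hp] at hdeg
  let v : Fin (p - 1) → K := fun i => ω ^ ((i : ℕ) + 1)
  have hv : LinearIndependent ℚ⟮ω ^ p⟯ v := by
    have h := (linearIndependent_pow (K := ℚ⟮ω ^ p⟯) ω).comp _ (Fin.castLE_injective hdeg)
    have h' := h.map' (LinearMap.mulLeft ℚ⟮ω ^ p⟯ ω)
      (LinearMap.ker_eq_bot.mpr (mul_right_injective₀ hω₀))
    have hv_eq : v = LinearMap.mulLeft ℚ⟮ω ^ p⟯ ω ∘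
        (fun i : Fin (minpoly ℚ⟮ω ^ p⟯ ω).natDegree => ω ^ (i : ℕ)) ∘ Fin.castLE hdeg := by
      ext i
      simp [v, pow_succ']
    rw [hv_eq]
    exact h'
  let g : Fin (p - 1) → K := fun i => if (p : ℤ) ∣ ((i : ℕ) + 1 : ℤ) - r then v i else 0
  obtain ⟨F, hF⟩ := LinearMap.exists_extend ((Module.Basis.span hv).constr ℕ g)
  have hFv (i) : F (v i) = g i := by
    have h := LinearMap.congr_fun hF (Module.Basis.span hv i)
    rw [Module.Basis.constr_basis] at h
    rw [← h]
    simp [Module.Basis.span_apply]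
  refine ⟨F.toAddMonoidHom, fun j hj => ?_⟩
  have hp₀ : (0 : ℤ) < p := by exact_mod_cast hp.pos
  have hmod₀ : 0 < j % p := lt_of_le_of_ne (Int.emod_nonneg _ hp₀.ne')
    (fun h => hj (Int.dvd_of_emod_eq_zero h.symm))
  have hmod₁ := Int.emod_lt_of_pos j hp₀
  let i : Fin (p - 1) := ⟨(j % p).toNat - 1, by omega⟩
  have hi : ((i : ℕ) + 1 : ℤ) = j % p := by simp only [i]; omega
  have hvi : v i = ω ^ (j % p) := by
    rw [← hi]; simp only [v]; exact_mod_cast rfl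
  let u : ℚ⟮ω ^ p⟯ := ⟨ω ^ p, mem_adjoin_simple_self _ _⟩
  have huj : ω ^ j = (u ^ (j / p) : ℚ⟮ω ^ p⟯) • v i := by
    rw [hvi, Algebra.smul_def, map_zpow₀]
    change _ = (ω ^ p) ^ (j / p) * _
    rw [← zpow_natCast ω p, ← zpow_mul, ← zpow_add₀ hω₀, Int.mul_ediv_add_emod]
  have hdvd : (p : ℤ) ∣ j % p - r ↔ (p : ℤ) ∣ j - r := by
    rw [← Int.modEq_iff_dvd, ← Int.modEq_iff_dvd, Int.ModEq, Int.ModEq, Int.emod_emod]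
  change F (ω ^ j) = _
  rw [huj, map_smul, hFv]
  simp only [g, hi, hdvd]
  split_ifs <;> simp

/-- The sum `ω + ω ^ q + ω⁻¹ + ω ^ (-q)`. -/
def quarticPeriod {K : Type*} [Field K] (q : ℤ) (ω : K) : K :=
  ω + ω ^ q + ω ^ (-1 : ℤ) + ω ^ (-q)

lemma map_quarticPeriod {K L F : Type*} [Field K] [Field L] [FunLike F K L] [RingHomClass F K L]
    (f : F) (q : ℤ) (ω : K) : f (quarticPeriod q ω) = quarticPeriod q (f ω) := by
  simp [quarticPeriod]

/-- The four residues `1, q, -1, -q` are distinct modulo an odd prime dividing `q ^ 2 + 1`. -/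
lemma odd_prime_not_dvd {p : ℕ} {q : ℤ} (hp : p.Prime) (hodd : p ≠ 2)
    (hq : (p : ℤ) ∣ q ^ 2 + 1) :
    ¬ (p : ℤ) ∣ 2 ∧ ¬ (p : ℤ) ∣ q ∧ ¬ (p : ℤ) ∣ q - 1 ∧ ¬ (p : ℤ) ∣ q + 1 := by
  have h2 : ¬ (p : ℤ) ∣ 2 := fun h =>
    hodd ((Nat.prime_dvd_prime_iff_eq hp Nat.prime_two).mp (by exact_mod_cast h))
  refine ⟨h2, fun h => ?_, fun h => h2 ?_, fun h => h2 ?_⟩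
  · have h1 : (p : ℤ) ∣ 1 := by
      have := dvd_sub hq (h.mul_right q)
      ring_nf at this
      exact this
    exact h2 (h1.trans (by norm_num))
  · have := dvd_sub hq (h.mul_right (q + 1))
    ring_nf at this
    exact this
  · have := dvd_sub hq (h.mul_right (q - 1))
    ring_nf at this
    exact this

/-- Only the conjugations `ω ↦ ω ^ (q ^ i)` fix the quartic period. -/
lemma IsPrimitiveRoot.dvd_of_quarticPeriod_zpow_eq {K : Type*} [Field K] [CharZero K]
    {ω : K} {M : ℕ} {q b : ℤ} (hω : IsPrimitiveRoot ω M) (hM : Odd M)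
    (hq : (M : ℤ) ∣ q ^ 2 + 1) (hb : IsCoprime b M)
    (h : quarticPeriod q (ω ^ b) = quarticPeriod q ω) :
    (M : ℤ) ∣ b - 1 ∨ (M : ℤ) ∣ b - q ∨ (M : ℤ) ∣ b + 1 ∨ (M : ℤ) ∣ b + q := by
  rcases eq_or_ne M 1 with rfl | hM₁
  · simp
  obtain ⟨p, hp, k, rfl⟩ := Nat.exists_prime_and_dvd hM₁
  have hpM : (p : ℤ) ∣ ((p * k : ℕ) : ℤ) := by simp
  have hp₂ : p ≠ 2 := by
    rintro rfl
    exact (Nat.not_even_iff_odd.mpr hM) (even_two_mul k)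
  have hω₀ : ω ≠ 0 := hω.ne_zero hM.pos.ne'
  obtain ⟨h2, hq₀, hq₁, hq₂⟩ := odd_prime_not_dvd hp hp₂ (hpM.trans hq)
  have hpp : Prime (p : ℤ) := Nat.prime_iff_prime_int.mp hp
  have hpb : ¬ (p : ℤ) ∣ b := fun h => hpp.not_isUnit (hb.isUnit_of_dvd' h hpM)
  have hp1 : ¬ (p : ℤ) ∣ 1 := fun h => hpp.not_isUnit (isUnit_of_dvd_one h)
  have key (c : ℤ) (hc : ω ^ b = ω ^ c) : ((p * k : ℕ) : ℤ) ∣ b - c := by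
    rw [← hω.zpow_eq_one_iff_dvd, zpow_sub₀ hω₀, hc, div_self (zpow_ne_zero _ hω₀)]
  obtain ⟨f, hf⟩ := hω.exists_residue_projection hp hM.pos b
  have e₁ : f (ω ^ b) = ω ^ b := by rw [hf _ hpb]; simp
  have e₂ : f (ω ^ (b * q)) = 0 := by
    rw [hf _ (by simp [hpp.dvd_mul, hpb, hq₀]), if_neg]
    rw [show b * q - b = b * (q - 1) by ring, hpp.dvd_mul]
    tauto
  have e₃ : f (ω ^ (b * -1)) = 0 := by
    rw [hf _ (by simpa using hpb), if_neg]
    rw [show b * -1 - b = -(b * 2) by ring, dvd_neg, hpp.dvd_mul]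
    tauto
  have e₄ : f (ω ^ (b * -q)) = 0 := by
    rw [hf _ (by simp [hpp.dvd_mul, hpb, hq₀]), if_neg]
    rw [show b * -q - b = -(b * (q + 1)) by ring, dvd_neg, hpp.dvd_mul]
    tauto
  have h' := congrArg f h
  simp only [quarticPeriod, ← zpow_mul, map_add, e₁, e₂, e₃, e₄, add_zero] at h'
  have d₁ := hf 1 hp1
  have d₂ := hf q hq₀
  have d₃ := hf (-1) (by simpa using hp1)
  have d₄ := hf (-q) (by simpa using hq₀)
  rw [zpow_one] at d₁
  rw [d₁, d₂, d₃, d₄] at h'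
  have s₁ (x y : ℤ) (hxy : ¬ (p : ℤ) ∣ x - y) (hx : (p : ℤ) ∣ x - b) : ¬ (p : ℤ) ∣ y - b :=
    fun hy => hxy (by simpa using dvd_sub hx hy)
  have n₁ : ¬ (p : ℤ) ∣ 1 - q := by rwa [dvd_sub_comm]
  have n₂ : ¬ (p : ℤ) ∣ 1 - -1 := by simpa using h2
  have n₃ : ¬ (p : ℤ) ∣ 1 - -q := by simpa [add_comm] using hq₂
  have n₄ : ¬ (p : ℤ) ∣ q - -1 := by simpa using hq₂
  have n₅ : ¬ (p : ℤ) ∣ q - -q := by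
    rw [sub_neg_eq_add, ← two_mul, hpp.dvd_mul]; tauto
  have n₆ : ¬ (p : ℤ) ∣ -1 - -q := by simpa [neg_add_eq_sub] using hq₁
  by_cases c₁ : (p : ℤ) ∣ 1 - b
  · simp [c₁, s₁ _ _ n₁ c₁, s₁ _ _ n₂ c₁, s₁ _ _ n₃ c₁, -zpow_neg] at h'
    exact Or.inl (key 1 (by simpa using h'))
  by_cases c₂ : (p : ℤ) ∣ q - b
  · simp [c₁, c₂, s₁ _ _ n₄ c₂, s₁ _ _ n₅ c₂, -zpow_neg] at h'
    exact Or.inr (Or.inl (key q h'))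
  by_cases c₃ : (p : ℤ) ∣ -1 - b
  · simp only [c₁, c₂, c₃, s₁ _ _ n₆ c₃, if_true, if_false, zero_add, add_zero] at h'
    exact Or.inr (Or.inr (Or.inl (by simpa using key (-1) h')))
  by_cases c₄ : (p : ℤ) ∣ -q - b
  · simp only [c₁, c₂, c₃, c₄, if_true, if_false, zero_add] at h'
    exact Or.inr (Or.inr (Or.inr (by simpa using key (-q) h')))
  · simp only [c₁, c₂, c₃, c₄, if_false, add_zero] at h'
    exact absurd h' (zpow_ne_zero _ hω₀)

/-- If every unit modulo `M` that is `1` modulo a proper divisor `g` of `M` lies in the subgroup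
generated by `q`, where `q ^ 2 = -1`, then `M = 5`. -/
lemma eq_five_of_forall_coprime_dvd {M g : ℕ} {q : ℤ} (hM : Odd M) (hq : (M : ℤ) ∣ q ^ 2 + 1)
    (hg : g ∣ M) (hgM : g ≠ M)
    (H : ∀ b : ℤ, IsCoprime b M → (g : ℤ) ∣ b - 1 →
      (M : ℤ) ∣ b - 1 ∨ (M : ℤ) ∣ b - q ∨ (M : ℤ) ∣ b + 1 ∨ (M : ℤ) ∣ b + q) : M = 5 := by
  obtain ⟨t, rfl⟩ := hg
  have ht : t ≠ 1 := by rintro rfl; simp at hgM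
  obtain ⟨p, hp, s, rfl⟩ := Nat.exists_prime_and_dvd ht
  obtain ⟨k, hk⟩ : ∃ k, k = g * s := ⟨_, rfl⟩
  have hM' : g * (p * s) = p * k := by rw [hk]; ring
  have hgk : (g : ℤ) ∣ k := by rw [hk]; simp
  rw [hM'] at hM hq H ⊢
  have hpM : (p : ℤ) ∣ ((p * k : ℕ) : ℤ) := by simp
  have hp₂ : p ≠ 2 := by
    rintro rfl
    exact (Nat.not_even_iff_odd.mpr hM) (even_two_mul k)
  have hkodd : Odd k := (Nat.odd_mul.mp hM).2
  obtain ⟨h2, hq₀, hq₁, hq₂⟩ := odd_prime_not_dvd hp hp₂ (hpM.trans hq)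
  have hpp : Prime (p : ℤ) := Nat.prime_iff_prime_int.mp hp
  have hp1 : ¬ (p : ℤ) ∣ 1 := fun h => hpp.not_isUnit (isUnit_of_dvd_one h)
  by_cases hpk : p ∣ k
  · exfalso
    have hpk' : (p : ℤ) ∣ k := by exact_mod_cast hpk
    have hc : IsCoprime (1 + k : ℤ) ((p * k : ℕ) : ℤ) := by
      have h1 : IsCoprime (1 + k : ℤ) k := ⟨1, -1, by ring⟩
      push_cast
      exact IsCoprime.mul_right (h1.of_isCoprime_of_dvd_right hpk') h1
    rcases H _ hc (by simpa using hgk) with h | h | h | h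
    · rw [add_sub_cancel_left] at h
      have := Nat.le_of_dvd hkodd.pos (by exact_mod_cast h)
      nlinarith [hp.two_le, hkodd.pos]
    · exact hq₁ (by
        have := dvd_sub hpk' (hpM.trans h)
        ring_nf at this; rwa [neg_add_eq_sub] at this)
    · exact h2 (by
        have := dvd_sub (hpM.trans h) hpk'
        ring_nf at this; exact this)
    · exact hq₂ (by
        have := dvd_sub (hpM.trans h) hpk'
        ring_nf at this; rwa [add_comm] at this)
  have hcop : IsCoprime (p : ℤ) k := by
    rw [Nat.isCoprime_iff_coprime]; exact (Nat.Prime.coprime_iff_not_dvd hp).mpr hpk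
  have crt (r : ℤ) (hr : ¬ (p : ℤ) ∣ r) : ∃ b : ℤ, (p : ℤ) ∣ b - r ∧ (k : ℤ) ∣ b - 1 ∧
      (((p * k : ℕ) : ℤ) ∣ b - 1 ∨ ((p * k : ℕ) : ℤ) ∣ b - q ∨ ((p * k : ℕ) : ℤ) ∣ b + 1 ∨
        ((p * k : ℕ) : ℤ) ∣ b + q) := by
    obtain ⟨x, y, hxy⟩ := hcop
    have e₁ : (p : ℤ) ∣ (x * p + r * (y * k)) - r :=
      ⟨x - r * x, by linear_combination r * hxy⟩
    have e₂ : (k : ℤ) ∣ (x * p + r * (y * k)) - 1 :=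
      ⟨r * y - y, by linear_combination hxy⟩
    refine ⟨x * p + r * (y * k), e₁, e₂, H _ ?_ (hgk.trans e₂)⟩
    push_cast
    refine IsCoprime.mul_right ?_ ?_
    · refine ((hpp.coprime_iff_not_dvd).mpr fun h => hr ?_).symm
      simpa using dvd_sub h e₁
    · obtain ⟨z, hz⟩ := e₂
      exact ⟨1, -z, by linear_combination hz⟩
  have hk1 : k = 1 := by
    obtain ⟨b, hb₁, hb₂, hb₃⟩ := crt (-1) (by simpa using hp1)
    have hk2 : (k : ℤ) ∣ 2 := by
      rcases hb₃ with h | h | h | h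
      · exact absurd (by have := dvd_sub hb₁ (hpM.trans h); ring_nf at this; exact this) h2
      · exact absurd (by have := dvd_sub hb₁ (hpM.trans h); ring_nf at this; rwa [add_comm]) hq₂
      · have hkM : (k : ℤ) ∣ ((p * k : ℕ) : ℤ) := by simp
        have := dvd_sub (hkM.trans h) hb₂
        ring_nf at this; exact this
      · refine absurd ?_ hq₁
        have := dvd_sub (hpM.trans h) hb₁; ring_nf at this; rwa [neg_add_eq_sub] at this
    have hk2' : k ∣ 2 := by exact_mod_cast hk2
    rcases (Nat.dvd_prime Nat.prime_two).mp hk2' with h | h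
    · exact h
    · subst h; exact absurd hkodd (by decide)
  subst hk1
  rw [mul_one] at hq crt ⊢
  obtain ⟨b, hb₁, -, hb₃⟩ := crt 2 h2
  have hp₅ (h : (p : ℤ) ∣ 5) : p = 5 :=
    (Nat.prime_dvd_prime_iff_eq hp Nat.prime_five).mp (by exact_mod_cast h)
  rcases hb₃ with h | h | h | h
  · exact absurd (by have := dvd_sub h hb₁; ring_nf at this; exact this) hp1
  · apply hp₅
    have h1 := dvd_sub h hb₁
    have := dvd_add hq (h1.mul_right (q + 2)); ring_nf at this; exact this
  · have h3 : (p : ℤ) ∣ 3 := by have := dvd_sub h hb₁; ring_nf at this; exact this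
    have h3' : p = 3 :=
      (Nat.prime_dvd_prime_iff_eq hp Nat.prime_three).mp (by exact_mod_cast h3)
    subst h3'
    obtain ⟨z, hz⟩ := hq
    have : q % 3 = 0 ∨ q % 3 = 1 ∨ q % 3 = 2 := by omega
    exfalso
    have e := congrArg (· % 3) hz
    rcases this with h | h | h <;> simp [pow_two, Int.add_emod, Int.mul_emod, h] at e
  · apply hp₅
    have h1 := dvd_sub h hb₁
    have := dvd_sub hq (h1.mul_right (q - 2)); ring_nf at this; exact this

/-- The quartic period of a primitive fifth root of unity is `-1`. -/
lemma IsPrimitiveRoot.quarticPeriod_eq_neg_one {K : Type*} [Field K] {ω : K} {q : ℤ}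
    (hω : IsPrimitiveRoot ω 5) (hq : (5 : ℤ) ∣ q ^ 2 + 1) : quarticPeriod q ω = -1 := by
  have hω₀ : ω ≠ 0 := hω.ne_zero (by norm_num)
  have hsum := hω.geom_sum_eq_zero (by norm_num)
  simp only [Finset.sum_range_succ, Finset.sum_range_zero] at hsum
  have key (a : ℤ) (c : ℕ) (h : (5 : ℤ) ∣ a - c) : ω ^ a = ω ^ c := by
    have h1 : ω ^ (a - c) = 1 := (hω.zpow_eq_one_iff_dvd _).mpr (by exact_mod_cast h)
    rw [zpow_sub₀ hω₀, div_eq_one_iff_eq (zpow_ne_zero _ hω₀)] at h1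
    rw [h1, zpow_natCast]
  have hcases : q % 5 = 2 ∨ q % 5 = 3 := by
    have : q % 5 = 0 ∨ q % 5 = 1 ∨ q % 5 = 2 ∨ q % 5 = 3 ∨ q % 5 = 4 := by omega
    have e := Int.emod_eq_zero_of_dvd hq
    rcases this with h | h | h | h | h <;> simp [pow_two, Int.add_emod, Int.mul_emod, h] at e ⊢
  rcases hcases with h | h
  · rw [quarticPeriod, key q 2 (by omega), key (-1) 4 (by norm_num), key (-q) 3 (by omega)]
    linear_combination hsum
  · rw [quarticPeriod, key q 3 (by omega), key (-1) 4 (by norm_num), key (-q) 2 (by omega)]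
    linear_combination hsum

lemma cycField_mono_s14 {c L : ℕ} (h : c ∣ L) : cycField c ≤ cycField L :=
  Subfield.closure_mono fun z (hz : z ^ c = 1) => by
    obtain ⟨t, rfl⟩ := h
    simp [pow_mul, hz]

lemma mem_cycField {z : ℂ} {L : ℕ} (h : z ^ L = 1) : z ∈ cycField L :=
  Subfield.subset_closure h

lemma isCyclotomicExtension_cycField (L : ℕ) [NeZero L] :
    IsCyclotomicExtension {L} ℚ (cycField L) := by
  have hroot := Complex.isPrimitiveRoot_exp L (NeZero.ne L)
  refine (IsCyclotomicExtension.iff_singleton L ℚ (cycField L)).mpr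
    ⟨⟨⟨_, mem_cycField hroot.pow_eq_one⟩, ?_⟩, ?_⟩
  · exact IsPrimitiveRoot.of_map_of_injective (f := (cycField L).subtype) hroot
      (cycField L).subtype_injective
  · have halg : ∀ b ∈ {b : cycField L | b ^ L = 1}, IsAlgebraic ℚ b := fun b hb =>
      (IsIntegral.of_pow (NeZero.pos L) (by
        rw [show b ^ L = 1 from hb]; exact isIntegral_one)).isAlgebraic
    have hall : ∀ (x : ℂ) (hx : x ∈ cycField L),
        (⟨x, hx⟩ : cycField L) ∈ IntermediateField.adjoin ℚ {b : cycField L | b ^ L = 1} := by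
      intro x hx
      induction hx using Subfield.closure_induction with
      | mem x hx => exact subset_adjoin _ _ (Subtype.ext hx)
      | one => exact one_mem _
      | add x y _ _ h₁ h₂ => exact add_mem h₁ h₂
      | neg x _ h => exact neg_mem h
      | inv x _ h => exact inv_mem h
      | mul x y _ _ h₁ h₂ => exact mul_mem h₁ h₂
    intro x
    rw [← adjoin_toSubalgebra_of_isAlgebraic halg]
    exact hall x x.2

/-- The automorphism of `ℚ(ζ_L)` raising the `L`-th roots of unity to the power `x`. -/
lemma exists_algEquiv_cycField_pow {L x : ℕ} [NeZero L] (hx : x.Coprime L) :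
    ∃ τ : cycField L ≃ₐ[ℚ] cycField L, ∀ u, u ^ L = 1 → τ u = u ^ x := by
  have := isCyclotomicExtension_cycField L
  have hz := IsCyclotomicExtension.zeta_spec L ℚ (cycField L)
  have hzx := hz.pow_of_coprime x hx
  have hirr := Polynomial.cyclotomic.irreducible_rat (NeZero.pos L)
  refine ⟨IsCyclotomicExtension.fromZetaAut hzx hirr, fun u hu => ?_⟩
  obtain ⟨i, -, rfl⟩ := hz.eq_pow_of_pow_eq_one hu
  rw [map_pow, IsCyclotomicExtension.fromZetaAut_spec, ← pow_mul, ← pow_mul, mul_comm]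

/-- A cyclotomic field containing a quartic period other than `-1` contains the corresponding
root of unity. -/
lemma IsPrimitiveRoot.dvd_of_quarticPeriod_mem_cycField {ω : ℂ} {M c : ℕ} {q : ℤ}
    (hω : IsPrimitiveRoot ω M) (hM : Odd M) (hq : (M : ℤ) ∣ q ^ 2 + 1) (hc : 0 < c)
    (hmem : quarticPeriod q ω ∈ cycField c) (hne : quarticPeriod q ω ≠ -1) : M ∣ c := by
  by_contra hMc
  have hg : Nat.gcd c M ≠ M := fun h => hMc (h ▸ Nat.gcd_dvd_left c M)
  have h5 := eq_five_of_forall_coprime_dvd hM hq (Nat.gcd_dvd_right c M) hg ?_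
  · subst h5
    exact hne (hω.quarticPeriod_eq_neg_one (by exact_mod_cast hq))
  intro b hb hb₁
  have hM₀ : (0 : ℤ) < M := by exact_mod_cast hM.pos
  obtain ⟨b', hb'⟩ := Int.eq_ofNat_of_zero_le (Int.emod_nonneg b hM₀.ne')
  have hbb : (M : ℤ) ∣ b - b' := by rw [← hb']; exact Int.dvd_self_sub_emod
  have hgb : 1 ≡ b' [MOD Nat.gcd c M] := by
    rw [Nat.modEq_iff_dvd]
    have hgM : ((Nat.gcd c M : ℕ) : ℤ) ∣ M := by exact_mod_cast Nat.gcd_dvd_right c M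
    have := dvd_sub hb₁ (hgM.trans hbb)
    push_cast
    simpa using this
  obtain ⟨x, hx₁, hx₂⟩ := Nat.chineseRemainder' hgb
  have hxb : (M : ℤ) ∣ b - x := by
    have := (Nat.modEq_iff_dvd.mp hx₂)
    simpa using dvd_add hbb this
  have hxM : x.Coprime M := by
    rw [← Nat.isCoprime_iff_coprime]
    obtain ⟨z, hz⟩ := hxb
    have : (x : ℤ) = b + M * (-z) := by linear_combination -hz
    rw [this]
    exact IsCoprime.add_mul_left_left hb _
  have hxc : x.Coprime c := by
    rw [Nat.coprime_iff_gcd_eq_one, hx₁.gcd_eq, Nat.gcd_one_left]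
  have hL₀ : 0 < c * M := Nat.mul_pos hc hM.pos
  have : NeZero (c * M) := ⟨hL₀.ne'⟩
  obtain ⟨τ, hτ⟩ := exists_algEquiv_cycField_pow (hxc.mul_right hxM)
  have hle := cycField_mono_s14 (dvd_mul_right c M)
  have hfix : ∀ y (hy : y ∈ cycField c), τ ⟨y, hle hy⟩ = ⟨y, hle hy⟩ := by
    intro y hy
    induction hy using Subfield.closure_induction with
    | mem y hy =>
      have hy' : y ^ c = 1 := hy
      rw [hτ _ (Subtype.ext (by simp [pow_mul, hy']))]
      refine Subtype.ext ?_
      change y ^ x = y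
      rw [pow_eq_pow_mod x hy', hx₁, ← pow_eq_pow_mod 1 hy', pow_one]
    | one => exact map_one τ
    | add x y _ _ h₁ h₂ =>
      exact (map_add τ ⟨x, _⟩ ⟨y, _⟩).trans (by rw [h₁, h₂])
    | neg x _ h => exact (map_neg τ ⟨x, _⟩).trans (by rw [h])
    | inv x _ h => exact (map_inv₀ τ ⟨x, _⟩).trans (by rw [h])
    | mul x y _ _ h₁ h₂ => exact (map_mul τ ⟨x, _⟩ ⟨y, _⟩).trans (by rw [h₁, h₂])
  have hωL : ω ^ (c * M) = 1 := by rw [mul_comm, pow_mul, hω.pow_eq_one, one_pow]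
  let w : cycField (c * M) := ⟨ω, mem_cycField hωL⟩
  have hτw : τ w = w ^ x := hτ w (Subtype.ext hωL)
  have hper : τ (quarticPeriod q w) = quarticPeriod q w := by
    convert! hfix _ hmem using 2
  rw [map_quarticPeriod, hτw] at hper
  have hper' : quarticPeriod q (ω ^ x) = quarticPeriod q ω := by
    have := congrArg (cycField (c * M)).subtype hper
    rw [map_quarticPeriod, map_quarticPeriod, map_pow] at this
    exact this
  apply hω.dvd_of_quarticPeriod_zpow_eq hM hq hb
  rw [← hper']
  congr 1
  have h1 : ω ^ (b - x) = 1 := (hω.zpow_eq_one_iff_dvd _).mpr hxb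
  have hω₀ := hω.ne_zero hM.pos.ne'
  rw [zpow_sub₀ hω₀, div_eq_one_iff_eq (zpow_ne_zero _ hω₀)] at h1
  rw [h1, zpow_natCast]

/-- An element of `ℚ(ω)` fixed by `ω ↦ ω ^ q` lies in the field generated by the quartic period. -/
lemma IsPrimitiveRoot.mem_adjoin_quarticPeriod {K : Type*} [Field K] [CharZero K] {M : ℕ}
    [IsCyclotomicExtension {M} ℚ K] {w : K} {q : ℤ} (hw : IsPrimitiveRoot w M) (hM : Odd M)
    (hq : (M : ℤ) ∣ q ^ 2 + 1) (s : K →ₐ[ℚ] K) (hs : s w = w ^ q) {y : K} (hy : s y = y) :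
    y ∈ ℚ⟮quarticPeriod q w⟯ := by
  have : NeZero M := ⟨hM.pos.ne'⟩
  have hw₀ : w ≠ 0 := hw.ne_zero hM.pos.ne'
  have := IsCyclotomicExtension.isGalois {M} ℚ K
  have := IsCyclotomicExtension.finiteDimensional {M} ℚ K
  rw [← IsGalois.fixedField_fixingSubgroup ℚ⟮quarticPeriod q w⟯, mem_fixedField_iff]
  intro τ hτ
  have hτα : τ (quarticPeriod q w) = quarticPeriod q w :=
    (mem_fixingSubgroup_iff _ τ).mp hτ _ (mem_adjoin_simple_self _ _)
  have hτw : IsPrimitiveRoot (τ w) M := hw.map_of_injective τ.injective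
  obtain ⟨b, -, hbM, hb⟩ := (hw.isPrimitiveRoot_iff).mp hτw
  rw [map_quarticPeriod, ← hb, ← zpow_natCast] at hτα
  have hdvd : ∃ i : ℕ, (M : ℤ) ∣ b - q ^ i := by
    rcases hw.dvd_of_quarticPeriod_zpow_eq hM hq (Nat.isCoprime_iff_coprime.mpr hbM) hτα with
      h | h | h | h
    · exact ⟨0, by simpa using h⟩
    · exact ⟨1, by simpa using h⟩
    · exact ⟨2, (show (b : ℤ) + 1 - (q ^ 2 + 1) = b - q ^ 2 by ring) ▸ dvd_sub h hq⟩
    · exact ⟨3, (show (b : ℤ) + q - (q ^ 2 + 1) * q = b - q ^ 3 by ring) ▸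
        dvd_sub h (hq.mul_right q)⟩
  obtain ⟨i, hi⟩ := hdvd
  have hsw (i : ℕ) : (s ^ i) w = w ^ (q ^ i) := by
    induction i with
    | zero => simp
    | succ i ih => rw [pow_succ', AlgHom.mul_apply, ih, map_zpow₀, hs, ← zpow_mul, pow_succ']
  have hsy (i : ℕ) : (s ^ i) y = y := by
    induction i with
    | zero => simp
    | succ i ih => rw [pow_succ', AlgHom.mul_apply, ih, hy]
  have hτs : (τ : K →ₐ[ℚ] K) = s ^ i := by
    apply (hw.powerBasis ℚ).algHom_ext
    rw [hw.powerBasis_gen ℚ, hsw]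
    change τ w = _
    have h1 := (hw.zpow_eq_one_iff_dvd _).mpr hi
    rw [zpow_sub₀ hw₀, div_eq_one_iff_eq (zpow_ne_zero _ hw₀), zpow_natCast] at h1
    rw [← hb, h1]
  exact (DFunLike.congr_fun hτs y).trans (hsy i)

/-- The numbers `q ± √(2q) + 1` are odd divisors of `q ^ 2 + 1`. -/
lemma odd_and_dvd_sq_add_one {n q N : ℕ} (hn : 1 ≤ n) (hq : q = 2 ^ (2 * n + 1))
    (hN : N = q + 2 ^ (n + 1) + 1 ∨ N = q - 2 ^ (n + 1) + 1) :
    Odd N ∧ (N : ℤ) ∣ (q : ℤ) ^ 2 + 1 := by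
  have hle : 2 ^ (n + 1) ≤ q := hq ▸ Nat.pow_le_pow_right (by norm_num) (by omega)
  have hq2 : Even q := hq ▸ (Nat.even_pow.mpr ⟨even_two, by omega⟩)
  have hs2 : Even (2 ^ (n + 1)) := Nat.even_pow.mpr ⟨even_two, by omega⟩
  have hs : ((2 : ℤ) ^ (n + 1)) ^ 2 = 2 * q := by rw [hq]; push_cast; ring
  rcases hN with rfl | rfl
  · exact ⟨(hq2.add hs2).add_one, q - 2 ^ (n + 1) + 1, by push_cast; linear_combination hs⟩
  · refine ⟨((Nat.even_sub hle).mpr (by tauto)).add_one, q + 2 ^ (n + 1) + 1, ?_⟩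
    push_cast [hle]
    linear_combination hs

/-- Let `q = 2^{2n+1}` with `n ≥ 1`, let `ζ` be a primitive `N`-th root of unity where
`N = q ± 2^{n+1} + 1`, and let `α_m = ζ^m + ζ^{mq} + ζ^{−m} + ζ^{−mq}` for an integer `m`.
If `α_m` cannot be written as a sum of fewer than four roots of unity, and `σ` is the Galois
automorphism of `ℚ(ζ_{c(α_m)})` sending `ζ^m` to `ζ^{mq}`, then `ℚ(α_m)` is exactly the
subfield of `ℚ(ζ_{c(α_m)})` fixed by `σ`. -/
theorem fixed_field_of_sigma (n : ℕ) (hn : 1 ≤ n) (q : ℕ) (hq : q = 2 ^ (2 * n + 1))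
    (N : ℕ) (hN : N = q + 2 ^ (n + 1) + 1 ∨ N = q - 2 ^ (n + 1) + 1)
    (ζ : ℂ) (hζ : IsPrimitiveRoot ζ N) (m : ℤ)
    (α : ℂ) (hα : α = ζ ^ m + ζ ^ (m * (q : ℤ)) + ζ ^ (-m) + ζ ^ (-(m * (q : ℤ))))
    (hmin : ∀ (j : ℕ) (η : Fin j → ℂ), (∀ i, IsRootOfUnity (η i)) →
      α = ∑ i, η i → 4 ≤ j)
    (σ : cycField (conductorOf {α}) ≃+* cycField (conductorOf {α}))
    (hσ : ∀ x : cycField (conductorOf {α}), (x : ℂ) = ζ ^ m →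
      ((σ x : ℂ) = ζ ^ (m * (q : ℤ)))) :
    (Subfield.closure {α} : Set ℂ) =
      {x : ℂ | ∃ y : cycField (conductorOf {α}), σ y = y ∧ (y : ℂ) = x} := by
  obtain ⟨hNodd, hNdvd⟩ := odd_and_dvd_sq_add_one hn hq hN
  set ω : ℂ := ζ ^ m with hω_def
  have hωN : ω ^ N = 1 := by
    rw [hω_def, ← zpow_natCast, zpow_comm, zpow_natCast, hζ.pow_eq_one, one_zpow]
  obtain ⟨M, hω⟩ : ∃ M, IsPrimitiveRoot ω M := ⟨_, IsPrimitiveRoot.orderOf ω⟩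
  have hMN : M ∣ N := hω.dvd_of_pow_eq_one N hωN
  have hM : Odd M := hNodd.of_dvd_nat hMN
  have hMq : (M : ℤ) ∣ (q : ℤ) ^ 2 + 1 := (Int.natCast_dvd_natCast.mpr hMN).trans hNdvd
  have hαω : α = quarticPeriod (q : ℤ) ω := by
    rw [hα, quarticPeriod, hω_def, ← zpow_mul, ← zpow_mul, ← zpow_mul, mul_neg_one, mul_neg]
  have hne : quarticPeriod (q : ℤ) ω ≠ -1 := fun h => by
    have := hmin 1 (fun _ => -1) (fun _ => ⟨2, by norm_num, by norm_num⟩) (by simp [hαω, h])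
    omega
  have hmemM : α ∈ cycField M := by
    have := mem_cycField hω.pow_eq_one
    rw [hαω]
    exact add_mem (add_mem (add_mem this (zpow_mem this _)) (zpow_mem this _)) (zpow_mem this _)
  have hM_mem : M ∈ {k : ℕ | 0 < k ∧ {α} ⊆ (cycField k : Set ℂ)} :=
    ⟨hM.pos, Set.singleton_subset_iff.mpr hmemM⟩
  obtain ⟨hc₀, hc₁⟩ := Nat.sInf_mem ⟨M, hM_mem⟩
  have hcond : conductorOf {α} = M := by
    refine le_antisymm (Nat.sInf_le hM_mem) (Nat.le_of_dvd hc₀ ?_)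
    exact hω.dvd_of_quarticPeriod_mem_cycField hM hMq hc₀
      (hαω ▸ Set.singleton_subset_iff.mp hc₁) hne
  rw [zpow_mul, ← hω_def] at hσ
  generalize conductorOf {α} = c at σ hσ hcond ⊢
  subst hcond
  have : NeZero c := ⟨hM.pos.ne'⟩
  have := isCyclotomicExtension_cycField c
  let w : cycField c := ⟨ω, mem_cycField hω.pow_eq_one⟩
  have hw : IsPrimitiveRoot w c := IsPrimitiveRoot.of_map_of_injective
    (f := (cycField c).subtype) hω (cycField c).subtype_injective
  have hσw : σ w = w ^ (q : ℤ) := Subtype.ext (hσ w rfl)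
  have hwα : ((quarticPeriod (q : ℤ) w : cycField c) : ℂ) = α :=
    (map_quarticPeriod (cycField c).subtype q w).trans hαω.symm
  have hσα : σ (quarticPeriod (q : ℤ) w) = quarticPeriod (q : ℤ) w := by
    have hw₀ : w ≠ 0 := hw.ne_zero hM.pos.ne'
    have hwq : (w ^ (q : ℤ)) ^ (q : ℤ) = w ^ (-1 : ℤ) := by
      have h := (hw.zpow_eq_one_iff_dvd _).mpr hMq
      rw [zpow_add₀ hw₀, zpow_one, pow_two, zpow_mul] at h
      rw [zpow_neg_one]
      exact eq_inv_of_mul_eq_one_left h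
    rw [map_quarticPeriod, hσw, quarticPeriod, quarticPeriod, zpow_neg _ (q : ℤ), hwq,
      zpow_neg, zpow_neg, zpow_neg, zpow_one, zpow_one, inv_inv]
    ring
  ext x
  constructor
  · intro hx
    have hle : Subfield.closure {α} ≤ cycField c := Subfield.closure_le.mpr (by simpa using hmemM)
    refine ⟨⟨x, hle hx⟩, ?_, rfl⟩
    induction hx using Subfield.closure_induction with
    | mem x hx =>
      obtain rfl : x = α := hx
      convert! hσα using 2
      exact Subtype.ext hwα.symm
    | one => exact map_one σ
    | add x y _ _ h₁ h₂ => exact (map_add σ ⟨x, _⟩ ⟨y, _⟩).trans (by rw [h₁, h₂])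
    | neg x _ h => exact (map_neg σ ⟨x, _⟩).trans (by rw [h])
    | inv x _ h => exact (map_inv₀ σ ⟨x, _⟩).trans (by rw [h])
    | mul x y _ _ h₁ h₂ => exact (map_mul σ ⟨x, _⟩ ⟨y, _⟩).trans (by rw [h₁, h₂])
  · rintro ⟨y, hy, rfl⟩
    have hmem := hw.mem_adjoin_quarticPeriod hM hMq (σ : cycField c →+* cycField c).toRatAlgHom
      hσw hy
    clear hy
    induction hmem using adjoin_induction with
    | mem x hx =>
      obtain rfl := Set.mem_singleton_iff.mp hx
      rw [hwα]
      exact Subfield.subset_closure rfl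
    | algebraMap x => simp
    | add x y _ _ h₁ h₂ => exact add_mem h₁ h₂
    | inv x _ h => exact inv_mem h
    | mul x y _ _ h₁ h₂ => exact mul_mem h₁ h₂
end
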